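/- arXiv:1007.3442 — 7 statements merged into one kernel-verified Lean document; each statement's English description precedes it below -/
import Mathlib

section
/- If M is an endo-trivial kX-module and M ≅ U ⊗ V for kX-modules U and V, then both U and V are endo-trivial kX-modules. -/
open CategoryTheory Limits MonoidalCategory

/-- A `kX`-module `M` is endo-trivial if `M ⊗ M* ≅ k ⊕ N` with `N` projective. -/
noncomputable def IsEndoTrivial {k : Type} [Field k] {G : Type} [Group G] (M : Rep k G) : Prop :=
  ∃ N : Rep k G, Projective N ∧ Nonempty (M ⊗ Rep.of M.ρ.dual ≅ 𝟙_ (Rep k G) ⊞ N)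

section Helpers

variable {k : Type} [Field k] {X : Type} [Group X]

/-- The regular-type representation on functions `X → N`, acting by left translation. -/
noncomputable def funRep (X : Type) [Group X] (N : Type) [AddCommGroup N] [Module k N] :
    Representation k X (X → N) where
  toFun g := LinearMap.funLeft k N (fun h => g⁻¹ * h)
  map_one' := by
    ext f h
    simp [LinearMap.funLeft]
  map_mul' g g' := by
    refine LinearMap.ext fun f => funext fun h => ?_
    simp [LinearMap.funLeft, mul_assoc]

/-- The evaluation map `f ↦ ∑ h, h • f h`. -/
noncomputable def funRepHom [Fintype X] (N : Rep k X) :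
    Rep.of (funRep (k := k) X N.V) ⟶ N :=
  Rep.ofHom (σ := N.ρ) ⟨
    (∑ h : X, (N.ρ h) ∘ₗ LinearMap.proj h : (X → N.V) →ₗ[k] N.V), (by
      intro g
      refine LinearMap.ext fun f => ?_
      simp only [LinearMap.sum_apply, LinearMap.comp_apply, LinearMap.proj_apply, map_sum]
      rw [← Equiv.sum_comp (Equiv.mulLeft g)]
      refine Finset.sum_congr rfl fun h _ => ?_
      simp [funRep, LinearMap.funLeft])⟩

lemma funRepHom_apply [Fintype X] (N : Rep k X) (f : X → N.V) :
    (funRepHom N).hom f = ∑ h : X, N.ρ h (f h) := by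
  change (∑ h : X, (N.ρ h) ∘ₗ LinearMap.proj h : (X → N.V) →ₗ[k] N.V) f = _
  simp

/-- A projective module has dimension zero in `k`. -/
lemma finrank_projective [Fintype X] (hX : (Fintype.card X : k) = 0) (N : Rep.{0} k X)
    [Projective N] [FiniteDimensional k N.V] : (Module.finrank k N.V : k) = 0 := by
  classical
  have hsurj : Function.Surjective (funRepHom N).hom := by
    intro n
    refine ⟨Pi.single 1 n, ?_⟩
    rw [funRepHom_apply, Finset.sum_eq_single 1]
    · simp
    · intro b _ hb
      simp [Pi.single_eq_of_ne hb]
    · simp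
  have : Epi (funRepHom N) := (Rep.epi_iff_surjective _).2 hsurj
  let s := Projective.factorThru (𝟙 N) (funRepHom N)
  have hs : s ≫ funRepHom N = 𝟙 N := Projective.factorThru_comp _ _
  let θ : N.V →ₗ[k] N.V := LinearMap.proj (1 : X) ∘ₗ s.hom.toLinearMap
  have key : (LinearMap.id : N.V →ₗ[k] N.V) = ∑ g : X, N.ρ g ∘ₗ (θ ∘ₗ N.ρ g⁻¹) := by
    ext n
    have h1 : (funRepHom N).hom (s.hom n) = n := by
      have := congrArg (fun t => t.hom n) hs
      simpa using this
    rw [funRepHom_apply] at h1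
    rw [LinearMap.sum_apply, LinearMap.id_apply]
    conv_lhs => rw [← h1]
    refine Finset.sum_congr rfl fun g _ => ?_
    have h2 : s.hom (N.ρ g⁻¹ n) = funRep (k := k) X N.V g⁻¹ (s.hom n) :=
      Rep.hom_comm_apply s g⁻¹ n
    have h3 : θ (N.ρ g⁻¹ n) = (s.hom n : X → N.V) g := by
      change (s.hom (N.ρ g⁻¹ n) : X → N.V) 1 = _
      rw [h2]
      simp [funRep, LinearMap.funLeft]
    simp only [LinearMap.comp_apply]
    rw [h3]
  have htr := congrArg (LinearMap.trace k N.V) key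
  rw [LinearMap.trace_id, map_sum] at htr
  rw [htr]
  have : ∀ g : X, LinearMap.trace k N.V (N.ρ g ∘ₗ (θ ∘ₗ N.ρ g⁻¹)) = LinearMap.trace k N.V θ := by
    intro g
    rw [LinearMap.trace_comp_comm', LinearMap.comp_assoc]
    have : N.ρ g⁻¹ ∘ₗ N.ρ g = LinearMap.id := by
      ext n; simp
    rw [this, LinearMap.comp_id]
  simp [this, hX]

lemma unit_not_projective [Fintype X] (hX : (Fintype.card X : k) = 0) :
    ¬ Projective (𝟙_ (Rep k X)) := by
  intro h
  have : FiniteDimensional k (𝟙_ (Rep k X)).V := inferInstanceAs (FiniteDimensional k k)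
  have := finrank_projective hX (𝟙_ (Rep k X))
  have h1 : Module.finrank k (𝟙_ (Rep k X)).V = 1 := Module.finrank_self k
  rw [h1] at this
  simp at this

lemma rep_hom_ext {A B : Rep k X} (f g : A ⟶ B) (h : ∀ x : A.V, f.hom x = g.hom x) : f = g := by
  apply Rep.hom_ext
  exact Representation.IntertwiningMap.ext (LinearMap.ext h)

lemma unit_end_apply (f : 𝟙_ (Rep k X) ⟶ 𝟙_ (Rep k X)) (x : k) :
    f.hom x = x * (f.hom (1 : k) : k) := by
  have := f.hom.toLinearMap.map_smul x (1 : k)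
  simpa using this

lemma unit_end_comm (f g : 𝟙_ (Rep k X) ⟶ 𝟙_ (Rep k X)) : f ≫ g = g ≫ f := by
  refine rep_hom_ext _ _ fun x => ?_
  change g.hom (f.hom (x : k)) = f.hom (g.hom (x : k))
  rw [unit_end_apply f x, unit_end_apply g x, unit_end_apply g (x * _),
    unit_end_apply f (x * _)]
  ring

lemma unit_end_isIso (f : 𝟙_ (Rep k X) ⟶ 𝟙_ (Rep k X)) (hf : f ≠ 0) : IsIso f := by
  have hc : (f.hom (1 : k) : k) ≠ 0 := by
    intro h
    apply hf
    refine rep_hom_ext _ _ fun x => ?_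
    change f.hom (x : k) = 0
    rw [unit_end_apply, h, mul_zero]
  refine ⟨(f.hom (1 : k) : k)⁻¹ • 𝟙 _, ?_, ?_⟩
  · refine rep_hom_ext _ _ fun x => ?_
    change (f.hom (1 : k) : k)⁻¹ • (f.hom (x : k) : k) = x
    rw [unit_end_apply f x, smul_eq_mul]
    field_simp
  · refine rep_hom_ext _ _ fun x => ?_
    change (f.hom ((f.hom (1 : k) : k)⁻¹ • (x : k)) : k) = x
    rw [unit_end_apply, smul_eq_mul]
    field_simp

/-- Cancellation of the trivial module. -/
lemma projective_of_cancel [Fintype X] (hX : (Fintype.card X : k) = 0) (A N : Rep k X)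
    [Projective N] (F : 𝟙_ (Rep k X) ⊞ A ≅ 𝟙_ (Rep k X) ⊞ N) : Projective A := by
  have h0 : ∀ (u : 𝟙_ (Rep k X) ⟶ N) (v : N ⟶ 𝟙_ (Rep k X)), u ≫ v = 0 := by
    intro u v
    by_contra h
    have := unit_end_isIso _ h
    exact unit_not_projective hX (Retract.projective (Y := N)
      { i := u, r := v ≫ inv (u ≫ v), retract := by rw [← Category.assoc]; simp })
  have h1 : (biprod.inl ≫ F.hom ≫ biprod.fst) ≫ (biprod.inl ≫ F.inv ≫ biprod.fst)
      = 𝟙 (𝟙_ (Rep k X)) := by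
    have e1 : (𝟙 (𝟙_ (Rep k X))) =
        biprod.inl ≫ F.hom ≫ (biprod.fst ≫ biprod.inl + biprod.snd ≫ biprod.inr) ≫
          F.inv ≫ biprod.fst := by
      rw [biprod.total]; simp
    rw [e1]
    have := h0 (biprod.inl ≫ F.hom ≫ biprod.snd) (biprod.inr ≫ F.inv ≫ biprod.fst)
    simp only [Category.assoc] at this
    simp only [Preadditive.comp_add, Preadditive.add_comp, Category.assoc, this, add_zero]
  have : IsIso (biprod.inl ≫ F.hom ≫ biprod.fst : 𝟙_ (Rep k X) ⟶ 𝟙_ (Rep k X)) :=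
    ⟨_, h1, by rw [unit_end_comm]; exact h1⟩
  exact Projective.of_iso (Biprod.isoElim F).symm inferInstance

/-- A split mono gives a direct sum decomposition. -/
lemma exists_compl {A E : Rep k X} (i : A ⟶ E) (r : E ⟶ A) (h : i ≫ r = 𝟙 A) :
    ∃ R : Rep k X, Nonempty (E ≅ A ⊞ R) := by
  refine ⟨cokernel i, ⟨ShortComplex.Splitting.isoBinaryBiproduct
    (S := ShortComplex.mk i (cokernel.π i) (by simp))
    { r := r, s := cokernel.desc i (𝟙 E - r ≫ i) (by simp [reassoc_of% h]), f_r := h,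
      s_g := ?_, id := ?_ }⟩⟩
  · apply coequalizer.hom_ext
    simp
  · simp

/-- The endomorphism representation. -/
noncomputable abbrev endRep (U : Rep k X) : Rep k X := Rep.of (Representation.linHom U.ρ U.ρ)

noncomputable def endRepIso (U : Rep k X) [FiniteDimensional k U.V] :
    U ⊗ Rep.of U.ρ.dual ≅ endRep U :=
  (β_ _ _) ≪≫ Rep.mkIso (.mk (dualTensorHomEquiv k U.V U.V) (fun g => by
    have := Representation.dualTensorHom_comm U.ρ U.ρ g
    exact this))

noncomputable def endRepTensor (U V : Rep k X) [FiniteDimensional k U.V] [FiniteDimensional k V.V] :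
    endRep U ⊗ endRep V ≅ endRep (U ⊗ V) :=
  Rep.mkIso (.mk (homTensorHomEquiv k U.V V.V U.V V.V) (fun g => by
    rw [homTensorHomEquiv_toLinearMap]
    refine TensorProduct.ext' fun f f' => ?_
    refine TensorProduct.ext' fun u v => ?_
    rfl))

noncomputable def endRepCongr {U V : Rep k X} (e : U ≅ V) : endRep U ≅ endRep V :=
  Rep.mkIso (.mk (Representation.equivOfIso e).toLinearEquiv.conj (fun g => by
    ext f v
    have h1 := Rep.hom_comm_apply e.inv g⁻¹ v
    have h2 := Rep.hom_comm_apply e.hom g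
    change e.hom.hom (U.ρ g (f (U.ρ g⁻¹ (e.inv.hom v)))) =
      V.ρ g (e.hom.hom (f (e.inv.hom (V.ρ g⁻¹ v))))
    rw [h1, h2]))

noncomputable def endUnit (U : Rep k X) : 𝟙_ (Rep k X) ⟶ endRep U :=
  Rep.ofHom (ρ := Representation.trivial k X k) ⟨LinearMap.toSpanSingleton k (U.V →ₗ[k] U.V) LinearMap.id, (by
      intro g
      ext u
      simp)⟩

noncomputable def endTrace (U : Rep k X) [FiniteDimensional k U.V] : endRep U ⟶ 𝟙_ (Rep k X) :=
  Rep.ofHom (σ := Representation.trivial k X k) ⟨LinearMap.trace k U.V, (by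
      intro g
      refine LinearMap.ext fun f => ?_
      have : U.ρ g⁻¹ ∘ₗ U.ρ g = LinearMap.id := by
        ext n; simp
      change LinearMap.trace k U.V (U.ρ g ∘ₗ f ∘ₗ U.ρ g⁻¹) = LinearMap.trace k U.V f
      rw [LinearMap.trace_comp_comm', LinearMap.comp_assoc, this, LinearMap.comp_id])⟩

lemma endUnit_trace (U : Rep k X) [FiniteDimensional k U.V] :
    endUnit U ≫ endTrace U = (Module.finrank k U.V : k) • 𝟙 _ := by
  refine rep_hom_ext _ _ fun x => ?_
  change LinearMap.trace k U.V ((x : k) • LinearMap.id) = (Module.finrank k U.V : k) • (x : k)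
  rw [map_smul, LinearMap.trace_id, smul_eq_mul, smul_eq_mul, mul_comm]

lemma finrank_sq [Fintype X] (hX : (Fintype.card X : k) = 0) (M : Rep k X)
    [FiniteDimensional k M.V] (hM : IsEndoTrivial M) : (Module.finrank k M.V : k) ≠ 0 := by
  obtain ⟨N, hN, ⟨F⟩⟩ := hM
  have hF : (F.hom ≫ biprod.fst) ≫ (biprod.inl ≫ F.inv) +
      (F.hom ≫ biprod.snd) ≫ (biprod.inr ≫ F.inv) = 𝟙 _ := by
    have : F.hom ≫ (biprod.fst ≫ biprod.inl + biprod.snd ≫ biprod.inr) ≫ F.inv = 𝟙 _ := by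
      rw [biprod.total]; simp
    simpa only [Preadditive.comp_add, Preadditive.add_comp, Category.assoc] using this
  have h11 : (biprod.inl ≫ F.inv) ≫ (F.hom ≫ biprod.fst) = 𝟙 _ := by simp
  have h12 : (biprod.inl ≫ F.inv) ≫ (F.hom ≫ biprod.snd) = 0 := by simp
  have h21 : (biprod.inr ≫ F.inv) ≫ (F.hom ≫ biprod.fst) = 0 := by simp
  have h22 : (biprod.inr ≫ F.inv) ≫ (F.hom ≫ biprod.snd) = 𝟙 _ := by simp
  generalize F.hom ≫ biprod.fst = f1 at *
  generalize F.hom ≫ biprod.snd = f2 at *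
  generalize biprod.inl ≫ F.inv = i1 at *
  generalize biprod.inr ≫ F.inv = i2 at *
  let e : TensorProduct k M.V (Module.Dual k M.V) ≃ₗ[k] k × N.V :=
    LinearEquiv.ofLinearMap
      (LinearMap.prod f1.hom.toLinearMap f2.hom.toLinearMap)
      (LinearMap.coprod i1.hom.toLinearMap i2.hom.toLinearMap)
      (by
        refine LinearMap.prod_ext (LinearMap.ext fun c => ?_) (LinearMap.ext fun n => ?_)
        · have e1 := congrArg (fun t => t.hom c) h11
          have e2 := congrArg (fun t => t.hom c) h12
          refine Prod.ext ?_ ?_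
          · simpa using e1
          · simpa using e2
        · have e1 := congrArg (fun t => t.hom n) h21
          have e2 := congrArg (fun t => t.hom n) h22
          refine Prod.ext ?_ ?_
          · simpa using e1
          · simpa using e2)
      (by
        refine LinearMap.ext fun x => ?_
        exact congrArg (fun t => t.hom x) hF)
  have : FiniteDimensional k (k × N.V) := Module.Finite.equiv e
  have : FiniteDimensional k N.V :=
    Module.Finite.of_surjective (LinearMap.snd k k N.V) LinearMap.snd_surjective
  have h := e.finrank_eq
  rw [Module.finrank_tensorProduct, Subspace.dual_finrank_eq, Module.finrank_prod,
    Module.finrank_self] at h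
  have h2 := congrArg (Nat.cast : ℕ → k) h
  push_cast at h2
  rw [finrank_projective hX N] at h2
  intro h3
  simp [h3] at h2

lemma endoTrivial_left [Fintype X] (hX : (Fintype.card X : k) = 0) (M U V : Rep k X)
    [FiniteDimensional k M.V] (hM : IsEndoTrivial M) (e : M ≅ U ⊗ V) : IsEndoTrivial U := by
  have hd := finrank_sq hX M hM
  have h1 : Module.finrank k M.V = Module.finrank k U.V * Module.finrank k V.V := by
    rw [(Representation.equivOfIso e).toLinearEquiv.finrank_eq]
    exact Module.finrank_tensorProduct
  rw [h1, Nat.cast_mul] at hd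
  have hU := left_ne_zero_of_mul hd
  have hV := right_ne_zero_of_mul hd
  have : FiniteDimensional k U.V := FiniteDimensional.of_finrank_pos
    (Nat.pos_of_ne_zero fun h => hU (by simp [h]))
  have : FiniteDimensional k V.V := FiniteDimensional.of_finrank_pos
    (Nat.pos_of_ne_zero fun h => hV (by simp [h]))
  obtain ⟨N, hN, ⟨F⟩⟩ := hM
  have hr : ∀ (W : Rep k X) [FiniteDimensional k W.V], (Module.finrank k W.V : k) ≠ 0 →
      endUnit W ≫ ((Module.finrank k W.V : k)⁻¹ • endTrace W) = 𝟙 _ := by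
    intro W _ hW
    rw [Linear.comp_smul, endUnit_trace, smul_smul, inv_mul_cancel₀ hW, one_smul]
  obtain ⟨A, ⟨a⟩⟩ := exists_compl _ _ (hr U hU)
  obtain ⟨R, ⟨b⟩⟩ := exists_compl ((ρ_ (endRep U)).inv ≫ endRep U ◁ endUnit V)
    (endRep U ◁ ((Module.finrank k V.V : k)⁻¹ • endTrace V) ≫ (ρ_ (endRep U)).hom) (by
      rw [Category.assoc, ← MonoidalCategory.whiskerLeft_comp_assoc, hr V hV]
      simp)
  let Φ : 𝟙_ (Rep k X) ⊞ (A ⊞ R) ≅ 𝟙_ (Rep k X) ⊞ N :=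
    (biprod.associator _ _ _).symm ≪≫ biprod.mapIso a.symm (Iso.refl R) ≪≫ b.symm ≪≫
      endRepTensor U V ≪≫ (endRepCongr e).symm ≪≫ (endRepIso M).symm ≪≫ F
  have := projective_of_cancel hX _ _ Φ
  refine ⟨A, Retract.projective (Y := A ⊞ R)
    { i := biprod.inl, r := biprod.fst, retract := by simp }, ⟨endRepIso U ≪≫ a⟩⟩

end Helpers

/-- If an endo-trivial module `M` factors as a tensor product `U ⊗ V`, then both
factors are endo-trivial. -/
theorem endoTrivial_of_tensor_factor
    (p : ℕ) (hp : p.Prime) (k : Type) [Field k] [IsAlgClosed k] [CharP k p]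
    (X : Type) [Group X] [Fintype X] (hpX : p ∣ Fintype.card X)
    (M U V : Rep k X) [FiniteDimensional k M.V]
    (hM : IsEndoTrivial M) (hUV : Nonempty (M ≅ U ⊗ V)) :
    IsEndoTrivial U ∧ IsEndoTrivial V := by
  have hX : (Fintype.card X : k) = 0 := (CharP.cast_eq_zero_iff k p _).2 hpX
  obtain ⟨e⟩ := hUV
  exact ⟨endoTrivial_left hX M U V hM e, endoTrivial_left hX M V U hM (e ≪≫ β_ U V)⟩
end

section
/- If M is an endo-trivial kX-module of the form M ≅ Ind_Y^X(L) for a proper subgroup Y of X and a kY-module L, then L is an endo-trivial kY-module and Y is strongly p-embedded in X. -/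
open CategoryTheory Limits MonoidalCategory

/-- The carrier of the module induced from a representation of a subgroup `Y ≤ X`
(realized, for finite groups, as the space of `Y`-equivariant functions `X → L`). -/
def indCarrier {k X : Type} [Field k] [Group X] {Y : Subgroup X}
    (L : Rep k ↥Y) : Submodule k (X → L.V) where
  carrier := {f | ∀ (y : ↥Y) (x : X), f (↑y * x) = L.ρ y (f x)}
  add_mem' := by intro f g hf hg y x; simp [hf y x, hg y x]
  zero_mem' := by intro y x; simp
  smul_mem' := by intro c f hf y x; simp [hf y x]

noncomputable def indρ {k X : Type} [Field k] [Group X] {Y : Subgroup X}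
    (L : Rep k ↥Y) : Representation k X (indCarrier L) where
  toFun g :=
    { toFun := fun f => ⟨fun x => f.1 (x * g), fun y x => by
        simpa [mul_assoc] using f.2 y (x * g)⟩
      map_add' := by intro f h; rfl
      map_smul' := by intro c f; rfl }
  map_one' := by
    refine LinearMap.ext fun f => Subtype.ext (funext fun x => ?_)
    simp
  map_mul' := by
    intro g h
    refine LinearMap.ext fun f => Subtype.ext (funext fun x => ?_)
    simp [mul_assoc]

/-- The induction `Ind_Y^X L` of a representation of a subgroup (for finite `X`). -/
noncomputable def indRep {k X : Type} [Field k] [Group X] {Y : Subgroup X}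
    (L : Rep k ↥Y) : Rep k X := Rep.of (indρ L)

/-- `Y` is strongly `p`-embedded in `X`: `p` divides `|Y|` and `p` does not divide
`|Y ∩ Y^g|` for every `g ∈ X \ Y`. -/
def StronglyPEmbedded (p : ℕ) {X : Type} [Group X] (Y : Subgroup X) : Prop :=
  p ∣ Nat.card Y ∧
    ∀ g : X, g ∉ Y → ¬ p ∣ Nat.card ↥(Y ⊓ Y.map (MulAut.conj g).toMonoidHom)

section StableCalculus

open scoped TensorProduct

variable {k : Type} [Field k] {G : Type} [Group G]
variable {U V W T : Type} [AddCommGroup U] [Module k U] [AddCommGroup V] [Module k V]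
  [AddCommGroup W] [Module k W] [AddCommGroup T] [Module k T]

/-- Equivariance of a linear map. -/
def Eqv (ρ : Representation k G V) (σ : Representation k G W) (f : V →ₗ[k] W) : Prop :=
  ∀ g, f ∘ₗ ρ g = σ g ∘ₗ f

/-- Relative trace from the trivial subgroup: the maps which are stably zero. -/
def StZ [Fintype G] (ρ : Representation k G V) (σ : Representation k G W) (f : V →ₗ[k] W) : Prop :=
  ∃ φ : V →ₗ[k] W, ∀ v, f v = ∑ g, σ g (φ (ρ g⁻¹ v))

theorem Eqv.app {ρ : Representation k G V} {σ : Representation k G W} {f : V →ₗ[k] W}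
    (h : Eqv ρ σ f) (g : G) (v : V) : f (ρ g v) = σ g (f v) :=
  LinearMap.congr_fun (h g) v

theorem Eqv.of {ρ : Representation k G V} {σ : Representation k G W} {f : V →ₗ[k] W}
    (h : ∀ g v, f (ρ g v) = σ g (f v)) : Eqv ρ σ f :=
  fun g => LinearMap.ext (h g)

theorem Eqv.comp {ρ : Representation k G V} {σ : Representation k G W} {τ : Representation k G U}
    {f : V →ₗ[k] W} {a : W →ₗ[k] U} (ha : Eqv σ τ a) (hf : Eqv ρ σ f) : Eqv ρ τ (a ∘ₗ f) :=
  Eqv.of fun g v => by simp [hf.app, ha.app]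

theorem Eqv.id (ρ : Representation k G V) : Eqv ρ ρ LinearMap.id := Eqv.of fun g v => by simp

theorem Eqv.sub {ρ : Representation k G V} {σ : Representation k G W}
    {f f' : V →ₗ[k] W} (hf : Eqv ρ σ f) (hf' : Eqv ρ σ f') : Eqv ρ σ (f - f') :=
  Eqv.of fun g v => by simp [hf.app, hf'.app]

theorem Eqv.map {V' W' : Type} [AddCommGroup V'] [Module k V'] [AddCommGroup W'] [Module k W']
    {ρ : Representation k G V} {σ : Representation k G W} {ρ' : Representation k G V'}
    {σ' : Representation k G W'}
    {f : V →ₗ[k] W} {f' : V' →ₗ[k] W'} (hf : Eqv ρ σ f) (hf' : Eqv ρ' σ' f') :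
    Eqv (ρ.tprod ρ') (σ.tprod σ') (TensorProduct.map f f') := by
  intro g
  rw [Representation.tprod_apply, Representation.tprod_apply, ← TensorProduct.map_comp,
    ← TensorProduct.map_comp, hf g, hf' g]

theorem Eqv.dual {ρ : Representation k G V} {σ : Representation k G W}
    {f : V →ₗ[k] W} (hf : Eqv ρ σ f) : Eqv σ.dual ρ.dual f.dualMap := by
  refine Eqv.of fun g v => LinearMap.ext fun x => ?_
  simp [Representation.dual_apply, Module.Dual.transpose_apply, hf.app]

variable [Fintype G]

theorem StZ.comp_left {ρ : Representation k G V} {σ : Representation k G W}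
    {τ : Representation k G U}
    {f : V →ₗ[k] W} {a : W →ₗ[k] U} (ha : Eqv σ τ a) (hf : StZ ρ σ f) : StZ ρ τ (a ∘ₗ f) := by
  obtain ⟨φ, h⟩ := hf
  exact ⟨a ∘ₗ φ, fun v => by simp [h, ha.app]⟩

theorem StZ.comp_right {ρ : Representation k G V} {σ : Representation k G W}
    {τ : Representation k G U}
    {f : V →ₗ[k] W} {a : U →ₗ[k] V} (hf : StZ ρ σ f) (ha : Eqv τ ρ a) : StZ τ σ (f ∘ₗ a) := by
  obtain ⟨φ, h⟩ := hf
  exact ⟨φ ∘ₗ a, fun v => by simp only [LinearMap.comp_apply, h, ha.app]⟩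

theorem StZ.add {ρ : Representation k G V} {σ : Representation k G W}
    {f f' : V →ₗ[k] W} (hf : StZ ρ σ f) (hf' : StZ ρ σ f') : StZ ρ σ (f + f') := by
  obtain ⟨φ, h⟩ := hf
  obtain ⟨φ', h'⟩ := hf'
  exact ⟨φ + φ', fun v => by simp [h, h', Finset.sum_add_distrib]⟩

theorem StZ.map {V' W' : Type} [AddCommGroup V'] [Module k V'] [AddCommGroup W'] [Module k W']
    {ρ : Representation k G V} {σ : Representation k G W} {ρ' : Representation k G V'}
    {σ' : Representation k G W'}
    {f : V →ₗ[k] W} {f' : V' →ₗ[k] W'} (hf : StZ ρ σ f) (hf' : Eqv ρ' σ' f') :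
    StZ (ρ.tprod ρ') (σ.tprod σ') (TensorProduct.map f f') := by
  obtain ⟨φ, h⟩ := hf
  refine ⟨TensorProduct.map φ f', fun v => ?_⟩
  induction v using TensorProduct.induction_on with
  | zero => simp
  | add x y hx hy => rw [map_add, hx, hy, ← Finset.sum_add_distrib]; simp only [map_add]
  | tmul x y =>
    simp only [TensorProduct.map_tmul, Representation.tprod_apply, h, TensorProduct.sum_tmul,
      hf'.app]
    refine Finset.sum_congr rfl fun g _ => ?_
    simp [← Module.End.mul_apply, ← map_mul]

theorem StZ.map_right {V' W' : Type} [AddCommGroup V'] [Module k V'] [AddCommGroup W'] [Module k W']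
    {ρ : Representation k G V} {σ : Representation k G W} {ρ' : Representation k G V'}
    {σ' : Representation k G W'}
    {f : V →ₗ[k] W} {f' : V' →ₗ[k] W'} (hf : Eqv ρ σ f) (hf' : StZ ρ' σ' f') :
    StZ (ρ.tprod ρ') (σ.tprod σ') (TensorProduct.map f f') := by
  obtain ⟨φ, h⟩ := hf'
  refine ⟨TensorProduct.map f φ, fun v => ?_⟩
  induction v using TensorProduct.induction_on with
  | zero => simp
  | add x y hx hy => rw [map_add, hx, hy, ← Finset.sum_add_distrib]; simp only [map_add]
  | tmul x y =>
    simp only [TensorProduct.map_tmul, Representation.tprod_apply, h, TensorProduct.tmul_sum,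
      hf.app]
    refine Finset.sum_congr rfl fun g _ => ?_
    simp [← Module.End.mul_apply, ← map_mul]

theorem StZ.dual {ρ : Representation k G V} {σ : Representation k G W}
    {f : V →ₗ[k] W} (hf : StZ ρ σ f) : StZ σ.dual ρ.dual f.dualMap := by
  obtain ⟨φ, h⟩ := hf
  refine ⟨φ.dualMap, fun ξ => LinearMap.ext fun x => ?_⟩
  rw [LinearMap.sum_apply]
  simp only [LinearMap.dualMap_apply, h, map_sum, Representation.dual_apply,
    Module.Dual.transpose_apply, LinearMap.comp_apply, inv_inv]

theorem StZ.pull {H : Type} [Group H] [Fintype H] (c : H →* G) (hc : Function.Injective c)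
    {ρ : Representation k G V} {σ : Representation k G W}
    {f : V →ₗ[k] W} (hf : StZ ρ σ f) : StZ (ρ.comp c) (σ.comp c) f := by
  classical
  obtain ⟨φ, h⟩ := hf
  let E0 : (G ⧸ c.range) × H → G := fun x => c x.2⁻¹ * (x.1.out)⁻¹
  have hE0 : Function.Bijective E0 := by
    constructor
    · rintro ⟨q, x⟩ ⟨q', x'⟩ hx
      have hx : c x⁻¹ * q.out⁻¹ = c x'⁻¹ * q'.out⁻¹ := hx
      have hq : q = q' := by
        rw [← QuotientGroup.out_eq' q, ← QuotientGroup.out_eq' q', QuotientGroup.eq]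
        refine ⟨x * x'⁻¹, ?_⟩
        rw [map_mul, eq_comm]
        calc q.out⁻¹ * q'.out = c x * (c x⁻¹ * q.out⁻¹) * q'.out := by simp
          _ = c x * c x'⁻¹ := by rw [hx]; group
      subst hq
      have := hc (mul_right_cancel hx)
      simp at this
      rw [this]
    · intro g
      have : ((g⁻¹ : G) : G ⧸ c.range) = (((g⁻¹ : G) : G ⧸ c.range).out : G) := by
        rw [QuotientGroup.out_eq']
      rw [QuotientGroup.eq] at this
      obtain ⟨x, hx⟩ := this
      refine ⟨(((g⁻¹ : G) : G ⧸ c.range), x⁻¹), ?_⟩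
      change c x⁻¹⁻¹ * _ = _
      rw [inv_inv, hx, inv_inv, mul_inv_cancel_right]
  let E : (G ⧸ c.range) × H ≃ G := Equiv.ofBijective E0 hE0
  have hE : ∀ q h, E (q, h) = c h⁻¹ * (q.out)⁻¹ := fun _ _ => rfl
  refine ⟨∑ q : G ⧸ c.range, σ q.out⁻¹ ∘ₗ φ ∘ₗ ρ q.out, fun v => ?_⟩
  rw [h, ← Equiv.sum_comp E, Fintype.sum_prod_type_right]
  refine Fintype.sum_equiv (Equiv.inv H) _ _ fun x => ?_
  simp [hE, ← Module.End.mul_apply, ← map_mul, LinearMap.sum_apply]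

/-- Unbundled endo-triviality. -/
def ET (ρ : Representation k G V) : Prop :=
  ∃ (a : k →ₗ[k] V ⊗[k] Module.Dual k V) (b : V ⊗[k] Module.Dual k V →ₗ[k] k),
    Eqv (Representation.trivial k G k) (ρ.tprod ρ.dual) a ∧
    Eqv (ρ.tprod ρ.dual) (Representation.trivial k G k) b ∧
    b ∘ₗ a = LinearMap.id ∧ StZ (ρ.tprod ρ.dual) (ρ.tprod ρ.dual) (LinearMap.id - a ∘ₗ b)

theorem StZ.scalar (hG : (Fintype.card G : k) = 0) {f : k →ₗ[k] k}
    (hf : StZ (Representation.trivial k G k) (Representation.trivial k G k) f) : f = 0 := by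
  obtain ⟨φ, h⟩ := hf
  ext
  simp [h, hG]

theorem ET.not_hig {ρ : Representation k G V} (hG : (Fintype.card G : k) = 0) (h : ET ρ)
    (hz : StZ ρ ρ LinearMap.id) : False := by
  obtain ⟨a, b, ha, hb, hba, -⟩ := h
  have h1 := ((hz.map (Eqv.id ρ.dual)).comp_right ha).comp_left hb
  rw [TensorProduct.map_id, LinearMap.id_comp, hba] at h1
  have := LinearMap.congr_fun (h1.scalar hG) 1
  simp at this

theorem ET.pull {H : Type} [Group H] [Fintype H] (c : H →* G) (hc : Function.Injective c)
    {ρ : Representation k G V} (h : ET ρ) : ET (ρ.comp c : Representation k H V) := by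
  obtain ⟨a, b, ha, hb, hba, hz⟩ := h
  have e : Representation.tprod (ρ.comp c) (Representation.dual (ρ.comp c)) = (ρ.tprod ρ.dual).comp c := by
    ext1 x
    simp [Representation.tprod_apply, Representation.dual_apply]
  refine ⟨a, b, ?_, ?_, hba, ?_⟩
  · rw [e]; exact fun g => ha (c g)
  · rw [e]; exact fun g => hb (c g)
  · rw [e]; exact hz.pull c hc

theorem ET.of_tensor {ρ : Representation k G V} (h : ET ρ) {e : V →ₗ[k] V}
    (hz : StZ (ρ.tprod ρ.dual) (ρ.tprod ρ.dual) (TensorProduct.map e LinearMap.id)) :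
    StZ ρ ρ e := by
  obtain ⟨a, b, ha, hb, hba, -⟩ := h
  let sw := (TensorProduct.comm k V (Module.Dual k V))
  let I : V →ₗ[k] (V ⊗[k] Module.Dual k V) ⊗[k] V :=
    (TensorProduct.assoc k V (Module.Dual k V) V).symm.toLinearMap ∘ₗ
      (TensorProduct.mk k V (Module.Dual k V ⊗[k] V)).flip (sw (a 1))
  let P : (V ⊗[k] Module.Dual k V) ⊗[k] V →ₗ[k] V :=
    (TensorProduct.rid k V).toLinearMap ∘ₗ
    (TensorProduct.map LinearMap.id (b ∘ₗ sw.symm.toLinearMap)) ∘ₗ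
    (TensorProduct.assoc k V (Module.Dual k V) V).toLinearMap
  have hswap : ∀ (g : G) (x : V ⊗[k] Module.Dual k V), sw ((ρ.tprod ρ.dual) g x) =
      (ρ.dual.tprod ρ) g (sw x) := by
    intro g x
    induction x using TensorProduct.induction_on with
    | zero => simp
    | add x y hx hy => simp only [map_add, hx, hy]
    | tmul x y => simp [sw, Representation.tprod_apply]
  have hassoc : ∀ (g : G) (x : V ⊗[k] (Module.Dual k V ⊗[k] V)),
      (TensorProduct.assoc k V (Module.Dual k V) V).symm ((ρ.tprod (ρ.dual.tprod ρ)) g x)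
      = ((ρ.tprod ρ.dual).tprod ρ) g ((TensorProduct.assoc k V (Module.Dual k V) V).symm x) := by
    intro g x
    simp only [Representation.tprod_apply]
    exact LinearMap.congr_fun (TensorProduct.map_map_comp_assoc_symm_eq (ρ g) (ρ.dual g) (ρ g)).symm x
  have hI : Eqv ρ ((ρ.tprod ρ.dual).tprod ρ) I := by
    refine Eqv.of fun g v => ?_
    have h1 : (ρ.dual.tprod ρ) g (sw (a 1)) = sw (a 1) := by
      rw [← hswap, ← ha.app]; simp
    simp only [I, LinearMap.comp_apply, LinearEquiv.coe_coe, ← hassoc]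
    congr 1
    simp only [LinearMap.flip_apply, TensorProduct.mk_apply, Representation.tprod_apply,
      TensorProduct.map_tmul]
    rw [Representation.tprod_apply] at h1
    rw [h1]
  have hP : Eqv ((ρ.tprod ρ.dual).tprod ρ) ρ P := by
    refine Eqv.of fun g x => ?_
    obtain ⟨x, rfl⟩ := (TensorProduct.assoc k V (Module.Dual k V) V).symm.surjective x
    rw [← hassoc]
    simp only [P, LinearMap.comp_apply, LinearEquiv.coe_coe, LinearEquiv.apply_symm_apply]
    induction x using TensorProduct.induction_on with
    | zero => simp
    | add x y hx hy => simp only [map_add, hx, hy]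
    | tmul x y =>
      obtain ⟨y, rfl⟩ := sw.surjective y
      have h1 := hswap g y
      have h2 := hb.app g y
      rw [Representation.tprod_apply, TensorProduct.map_tmul, ← h1]
      simp only [TensorProduct.map_tmul, LinearMap.comp_apply, LinearEquiv.coe_coe,
        LinearEquiv.symm_apply_apply, h2]
      simp
  have h1 := ((hz.map (Eqv.id ρ)).comp_right hI).comp_left hP
  convert h1 using 1
  ext v
  have key : ∀ y : Module.Dual k V ⊗[k] V, P (TensorProduct.map (TensorProduct.map e LinearMap.id)
      LinearMap.id ((TensorProduct.assoc k V (Module.Dual k V) V).symm (v ⊗ₜ y))) =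
      b (sw.symm y) • e v := by
    intro y
    induction y using TensorProduct.induction_on with
    | zero => simp
    | add x y hx hy => simp only [map_add, TensorProduct.tmul_add, hx, hy, add_smul]
    | tmul x y => simp [P]
  have hb1 : b (a 1) = 1 := LinearMap.congr_fun hba 1
  simp only [LinearMap.comp_apply]
  have := key (sw (a 1))
  rw [LinearEquiv.symm_apply_apply, hb1, one_smul] at this
  exact this.symm

theorem ET.dichotomy {ρ : Representation k G V} (hG : (Fintype.card G : k) = 0) (h : ET ρ)
    {e : V →ₗ[k] V} (he : Eqv ρ ρ e) (hee : e ∘ₗ e = e) :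
    StZ ρ ρ e ∨ StZ ρ ρ (LinearMap.id - e) := by
  have h0 := h
  obtain ⟨a, b, ha, hb, hba, hz⟩ := h
  set τ := ρ.tprod ρ.dual with hτ
  -- the key computation
  have key : ∀ E : V ⊗[k] Module.Dual k V →ₗ[k] V ⊗[k] Module.Dual k V, Eqv τ τ E →
      b (E (a 1)) = 0 → StZ τ τ E := by
    intro E hE hc
    have h1 := (hz.comp_left hE).add ((hz.comp_right (hE.comp (ha.comp hb))))
    have h2 : a ∘ₗ b ∘ₗ E ∘ₗ a ∘ₗ b = 0 := by
      ext1
      ext x y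
      have : b (x ⊗ₜ y) = b (x ⊗ₜ y) • (1 : k) := by simp
      simp only [LinearMap.comp_apply, TensorProduct.AlgebraTensorModule.curry_apply,
        LinearMap.restrictScalars_self, TensorProduct.curry_apply]
      rw [this]
      simp only [map_smul, hc]
      simp
    convert h1 using 1
    rw [LinearMap.sub_comp, LinearMap.comp_sub]
    simp only [LinearMap.comp_id, LinearMap.id_comp, LinearMap.comp_assoc, h2]
    simp
  let E := TensorProduct.map e (LinearMap.id : Module.Dual k V →ₗ[k] Module.Dual k V)
  have hE : Eqv τ τ E := he.map (Eqv.id _)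
  have hEE : E ∘ₗ E = E := by
    simp only [E, ← TensorProduct.map_comp, hee, LinearMap.id_comp]
  have hs := (((hz.comp_right (hE.comp ha)).comp_left hE).comp_left hb).scalar hG
  have hs1 := LinearMap.congr_fun hs 1
  have hEE1 : ∀ x, E (E x) = E x := LinearMap.congr_fun hEE
  simp only [LinearMap.comp_apply, LinearMap.sub_apply, LinearMap.id_apply, map_sub, hEE1,
    LinearMap.zero_apply] at hs1
  have hc : b (E (a 1)) * (1 - b (E (a 1))) = 0 := by
    have : a (b (E (a 1))) = b (E (a 1)) • a 1 := by rw [← map_smul]; simp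
    rw [this, map_smul, map_smul, smul_eq_mul] at hs1
    linear_combination hs1
  have hb1 : b (a 1) = 1 := LinearMap.congr_fun hba 1
  rcases mul_eq_zero.1 hc with hc | hc
  · left
    exact h0.of_tensor (key E hE hc)
  · right
    apply h0.of_tensor
    have : TensorProduct.map (LinearMap.id - e) (LinearMap.id : Module.Dual k V →ₗ[k] _)
        = LinearMap.id - E := by
      ext x y
      simp [E, TensorProduct.sub_tmul]
    rw [this]
    refine key _ ((Eqv.id _).sub hE) ?_
    simp [hb1, hc]

theorem ET.retract {ρ : Representation k G V} {σ : Representation k G W}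
    (hG : (Fintype.card G : k) = 0) (h : ET ρ)
    {i : W →ₗ[k] V} {r : V →ₗ[k] W} (hi : Eqv σ ρ i) (hr : Eqv ρ σ r)
    (hri : r ∘ₗ i = LinearMap.id) (hir : StZ ρ ρ (LinearMap.id - i ∘ₗ r)) : ET σ := by
  obtain ⟨a, b, ha, hb, hba, hz⟩ := h
  let R := TensorProduct.map r i.dualMap
  let I := TensorProduct.map i r.dualMap
  have hR : Eqv (ρ.tprod ρ.dual) (σ.tprod σ.dual) R := hr.map hi.dual
  have hI : Eqv (σ.tprod σ.dual) (ρ.tprod ρ.dual) I := hi.map hr.dual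
  have hRI : R ∘ₗ I = LinearMap.id := by
    simp only [R, I, ← TensorProduct.map_comp, hri]
    rw [LinearMap.dualMap_comp_dualMap, hri]; simp
  have hIR : StZ (ρ.tprod ρ.dual) (ρ.tprod ρ.dual) (LinearMap.id - I ∘ₗ R) := by
    have h1 := (hir.map (Eqv.id ρ.dual)).add (StZ.map_right (hi.comp hr) hir.dual)
    convert h1 using 1
    ext x y
    have hd : (LinearMap.id - i ∘ₗ r).dualMap y = y - r.dualMap (i.dualMap y) := by
      ext z; simp
    simp [I, R, TensorProduct.sub_tmul, TensorProduct.tmul_sub, hd]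
  refine ⟨R ∘ₗ a, b ∘ₗ I, hR.comp ha, hb.comp hI, ?_, ?_⟩
  · have := ((hIR.comp_right ha).comp_left hb).scalar hG
    rw [LinearMap.sub_comp, LinearMap.comp_sub, LinearMap.id_comp, hba, sub_eq_zero] at this
    rw [this]; rfl
  · have := (hz.comp_right hI).comp_left hR
    convert this using 1
    rw [LinearMap.sub_comp, LinearMap.comp_sub, LinearMap.id_comp, hRI]
    rfl

end StableCalculus

section Bridge

variable {k : Type} [Field k] {G : Type} [Group G] [Fintype G]

theorem projective_of_hig (N : Rep k G) (h : StZ N.ρ N.ρ LinearMap.id) : Projective N := by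
  obtain ⟨φ, h⟩ := h
  refine ⟨fun {E Z} f e he => ?_⟩
  rw [Rep.epi_iff_surjective] at he
  obtain ⟨s, hs⟩ := LinearMap.exists_rightInverse_of_surjective e.hom.toLinearMap
    (LinearMap.range_eq_top.2 he)
  have hs' : ∀ z, e.hom (s z) = z := LinearMap.congr_fun hs
  let t : N.V →ₗ[k] E.V := ∑ g, E.ρ g ∘ₗ s ∘ₗ f.hom.toLinearMap ∘ₗ φ ∘ₗ N.ρ g⁻¹
  have ht : ∀ v, t v = ∑ g, E.ρ g (s (f.hom (φ (N.ρ g⁻¹ v)))) := fun v => by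
    simp [t, LinearMap.sum_apply]
  refine ⟨Rep.ofHom (ρ := N.ρ) (σ := E.ρ) ⟨t, fun g => ?_⟩, ?_⟩
  · ext v
    simp only [LinearMap.comp_apply, ht, map_sum]
    refine Fintype.sum_equiv (Equiv.mulLeft g⁻¹) _ _ fun x => ?_
    simp [← Module.End.mul_apply, ← map_mul]
  · ext v
    have h1 := h v
    simp only [LinearMap.id_apply] at h1
    change e.hom (t v) = f.hom v
    rw [ht, map_sum]
    conv_rhs => rw [h1, map_sum]
    refine Finset.sum_congr rfl fun g _ => ?_
    rw [Rep.hom_comm_apply, hs', Rep.hom_comm_apply]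

/-- The coinduced module from the trivial subgroup. -/
def coindTriv (V : Type) [AddCommGroup V] [Module k V] : Representation k G (G → V) where
  toFun h :=
    { toFun := fun f x => f (h⁻¹ * x)
      map_add' := fun _ _ => rfl
      map_smul' := fun _ _ => rfl }
  map_one' := by ext; simp
  map_mul' a b := by ext; simp [mul_assoc]

theorem hig_of_projective (N : Rep k G) (hN : Projective N) : StZ N.ρ N.ρ LinearMap.id := by
  classical
  let q : (G → N.V) →ₗ[k] N.V := ∑ g, N.ρ g ∘ₗ LinearMap.proj g
  have hq : ∀ f, q f = ∑ g, N.ρ g (f g) := fun f => by simp [q, LinearMap.sum_apply]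
  let Q : Rep.of (coindTriv (k := k) (G := G) N.V) ⟶ N :=
    Rep.ofHom (σ := N.ρ) ⟨q, fun g => by
      refine LinearMap.ext fun f => ?_
      simp only [LinearMap.comp_apply, hq, map_sum]
      refine Fintype.sum_equiv (Equiv.mulLeft g⁻¹) _ _ fun x => ?_
      simp [coindTriv, ← Module.End.mul_apply, ← map_mul]⟩
  have hQ : Epi Q := by
    rw [Rep.epi_iff_surjective]
    intro v
    refine ⟨Pi.single 1 v, ?_⟩
    change q _ = v
    rw [hq, Finset.sum_eq_single 1]
    · simp
    · intro b _ hb; simp [hb]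
    · simp
  obtain ⟨s, hs⟩ := hN.factors (𝟙 N) Q
  refine ⟨LinearMap.proj 1 ∘ₗ s.hom.toLinearMap, fun v => ?_⟩
  have h1 : q (s.hom v) = v := congrArg (fun m : N ⟶ N => m.hom v) hs
  rw [LinearMap.id_apply]
  conv_lhs => rw [← h1, hq]
  refine Finset.sum_congr rfl fun g _ => ?_
  congr 1
  change _ = (s.hom (N.ρ g⁻¹ v)) 1
  rw [Rep.hom_comm_apply]
  simp [coindTriv]

theorem ET_of_isEndoTrivial (M : Rep k G) (h : IsEndoTrivial M) : ET M.ρ := by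
  obtain ⟨N, hN, ⟨e⟩⟩ := h
  have hz := hig_of_projective N hN
  let a : 𝟙_ (Rep k G) ⟶ M ⊗ Rep.of M.ρ.dual := biprod.inl ≫ e.inv
  let b : M ⊗ Rep.of M.ρ.dual ⟶ 𝟙_ (Rep k G) := e.hom ≫ biprod.fst
  let a' : N ⟶ M ⊗ Rep.of M.ρ.dual := biprod.inr ≫ e.inv
  let b' : M ⊗ Rep.of M.ρ.dual ⟶ N := e.hom ≫ biprod.snd
  have hab : a ≫ b = 𝟙 _ := by simp [a, b]
  have hs : 𝟙 _ = b ≫ a + b' ≫ a' := by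
    have : e.hom ≫ (biprod.fst ≫ biprod.inl + biprod.snd ≫ biprod.inr) ≫ e.inv = 𝟙 _ := by
      rw [biprod.total]; simp
    rw [← this]; simp only [a, b, a', b', Preadditive.add_comp, Preadditive.comp_add, Category.assoc]
  have eqv : ∀ {A B : Rep k G} (f : A ⟶ B), Eqv A.ρ B.ρ f.hom.toLinearMap := fun f =>
    Eqv.of fun g v => Rep.hom_comm_apply f g v
  refine ⟨a.hom.toLinearMap, b.hom.toLinearMap, eqv a, eqv b, ?_, ?_⟩
  · exact congrArg (fun m : 𝟙_ (Rep k G) ⟶ 𝟙_ (Rep k G) => m.hom.toLinearMap) hab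
  · have h1 := (hz.comp_left (eqv a')).comp_right (eqv b')
    have h2 := congrArg (fun m : (M ⊗ Rep.of M.ρ.dual) ⟶ (M ⊗ Rep.of M.ρ.dual) =>
      m.hom.toLinearMap) hs
    have h3 : (LinearMap.id : (M ⊗ Rep.of M.ρ.dual).V →ₗ[k] (M ⊗ Rep.of M.ρ.dual).V) =
      a.hom.toLinearMap ∘ₗ b.hom.toLinearMap + a'.hom.toLinearMap ∘ₗ b'.hom.toLinearMap := h2
    have h4 : StZ (M ⊗ Rep.of M.ρ.dual).ρ (M ⊗ Rep.of M.ρ.dual).ρ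
        (LinearMap.id - a.hom.toLinearMap ∘ₗ b.hom.toLinearMap) := by
      rw [sub_eq_of_eq_add' h3]
      exact h1
    exact h4

theorem isEndoTrivial_of_ET (M : Rep k G) (h : ET M.ρ) : IsEndoTrivial M := by
  obtain ⟨a, b, ha, hb, hba, hz⟩ := h
  let T : Rep k G := M ⊗ Rep.of M.ρ.dual
  have hba' : ∀ c, b (a c) = c := LinearMap.congr_fun hba
  let K : Submodule k T.V := LinearMap.ker b
  have hK : ∀ g, K ≤ K.comap (T.ρ g) := fun g v hv => by
    change b (T.ρ g v) = 0
    have hv : b v = 0 := hv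
    have := hb.app g v
    rw [hv, map_zero] at this
    exact this
  let N : Rep k G := T.subrepresentation K hK
  let A : 𝟙_ (Rep k G) ⟶ T := Rep.ofHom (ρ := Representation.trivial k G k) (σ := T.ρ) ⟨a, ha⟩
  let B : T ⟶ 𝟙_ (Rep k G) := Rep.ofHom (ρ := T.ρ) (σ := Representation.trivial k G k) ⟨b, hb⟩
  let I : N ⟶ T := T.subtype K hK
  let r : T.V →ₗ[k] K := (LinearMap.id - a ∘ₗ b).codRestrict K fun v => by
    change b (v - a (b v)) = 0
    rw [map_sub, hba', sub_self]
  have hrE : Eqv T.ρ N.ρ r := Eqv.of fun g v => Subtype.ext <|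
    ((Eqv.id _).sub (ha.comp hb)).app g v
  let R : T ⟶ N := Rep.ofHom (ρ := T.ρ) (σ := N.ρ) ⟨r, hrE⟩
  have hrI : ∀ x : K, r x.1 = x := fun x => Subtype.ext <| by
    change x.1 - a (b x.1) = x.1
    have : b x.1 = 0 := x.2
    rw [this, map_zero, sub_zero]
  have hAB : A ≫ B = 𝟙 _ := by
    ext
    exact hba' _
  have hIB : I ≫ B = 0 := by
    ext v
    exact v.2
  have hAR : A ≫ R = 0 := by
    apply Rep.hom_ext
    apply Representation.IntertwiningMap.ext
    refine LinearMap.ext fun v => Subtype.ext ?_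
    change a v - a (b (a v)) = 0
    rw [hba', sub_self]
  have hIR : I ≫ R = 𝟙 _ := by
    apply Rep.hom_ext
    apply Representation.IntertwiningMap.ext
    exact LinearMap.ext fun v => hrI v
  have hT : B ≫ A + R ≫ I = 𝟙 _ := by
    apply Rep.hom_ext
    apply Representation.IntertwiningMap.ext
    refine LinearMap.ext fun v => ?_
    change a (b v) + (v - a (b v)) = v
    abel
  refine ⟨N, projective_of_hig N ?_, ⟨⟨biprod.lift B R, biprod.desc A I, ?_, ?_⟩⟩⟩
  · have hIE : Eqv N.ρ T.ρ K.subtype := Eqv.of fun g v => rfl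
    have h1 := (hz.comp_right hIE).comp_left hrE
    convert h1 using 1
    refine LinearMap.ext fun v => ?_
    change v = r (r v.1).1
    rw [hrI, hrI]
  · rw [biprod.lift_desc, hT]
  · apply biprod.hom_ext' <;> apply biprod.hom_ext <;>
      simp [hAB, hIB, hAR, hIR]

end Bridge

section Induced

variable {k X : Type} [Field k] [Group X] {Y : Subgroup X}

open Classical in
/-- `l ↦` the function supported on `Y * g⁻¹` with value `l` at `g⁻¹`. -/
noncomputable def indIncl (L : Rep k ↥Y) (g : X) : L.V →ₗ[k] indCarrier L where
  toFun l := ⟨fun x => if h : x * g ∈ Y then L.ρ ⟨x * g, h⟩ l else 0, fun y x => by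
    by_cases h : x * g ∈ Y
    · have h' : (y : X) * x * g ∈ Y := by rw [mul_assoc]; exact Y.mul_mem y.2 h
      have e : (⟨(y : X) * x * g, h'⟩ : Y) = y * ⟨x * g, h⟩ := Subtype.ext (mul_assoc _ _ _)
      simp only [h, h', dif_pos]
      rw [e, map_mul]; rfl
    · have h' : ¬ (y : X) * x * g ∈ Y := by
        rw [mul_assoc, Y.mul_mem_cancel_left y.2]; exact h
      simp [h, h']⟩
  map_add' a b := Subtype.ext <| funext fun x => by
    by_cases h : x * g ∈ Y <;> simp [h]
  map_smul' c b := Subtype.ext <| funext fun x => by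
    by_cases h : x * g ∈ Y <;> simp [h]

theorem indIncl_pos (L : Rep k ↥Y) (g : X) (l : L.V) (x : X) (h : x * g ∈ Y) :
    (indIncl L g l).1 x = L.ρ ⟨x * g, h⟩ l := dif_pos h

theorem indIncl_neg (L : Rep k ↥Y) (g : X) (l : L.V) (x : X) (h : x * g ∉ Y) :
    (indIncl L g l).1 x = 0 := dif_neg h

/-- Evaluation at `g⁻¹`. -/
def indEval (L : Rep k ↥Y) (g : X) : indCarrier L →ₗ[k] L.V where
  toFun f := f.1 g⁻¹
  map_add' _ _ := rfl
  map_smul' _ _ := rfl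

theorem indEval_comp_incl (L : Rep k ↥Y) (g : X) :
    indEval L g ∘ₗ indIncl L g = LinearMap.id := by
  refine LinearMap.ext fun l => ?_
  change (indIncl L g l).1 g⁻¹ = l
  have h : g⁻¹ * g ∈ Y := by simp
  rw [indIncl_pos L g l _ h]
  have e : (⟨g⁻¹ * g, h⟩ : Y) = 1 := Subtype.ext (by simp)
  rw [e]; simp

theorem indIncl_eqv (L : Rep k ↥Y) (g : X) {H : Type} [Group H] (c : H →* X) (d : H →* Y)
    (hcd : ∀ h, (d h : X) = g⁻¹ * c h * g) :
    Eqv (L.ρ.comp d : Representation k H L.V) ((indρ L).comp c) (indIncl L g) := by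
  refine Eqv.of fun q l => Subtype.ext <| funext fun x => ?_
  change (indIncl L g (L.ρ (d q) l)).1 x = (indIncl L g l).1 (x * c q)
  have e : x * c q * g = x * g * d q := by rw [hcd]; group
  by_cases h : x * g ∈ Y
  · have h' : x * c q * g ∈ Y := by rw [e]; exact Y.mul_mem h (d q).2
    rw [indIncl_pos L g _ _ h, indIncl_pos L g _ _ h']
    have e' : (⟨x * c q * g, h'⟩ : Y) = ⟨x * g, h⟩ * d q := Subtype.ext e
    rw [e', map_mul]; rfl
  · have h' : x * c q * g ∉ Y := by rw [e, Y.mul_mem_cancel_right (d q).2]; exact h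
    rw [indIncl_neg L g _ _ h, indIncl_neg L g _ _ h']

theorem indEval_eqv (L : Rep k ↥Y) (g : X) {H : Type} [Group H] (c : H →* X) (d : H →* Y)
    (hcd : ∀ h, (d h : X) = g⁻¹ * c h * g) :
    Eqv ((indρ L).comp c : Representation k H (indCarrier L)) (L.ρ.comp d) (indEval L g) := by
  refine Eqv.of fun q f => ?_
  change f.1 (g⁻¹ * c q) = L.ρ (d q) (f.1 g⁻¹)
  rw [← f.2, hcd]
  group

theorem ind_hig [Fintype X] (L : Rep k ↥Y) [Fintype Y] (h : StZ L.ρ L.ρ LinearMap.id) :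
    StZ (indρ L) (indρ L) LinearMap.id := by
  classical
  obtain ⟨φ, h⟩ := h
  refine ⟨indIncl L 1 ∘ₗ φ ∘ₗ indEval L 1, fun f => Subtype.ext <| funext fun x => ?_⟩
  have e1 : ∀ g : X, ((indρ L) g ((indIncl L 1 ∘ₗ φ ∘ₗ indEval L 1) ((indρ L) g⁻¹ f))).1 x
      = (indIncl L 1 (φ (f.1 g⁻¹))).1 (x * g) := by
    intro g
    change (indIncl L 1 (φ (f.1 (1⁻¹ * g⁻¹)))).1 (x * g) = _
    simp
  rw [AddSubmonoidClass.coe_finsetSum, Finset.sum_apply]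
  simp only [e1]
  rw [← Equiv.sum_comp (Equiv.mulLeft x⁻¹)]
  simp only [Equiv.coe_mulLeft, mul_inv_cancel_left, mul_inv_rev, inv_inv]
  rw [← Finset.sum_subset (Finset.subset_univ (Finset.univ.filter (· ∈ Y)))]
  · rw [LinearMap.id_apply, ← LinearMap.id_apply (R := k) (f.1 x), h]
    rw [Finset.sum_subtype (p := (· ∈ Y)) _ (by simp)]
    refine Finset.sum_congr rfl fun y _ => ?_
    have hy : (y : X) * 1 ∈ Y := by simp
    rw [indIncl_pos L 1 _ _ hy]
    have e : (⟨(y : X) * 1, hy⟩ : Y) = y := Subtype.ext (by simp)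
    rw [e, ← f.2 y⁻¹ x]; rfl
  · intro y _ hy
    refine indIncl_neg L 1 _ _ ?_
    simpa using hy

end Induced

/-- If an endo-trivial `kX`-module is induced from a proper subgroup `Y`, then the
inducing module is endo-trivial and `Y` is strongly `p`-embedded. -/
theorem endoTrivial_induced_from_proper
    (p : ℕ) (hp : p.Prime) (k : Type) [Field k] [IsAlgClosed k] [CharP k p]
    (X : Type) [Group X] [Fintype X] (hpX : p ∣ Fintype.card X)
    (Y : Subgroup X) (hY : Y < ⊤) (L : Rep k ↥Y) (M : Rep k X)
    (hM : IsEndoTrivial M) (hind : Nonempty (M ≅ indRep L)) :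
    IsEndoTrivial L ∧ StronglyPEmbedded p Y := by

  classical
  have : Fintype Y := Fintype.ofFinite _
  have hXk : (Fintype.card X : k) = 0 := (CharP.cast_eq_zero_iff k p _).2 hpX
  obtain ⟨e⟩ := hind
  -- `Ind L` is endo-trivial
  have hV : ET (indρ L) := by
    have h0 := ET_of_isEndoTrivial M hM
    refine h0.retract hXk (i := e.inv.hom.toLinearMap) (r := e.hom.hom.toLinearMap)
      (Eqv.of fun g v => Rep.hom_comm_apply e.inv g v)
      (Eqv.of fun g v => Rep.hom_comm_apply e.hom g v)
      (LinearMap.ext fun v => congrArg (fun m : indRep L ⟶ indRep L => m.hom v) e.inv_hom_id)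
      ⟨0, fun v => ?_⟩
    have h1 : e.inv.hom (e.hom.hom v) = v :=
      congrArg (fun m : M ⟶ M => m.hom v) e.hom_inv_id
    change v - e.inv.hom (e.hom.hom v) = _
    rw [h1, sub_self]
    exact (Finset.sum_eq_zero fun g _ => map_zero (M.ρ g)).symm
  have hLn : ¬ StZ L.ρ L.ρ LinearMap.id := fun h => hV.not_hig hXk (ind_hig L h)
  have hYk : (Fintype.card Y : k) = 0 := by
    by_contra hne
    refine hLn ⟨(Fintype.card Y : k)⁻¹ • LinearMap.id, fun v => ?_⟩
    have h1 : ∀ y : Y, L.ρ y (((Fintype.card Y : k)⁻¹ • (LinearMap.id : L.V →ₗ[k] L.V)) (L.ρ y⁻¹ v)) =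
        (Fintype.card Y : k)⁻¹ • v := fun y => by
      simp
    rw [Finset.sum_congr rfl fun y _ => h1 y, Finset.sum_const, Finset.card_univ,
      ← Nat.cast_smul_eq_nsmul k, smul_smul, mul_inv_cancel₀ hne, one_smul]
    rfl
  have hVY : ET ((indρ L).comp Y.subtype : Representation k Y (indCarrier L)) :=
    hV.pull Y.subtype Y.subtype_injective
  have hi := indIncl_eqv L 1 Y.subtype (MonoidHom.id Y) (fun h => by simp)
  have hr := indEval_eqv L 1 Y.subtype (MonoidHom.id Y) (fun h => by simp)
  rw [MonoidHom.comp_id] at hi hr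
  have hri := indEval_comp_incl L 1
  have hcompl : StZ ((indρ L).comp Y.subtype : Representation k Y (indCarrier L))
      ((indρ L).comp Y.subtype) (LinearMap.id - indIncl L 1 ∘ₗ indEval L 1) := by
    refine (hVY.dichotomy hYk (hi.comp hr) ?_).resolve_left fun hz => hLn ?_
    · rw [LinearMap.comp_assoc, ← LinearMap.comp_assoc (indEval L 1), hri, LinearMap.id_comp]
    · have h1 := (hz.comp_left hr).comp_right hi
      rwa [LinearMap.comp_assoc, LinearMap.comp_assoc, hri, LinearMap.comp_id, hri] at h1
  have hL : ET L.ρ := hVY.retract hYk hi hr hri hcompl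
  refine ⟨isEndoTrivial_of_ET L hL, ?_, ?_⟩
  · rw [Nat.card_eq_fintype_card]
    exact (CharP.cast_eq_zero_iff k p _).1 hYk
  intro g hg hpQ
  let Q := Y ⊓ Y.map (MulAut.conj g).toMonoidHom
  have : Fintype Q := Fintype.ofFinite _
  have hQk : (Fintype.card Q : k) = 0 := by
    rw [Nat.card_eq_fintype_card] at hpQ
    exact (CharP.cast_eq_zero_iff k p _).2 hpQ
  let c : Q →* Y := Subgroup.inclusion inf_le_left
  let d : Q →* Y :=
    { toFun := fun q => ⟨g⁻¹ * q.1 * g, by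
        obtain ⟨y, hy, hyq⟩ := q.2.2
        rw [← hyq]
        simpa [mul_assoc] using hy⟩
      map_one' := Subtype.ext (by simp)
      map_mul' := fun a b => Subtype.ext (by simp [mul_assoc]) }
  have hc : Function.Injective c := Subgroup.inclusion_injective _
  have hd : Function.Injective d := fun a b hab => Subtype.ext (by
    have := congrArg Subtype.val hab
    simpa [d] using this)
  have hj := indIncl_eqv L g (Y.subtype.comp c) d (fun h => rfl)
  have hs := indEval_eqv L g (Y.subtype.comp c) d (fun h => rfl)
  have h1 := ((hcompl.pull c hc).comp_left hs).comp_right hj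
  refine (hL.pull d hd).not_hig hQk ?_
  convert h1 using 1
  refine LinearMap.ext fun l => ?_
  have h2 := LinearMap.congr_fun (indEval_comp_incl L g) l
  have h3 : indEval L g (indIncl L 1 (indEval L 1 (indIncl L g l))) = 0 :=
    indIncl_neg L 1 _ _ (by simpa using hg)
  simp only [LinearMap.comp_apply, LinearMap.sub_apply, LinearMap.id_apply, map_sub] at h2 ⊢
  rw [h2, h3, sub_zero]
end

section
/- If Y is a strongly p-embedded subgroup of a finite group X and L is an endo-trivial kY-module, then Ind_Y^X(L) is an endo-trivial kX-module. -/
open CategoryTheory Limits MonoidalCategory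

open Representation TensorProduct

def EGood {k G V : Type} [Field k] [Group G] [Fintype G] [AddCommGroup V] [Module k V]
    (ρ : Representation k G V) : Prop :=
  ∃ (v : V) (f : V →ₗ[k] k) (θ : V →ₗ[k] V), (∀ g, ρ g v = v) ∧ (∀ g x, f (ρ g x) = f x) ∧
    f v = 1 ∧ ∀ x, ∑ g : G, ρ g (θ (ρ g⁻¹ x)) = x - f x • v

structure EInd {k X M L : Type} [Field k] [Group X] (Y : Subgroup X) [Fintype (X ⧸ Y)]
    [AddCommGroup M] [Module k M]
    [AddCommGroup L] [Module k L] (ρ : Representation k X M) (l : Representation k Y L)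
    (i : L →ₗ[k] M) (e : M →ₗ[k] L) : Prop where
  ieq : ∀ (y : Y) x, i (l y x) = ρ y (i x)
  eeq : ∀ (y : Y) x, e (ρ y x) = l y (e x)
  ei : ∀ x, e (i x) = x
  orth : ∀ g, g ∉ Y → ∀ x, e (ρ g (i x)) = 0
  sum : ∀ m, ∑ a : X ⧸ Y, ρ a.out (i (e (ρ a.out⁻¹ m))) = m

lemma orbit_fun (k : Type) [Field k] (G S : Type) [Group G] [Fintype G] [MulAction G S] :
    ∃ c : S → k, ∀ s, (Nat.card (MulAction.stabilizer G s) : k) ≠ 0 → ∑ g : G, c (g • s) = 1 := by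
  classical
  let r : S → S := fun s => (Quotient.out (Quotient.mk (MulAction.orbitRel G S) s))
  have hr : ∀ (g : G) s, r (g • s) = r s := fun g s => by
    have : Quotient.mk (MulAction.orbitRel G S) (g • s) = Quotient.mk _ s :=
      Quotient.sound (MulAction.orbitRel_apply.2 ⟨g, rfl⟩)
    simp only [r, this]
  refine ⟨fun s => if s = r s then (Nat.card (MulAction.stabilizer G s) : k)⁻¹ else 0, ?_⟩
  intro s hs
  obtain ⟨h, hh⟩ : ∃ h : G, h • s = r s := by
    have := Quotient.mk_out (s := MulAction.orbitRel G S) s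
    exact MulAction.orbitRel_apply.1 this
  rw [← Fintype.sum_equiv (Equiv.mulRight h) (fun g => (if (g * h) • s = r ((g * h) • s) then
    (Nat.card (MulAction.stabilizer G ((g * h) • s)) : k)⁻¹ else 0)) _ (fun g => rfl)]
  have hc : Nat.card (MulAction.stabilizer G (h • s)) = Nat.card (MulAction.stabilizer G s) :=
    Nat.card_congr (MulAction.stabilizerEquivStabilizer (g := h) rfl).toEquiv.symm
  have : ∀ g : G, (if (g * h) • s = r ((g * h) • s) then
      (Nat.card (MulAction.stabilizer G ((g * h) • s)) : k)⁻¹ else 0) =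
      if g ∈ MulAction.stabilizer G (h • s) then
        (Nat.card (MulAction.stabilizer G s) : k)⁻¹ else 0 := by
    intro g
    rw [hr, ← hh, mul_smul]
    by_cases h1 : g • h • s = h • s
    · rw [if_pos h1, if_pos (MulAction.mem_stabilizer_iff.2 h1), h1, hc]
    · rw [if_neg h1, if_neg (fun hh => h1 (MulAction.mem_stabilizer_iff.1 hh))]
  simp_rw [this]
  rw [← Finset.sum_filter, Finset.sum_const, nsmul_eq_mul, ← Fintype.card_subtype,
    ← Nat.card_eq_fintype_card]
  change ((Nat.card (MulAction.stabilizer G (h • s)) : ℕ) : k) * _ = 1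
  rw [hc, mul_inv_cancel₀ hs]

lemma trace_fam {k G S V : Type} [Field k] [Group G] [Fintype G] [MulAction G S] [Fintype S]
    [AddCommGroup V] [Module k V] (ρ : Representation k G V) (A : S → V →ₗ[k] V)
    (hA : ∀ g s x, ρ g (A s (ρ g⁻¹ x)) = A (g • s) x)
    (h0 : ∀ s, A s = 0 ∨ (Nat.card (MulAction.stabilizer G s) : k) ≠ 0) :
    ∃ θ : V →ₗ[k] V, ∀ x, ∑ g : G, ρ g (θ (ρ g⁻¹ x)) = ∑ s, A s x := by
  obtain ⟨c, hc⟩ := orbit_fun k G S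
  refine ⟨∑ s, c s • A s, fun x => ?_⟩
  simp only [LinearMap.sum_apply, LinearMap.smul_apply, map_sum, map_smul, hA]
  have : ∀ g : G, ∑ s, c s • A (g • s) x = ∑ s, c (g⁻¹ • s) • A s x := fun g =>
    Fintype.sum_equiv (MulAction.toPerm g) _ _ (fun s => by simp)
  simp_rw [this]
  rw [Finset.sum_comm]
  refine Finset.sum_congr rfl fun s _ => ?_
  rw [← Finset.sum_smul]
  rcases h0 s with h | h
  · simp [h]
  · rw [Fintype.sum_equiv (Equiv.inv G) (fun g => c (g⁻¹ • s)) (fun g => c (g • s)) (fun g => rfl),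
      hc s h, one_smul]

lemma card_one {k X : Type} [Field k] [Group X] (Y : Subgroup X) [Fintype Y] [Fintype (X ⧸ Y)]
    (hY : (Fintype.card Y : k) = 0)
    (h : ∀ a : X ⧸ Y, a ≠ (1 : X) → (Nat.card (MulAction.stabilizer Y a) : k) ≠ 0) :
    (Fintype.card (X ⧸ Y) : k) = 1 := by
  classical
  obtain ⟨c, hc⟩ := orbit_fun k Y (X ⧸ Y)
  let c' : X ⧸ Y → k := fun a => if a = (1 : X) then 0 else c a
  have fix : ∀ (y : Y) (a : X ⧸ Y), y • a = (1 : X) ↔ a = (1 : X) := by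
    have h1 : ∀ y : Y, y • ((1 : X) : X ⧸ Y) = (1 : X) := by
      intro y
      change (((y : X) * 1 : X) : X ⧸ Y) = (1 : X)
      rw [QuotientGroup.eq]; simp
    intro y a
    rw [← h1 y, smul_left_cancel_iff, h1 y]
  have e1 : ∀ a : X ⧸ Y, ∑ y : Y, c' (y • a) = if a = (1 : X) then 0 else 1 := by
    intro a
    simp only [c', fix]
    split_ifs with ha
    · simp
    · exact hc a (h a ha)
  have e2 : ∑ a : X ⧸ Y, ∑ y : Y, c' (y • a) = 0 := by
    rw [Finset.sum_comm]
    have : ∀ y : Y, ∑ a : X ⧸ Y, c' (y • a) = ∑ a, c' a := fun y =>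
      Fintype.sum_equiv (MulAction.toPerm y) _ _ (fun s => by simp)
    simp_rw [this]
    simp [hY]
  simp_rw [e1] at e2
  have : ∀ a : X ⧸ Y, (if a = (1 : X) then (0:k) else 1) = 1 - if a = (1 : X) then 1 else 0 := by
    intro a; split_ifs <;> simp
  simp_rw [this, Finset.sum_sub_distrib] at e2
  simp at e2
  exact sub_eq_zero.1 e2

lemma stab_pair {p : ℕ} {X : Type} [Group X] {Y : Subgroup X}
    (h : ∀ g : X, g ∉ Y → ¬ p ∣ Nat.card ↥(Y ⊓ Y.map (MulAut.conj g).toMonoidHom))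
    (a b : X ⧸ Y) (hab : a ≠ b) : ¬ p ∣ Nat.card (MulAction.stabilizer X (a, b)) := by
  induction a using QuotientGroup.induction_on with | _ s =>
  induction b using QuotientGroup.induction_on with | _ t =>
  have := h (s⁻¹ * t) (fun hh => hab (QuotientGroup.eq.2 hh))
  convert this using 2
  refine Nat.card_congr ((MulAut.conj s⁻¹).toEquiv.subtypeEquiv fun g => ?_)
  have e1 : (g • (s : X ⧸ Y) = s) ↔ s⁻¹ * g * s ∈ Y := by
    change ((g * s : X) : X ⧸ Y) = s ↔ _
    rw [eq_comm, QuotientGroup.eq, mul_assoc]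
  have e2 : (g • (t : X ⧸ Y) = t) ↔ t⁻¹ * g * t ∈ Y := by
    change ((g * t : X) : X ⧸ Y) = t ↔ _
    rw [eq_comm, QuotientGroup.eq, mul_assoc]
  rw [MulAction.mem_stabilizer_iff, Prod.smul_mk, Prod.mk.injEq, e1, e2, Subgroup.mem_inf,
    Subgroup.mem_map_equiv, MulAut.conj_symm_apply]
  simp [mul_assoc]

lemma stab_one {p : ℕ} {X : Type} [Group X] {Y : Subgroup X}
    (h : ∀ g : X, g ∉ Y → ¬ p ∣ Nat.card ↥(Y ⊓ Y.map (MulAut.conj g).toMonoidHom))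
    (a : X ⧸ Y) (ha : a ≠ (1 : X)) : ¬ p ∣ Nat.card (MulAction.stabilizer Y a) := by
  induction a using QuotientGroup.induction_on with | _ t =>
  have := h t (fun hh => ha (QuotientGroup.eq.2 (by simpa using hh)))
  convert this using 2
  have key : ∀ y : Y, y ∈ MulAction.stabilizer Y (t : X ⧸ Y) ↔
      (y : X) ∈ Y.map (MulAut.conj t).toMonoidHom := by
    intro y
    rw [MulAction.mem_stabilizer_iff, Subgroup.mem_map_equiv]
    change (((y : X) * t : X) : X ⧸ Y) = t ↔ _
    rw [eq_comm, QuotientGroup.eq]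
    simp [mul_assoc]
  exact Nat.card_congr
    { toFun := fun y => ⟨y.1.1, y.1.2, (key _).1 y.2⟩
      invFun := fun y => ⟨⟨y.1, y.2.1⟩, (key _).2 y.2.2⟩
      left_inv := fun y => rfl
      right_inv := fun y => rfl }

lemma out_smul' {X : Type} [Group X] {Y : Subgroup X} (g : X) (a : X ⧸ Y) :
    ∃ y : Y, (g • a).out = g * a.out * y := by
  have h : ((g * a.out : X) : X ⧸ Y) = (((g • a).out : X) : X ⧸ Y) := by
    rw [QuotientGroup.out_eq']
    change g • ((a.out : X) : X ⧸ Y) = _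
    rw [QuotientGroup.out_eq']
  rw [QuotientGroup.eq] at h
  exact ⟨⟨_, h⟩, by simp [mul_assoc]⟩

lemma sum_cosets {X W : Type} [Group X] [Fintype X] [AddCommMonoid W] (Y : Subgroup X) [Fintype Y]
    [Fintype (X ⧸ Y)] (F : X → W) :
    ∑ g, F g = ∑ a : X ⧸ Y, ∑ y : Y, F (a.out * y) := by
  rw [← Fintype.sum_prod_type']
  refine (Fintype.sum_bijective (fun q : (X ⧸ Y) × Y => q.1.out * (q.2 : X)) ⟨?_, ?_⟩ _ _
    (fun _ => rfl)).symm
  · rintro ⟨a, y⟩ ⟨b, z⟩ h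
    simp only at h
    have : a = b := by
      rw [← QuotientGroup.out_eq' a, ← QuotientGroup.out_eq' b, QuotientGroup.eq]
      have : a.out⁻¹ * b.out = y * (z : X)⁻¹ := by
        rw [inv_mul_eq_iff_eq_mul, ← mul_assoc, h]; simp
      rw [this]
      exact Y.mul_mem y.2 (Y.inv_mem z.2)
    subst this
    simpa using h
  · intro g
    have h : (((g : X ⧸ Y).out : X) : X ⧸ Y) = g := QuotientGroup.out_eq' _
    rw [QuotientGroup.eq] at h
    exact ⟨((g : X ⧸ Y), ⟨_, h⟩), by simp⟩

lemma EInd.dual {k X M L : Type} [Field k] [Group X] {Y : Subgroup X} [Fintype (X ⧸ Y)]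
    [AddCommGroup M] [Module k M]
    [AddCommGroup L] [Module k L] {ρ : Representation k X M} {l : Representation k Y L}
    {i : L →ₗ[k] M} {e : M →ₗ[k] L} (h : EInd Y ρ l i e) :
    EInd Y ρ.dual l.dual e.dualMap i.dualMap where
  ieq y f := by
    ext x
    have := h.eeq y⁻¹ x
    simp only [Subgroup.coe_inv] at this
    simp [this, Module.Dual.transpose_apply]
  eeq y f := by
    ext x
    have := h.ieq y⁻¹ x
    simp only [Subgroup.coe_inv] at this
    simp [this, Module.Dual.transpose_apply]
  ei f := by ext x; simp [h.ei]
  orth g hg f := by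
    ext x
    have := h.orth g⁻¹ (by simpa using hg) x
    simp [this, Module.Dual.transpose_apply]
  sum f := by
    ext x
    have := congrArg f (h.sum x)
    rw [map_sum] at this
    simpa [Module.Dual.transpose_apply] using this

lemma EInd.Qeq {k X M L : Type} [Field k] [Group X] {Y : Subgroup X} [Fintype (X ⧸ Y)]
    [AddCommGroup M] [Module k M]
    [AddCommGroup L] [Module k L] {ρ : Representation k X M} {l : Representation k Y L}
    {i : L →ₗ[k] M} {e : M →ₗ[k] L} (h : EInd Y ρ l i e) (g : X) (a : X ⧸ Y) :
    ρ g ∘ₗ (ρ a.out ∘ₗ i ∘ₗ e ∘ₗ ρ a.out⁻¹) ∘ₗ ρ g⁻¹ =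
      ρ (g • a).out ∘ₗ i ∘ₗ e ∘ₗ ρ (g • a).out⁻¹ := by
  obtain ⟨y, hy⟩ := out_smul' g a
  ext x
  rw [hy]
  have := h.eeq y⁻¹
  simp only [Subgroup.coe_inv] at this
  simp only [mul_inv_rev, map_mul, LinearMap.comp_apply, Module.End.mul_apply, this]
  rw [← h.ieq, Representation.self_inv_apply]

lemma main_good {k X M L D K : Type} [Field k] [Group X] [Fintype X] (Y : Subgroup X) [Fintype Y]
    [Fintype (X ⧸ Y)] [AddCommGroup M] [Module k M] [AddCommGroup L] [Module k L]
    [AddCommGroup D] [Module k D] [AddCommGroup K] [Module k K]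
    {ρ : Representation k X M} {l : Representation k Y L}
    {i : L →ₗ[k] M} {e : M →ₗ[k] L} (h : EInd Y ρ l i e)
    {ρ' : Representation k X D} {l' : Representation k Y K}
    {i' : K →ₗ[k] D} {e' : D →ₗ[k] K} (h' : EInd Y ρ' l' i' e')
    (hn : (Fintype.card (X ⧸ Y) : k) = 1)
    (hs : ∀ a b : X ⧸ Y, a ≠ b → (Nat.card (MulAction.stabilizer X (a, b)) : k) ≠ 0)
    (hL : EGood (l.tprod l')) : EGood (ρ.tprod ρ') := by
  classical
  obtain ⟨v0, f0, θ0, hv, hf, hfv, hθ⟩ := hL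
  set σ := ρ.tprod ρ' with hσ
  set τ := l.tprod l' with hτ
  let J : L ⊗[k] K →ₗ[k] M ⊗[k] D := TensorProduct.map i i'
  let E : M ⊗[k] D →ₗ[k] L ⊗[k] K := TensorProduct.map e e'
  have Jeq : ∀ (y : Y) x, J (τ y x) = σ y (J x) := by
    intro y x
    refine LinearMap.congr_fun (f := J ∘ₗ τ y) (g := σ y ∘ₗ J) (TensorProduct.ext' ?_) x
    intro m d
    simp [J, hσ, hτ, h.ieq, h'.ieq]
  have Eeq : ∀ (y : Y) x, E (σ y x) = τ y (E x) := by
    intro y x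
    refine LinearMap.congr_fun (f := E ∘ₗ σ y) (g := τ y ∘ₗ E) (TensorProduct.ext' ?_) x
    intro m d
    simp [E, hσ, hτ, h.eeq, h'.eeq]
  have EJ : ∀ x, E (J x) = x := by
    intro x
    refine LinearMap.congr_fun (f := E ∘ₗ J) (g := LinearMap.id) (TensorProduct.ext' ?_) x
    intro m d
    simp [E, J, h.ei, h'.ei]
  have Eorth : ∀ g, g ∉ Y → ∀ x, E (σ g (J x)) = 0 := by
    intro g hg x
    refine LinearMap.congr_fun (f := E ∘ₗ σ g ∘ₗ J) (g := 0) (TensorProduct.ext' ?_) x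
    intro m d
    simp [E, J, hσ, h.orth g hg]
  let Q : X ⧸ Y → M →ₗ[k] M := fun a => ρ a.out ∘ₗ i ∘ₗ e ∘ₗ ρ a.out⁻¹
  let Q' : X ⧸ Y → D →ₗ[k] D := fun a => ρ' a.out ∘ₗ i' ∘ₗ e' ∘ₗ ρ' a.out⁻¹
  let w : X ⧸ Y → M ⊗[k] D := fun a => σ a.out (J v0)
  let F : X ⧸ Y → M ⊗[k] D →ₗ[k] k := fun a => f0 ∘ₗ E ∘ₗ σ a.out⁻¹
  have hw : ∀ g a, σ g (w a) = w (g • a) := by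
    intro g a
    obtain ⟨y, hy⟩ := out_smul' g a
    simp only [w]
    rw [hy, map_mul, map_mul, Module.End.mul_apply, Module.End.mul_apply, ← Jeq, hv]
  have hF : ∀ g a x, F a (σ g⁻¹ x) = F (g • a) x := by
    intro g a x
    obtain ⟨y, hy⟩ := out_smul' g a
    simp only [F, LinearMap.comp_apply]
    rw [hy, mul_inv_rev, mul_inv_rev, map_mul, map_mul, Module.End.mul_apply, Module.End.mul_apply,
      ← Subgroup.coe_inv, Eeq, hf]
  have hFw : ∀ a b, F b (w a) = if b = a then 1 else 0 := by
    intro a b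
    simp only [F, w, LinearMap.comp_apply]
    rw [← Module.End.mul_apply, ← map_mul]
    split_ifs with hab
    · subst hab
      simp [EJ, hfv]
    · rw [Eorth _ (fun hh => hab ?_), map_zero]
      rw [← QuotientGroup.out_eq' a, ← QuotientGroup.out_eq' b, QuotientGroup.eq]
      exact hh
  let A : (X ⧸ Y) × (X ⧸ Y) → (M ⊗[k] D →ₗ[k] M ⊗[k] D) := fun s =>
    TensorProduct.map (Q s.1) (Q' s.2) - (F s.2).smulRight (w s.1)
  have hA : ∀ g s x, σ g (A s (σ g⁻¹ x)) = A (g • s) x := by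
    rintro g ⟨a, b⟩ x
    simp only [A, LinearMap.sub_apply, map_sub, LinearMap.smulRight_apply, map_smul, hw, hF,
      Prod.smul_mk]
    congr 1
    simp only [hσ, Representation.tprod_apply]
    rw [← LinearMap.comp_apply, ← LinearMap.comp_apply, ← TensorProduct.map_comp,
      ← TensorProduct.map_comp]
    have e1 := h.Qeq g a
    have e2 := h'.Qeq g b
    simp only [Q, Q']
    rw [← e1, ← e2]
    rfl
  obtain ⟨θ1, h1⟩ := trace_fam σ 
    (fun s : (X ⧸ Y) × (X ⧸ Y) => if s.1 = s.2 then 0 else A s) (by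
    rintro g ⟨a, b⟩ x
    by_cases hab : a = b
    · simp [hab]
    · simp [hab, hA]) (by
    rintro ⟨a, b⟩
    by_cases hab : a = b
    · simp [hab]
    · exact Or.inr (hs a b hab))
  have hdiag : ∀ x, ∑ g, σ g (J (θ0 (E (σ g⁻¹ x)))) = ∑ a, A (a, a) x := by
    intro x
    rw [sum_cosets Y]
    refine Finset.sum_congr rfl fun a _ => ?_
    have : ∀ y : Y, σ (a.out * y) (J (θ0 (E (σ (a.out * y)⁻¹ x)))) =
        σ a.out (J (τ y (θ0 (τ y⁻¹ (E (σ a.out⁻¹ x)))))) := by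
      intro y
      rw [Jeq, ← Eeq, mul_inv_rev, map_mul, map_mul]
      rfl
    simp_rw [this]
    rw [← map_sum, ← map_sum, hθ, map_sub, map_sub, map_smul, map_smul]
    simp only [A, LinearMap.sub_apply, LinearMap.smulRight_apply]
    congr 1
    simp only [J, E, hσ, Representation.tprod_apply, Q, Q', TensorProduct.map_comp]
    rfl
  have hall : ∀ x, ∑ s, A s x = x - (∑ b, F b x) • ∑ a, w a := by
    intro x
    have e1 : ∑ a, Q a = LinearMap.id := by
      ext m; simpa [Q] using h.sum m
    have e2 : ∑ a, Q' a = LinearMap.id := by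
      ext m; simpa [Q'] using h'.sum m
    simp only [A, LinearMap.sub_apply, Finset.sum_sub_distrib, LinearMap.smulRight_apply]
    congr 1
    · rw [Fintype.sum_prod_type]
      have : TensorProduct.map (∑ a, Q a) (∑ b, Q' b) x = x := by
        rw [e1, e2]; simp
      conv_rhs => rw [← this]
      rw [← TensorProduct.mapBilinear_apply]
      simp [TensorProduct.mapBilinear_apply]
      exact Finset.sum_comm
    · rw [Fintype.sum_prod_type, Finset.smul_sum]
      simp [Finset.sum_smul]
  refine ⟨∑ a, w a, ∑ b, F b, J ∘ₗ θ0 ∘ₗ E + θ1, ?_, ?_, ?_, ?_⟩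
  · intro g
    rw [map_sum]
    exact Fintype.sum_equiv (MulAction.toPerm g) _ _ (fun a => by simp [hw])
  · intro g x
    simp only [LinearMap.sum_apply]
    refine Fintype.sum_equiv (MulAction.toPerm g⁻¹) _ _ (fun a => ?_)
    rw [MulAction.toPerm_apply, ← hF, inv_inv]
  · simp [hFw, hn]
  · intro x
    simp only [LinearMap.add_apply, map_add, Finset.sum_add_distrib, LinearMap.sum_apply]
    rw [h1, ← hall x]
    simp only [LinearMap.comp_apply]
    rw [hdiag, Fintype.sum_prod_type, Fintype.sum_prod_type, ← Finset.sum_add_distrib]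
    refine Finset.sum_congr rfl fun a _ => ?_
    rw [← Finset.add_sum_erase _ (fun b => A (a, b) x) (Finset.mem_univ a),
      ← Finset.add_sum_erase _ _ (Finset.mem_univ a)]
    simp only [if_true, LinearMap.zero_apply, zero_add]
    congr 1
    refine Finset.sum_congr rfl fun b hb => ?_
    rw [if_neg (Finset.ne_of_mem_erase hb).symm]

lemma ind_EInd {k X : Type} [Field k] [Group X] {Y : Subgroup X} [Fintype (X ⧸ Y)]
    (L : Rep k ↥Y) : ∃ i e, EInd Y (indρ L) L.ρ i e := by
  classical
  let i : L.V →ₗ[k] indCarrier L :=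
    { toFun := fun v => ⟨fun x => if h : x ∈ Y then L.ρ ⟨x, h⟩ v else 0, by
        intro y x
        by_cases hx : x ∈ Y
        · have : (y : X) * x ∈ Y := Y.mul_mem y.2 hx
          simp only [hx, this, dif_pos]
          rw [← Module.End.mul_apply, ← map_mul]
          rfl
        · have : (y : X) * x ∉ Y := fun h => hx ((Y.mul_mem_cancel_left y.2).1 h)
          simp only [hx, this, dif_neg, not_false_eq_true, map_zero]⟩
      map_add' := by
        intro v w
        refine Subtype.ext (funext fun x => ?_)
        by_cases hx : x ∈ Y <;> simp [hx]
      map_smul' := by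
        intro c w
        refine Subtype.ext (funext fun x => ?_)
        by_cases hx : x ∈ Y <;> simp [hx] }
  let e : indCarrier L →ₗ[k] L.V :=
    { toFun := fun f => f.1 1
      map_add' := fun _ _ => rfl
      map_smul' := fun _ _ => rfl }
  have hi : ∀ v x, (i v).1 x = if h : x ∈ Y then L.ρ ⟨x, h⟩ v else 0 := fun _ _ => rfl
  have he : ∀ f, e f = f.1 1 := fun _ => rfl
  have hr : ∀ g f x, (indρ L g f).1 x = f.1 (x * g) := fun _ _ _ => rfl
  refine ⟨i, e, ?_, ?_, ?_, ?_, ?_⟩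
  · intro y v
    refine Subtype.ext (funext fun x => ?_)
    rw [hr, hi, hi]
    by_cases hx : x ∈ Y
    · have : x * (y : X) ∈ Y := Y.mul_mem hx y.2
      simp only [hx, this, dif_pos]
      rw [← Module.End.mul_apply, ← map_mul]
      rfl
    · simp [hx, Y.mul_mem_cancel_right y.2]
  · intro y f
    rw [he, hr, he, ← f.2 y 1]
    simp
  · intro v
    rw [he, hi]
    simp only [Y.one_mem, dif_pos]
    change L.ρ 1 v = v
    simp
  · intro g hg v
    rw [he, hr, hi]
    simp [hg]
  · intro f
    refine Subtype.ext (funext fun x => ?_)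
    rw [AddSubmonoidClass.coe_finsetSum, Finset.sum_apply]
    simp only [hr, hi, he]
    rw [Finset.sum_eq_single ((x⁻¹ : X) : X ⧸ Y)]
    · have h : (((x⁻¹ : X) : X ⧸ Y)) = ((((x⁻¹ : X) : X ⧸ Y).out : X) : X ⧸ Y) :=
        (QuotientGroup.out_eq' _).symm
      rw [QuotientGroup.eq, inv_inv] at h
      rw [dif_pos h, ← f.2]
      simp
    · intro a _ ha
      rw [dif_neg]
      intro hh
      apply ha
      rw [← QuotientGroup.out_eq' a, eq_comm, QuotientGroup.eq]
      simpa using hh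
    · simp

lemma rep_ext' {k G : Type} [Field k] [Group G] {A B : Rep k G} {f g : A ⟶ B}
    (h : ∀ x, f.hom x = g.hom x) : f = g := by
  apply Rep.hom_ext
  exact DFunLike.ext _ _ h

lemma proj_trace {k G : Type} [Field k] [Group G] [Fintype G] (N : Rep k G)
    (hN : Projective N) : ∃ θ : N.V →ₗ[k] N.V, ∀ x, ∑ g : G, N.ρ g (θ (N.ρ g⁻¹ x)) = x := by
  classical
  let r : Representation k G (G → N.V) :=
    { toFun := fun g =>
        { toFun := fun f x => f (x * g)
          map_add' := fun _ _ => rfl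
          map_smul' := fun _ _ => rfl }
      map_one' := by ext; simp
      map_mul' := by intro a b; refine LinearMap.ext fun f => funext fun x => ?_; simp [mul_assoc] }
  have hr : ∀ g f x, r g f x = f (x * g) := fun _ _ _ => rfl
  let q : (G → N.V) →ₗ[k] N.V :=
    { toFun := fun f => ∑ x : G, N.ρ x⁻¹ (f x)
      map_add' := by intro f g; simp [Finset.sum_add_distrib]
      map_smul' := by intro c f; simp [Finset.smul_sum] }
  have hq : ∀ f, q f = ∑ x : G, N.ρ x⁻¹ (f x) := fun _ => rfl
  let Q : r.IntertwiningMap N.ρ := ⟨q, by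
    intro g
    refine LinearMap.ext fun f => ?_
    simp only [LinearMap.comp_apply, hq, hr, map_sum]
    refine Fintype.sum_equiv (Equiv.mulRight g) _ _ fun x => ?_
    rw [← Module.End.mul_apply, ← map_mul]
    simp⟩
  have hQ : ∀ f, Q f = ∑ x : G, N.ρ x⁻¹ (f x) := fun _ => rfl
  let π : Rep.of r ⟶ N := Rep.ofHom Q
  have : Epi π := by
    rw [Rep.epi_iff_surjective]
    intro n
    refine ⟨Pi.single 1 n, ?_⟩
    change Q _ = n
    rw [hQ, Finset.sum_eq_single 1]
    · simp
    · intro b _ hb; simp [hb]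
    · simp
  let s := Projective.factorThru (𝟙 N) π
  have hs : s ≫ π = 𝟙 N := Projective.factorThru_comp _ _
  let sl : N.V →ₗ[k] (G → N.V) := s.hom.toLinearMap
  have hsl : ∀ n, ∑ x : G, N.ρ x⁻¹ (sl n x) = n := by
    intro n
    rw [← hQ]
    exact congrArg (fun f : N ⟶ N => f.hom n) hs
  have hse : ∀ g n, sl (N.ρ g n) = r g (sl n) := fun g n => Rep.hom_comm_apply s g n
  refine ⟨LinearMap.proj 1 ∘ₗ sl, fun x => ?_⟩
  simp only [LinearMap.comp_apply, hse, LinearMap.proj_apply, hr, one_mul]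
  conv_rhs => rw [← hsl x]
  exact Fintype.sum_equiv (Equiv.inv G) _ _ fun g => by simp

lemma good_of_iso {k G : Type} [Field k] [Group G] [Fintype G] (V N : Rep k G)
    (hN : Projective N) (e : V ≅ 𝟙_ (Rep k G) ⊞ N) : EGood V.ρ := by
  obtain ⟨θ, hθ⟩ := proj_trace N hN
  let i1 : 𝟙_ (Rep k G) ⟶ V := biprod.inl ≫ e.inv
  let p1 : V ⟶ 𝟙_ (Rep k G) := e.hom ≫ biprod.fst
  let i2 : N ⟶ V := biprod.inr ≫ e.inv
  let p2 : V ⟶ N := e.hom ≫ biprod.snd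
  have h11 : i1 ≫ p1 = 𝟙 _ := by simp [i1, p1]
  have ht : p1 ≫ i1 + p2 ≫ i2 = 𝟙 V := by
    have : p1 ≫ i1 + p2 ≫ i2 = e.hom ≫ (biprod.fst ≫ biprod.inl + biprod.snd ≫ biprod.inr) ≫
        e.inv := by
      simp only [i1, p1, i2, p2, Preadditive.comp_add, Preadditive.add_comp, Category.assoc]
    rw [this, biprod.total, Category.id_comp, e.hom_inv_id]
  have ht' : ∀ x, i2.hom (p2.hom x) = x - i1.hom (p1.hom x) := by
    intro x
    rw [eq_sub_iff_add_eq']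
    exact congrArg (fun f : V ⟶ V => f.hom x) ht
  let one : (𝟙_ (Rep k G)).V := (1 : k)
  have hsm : ∀ c : k, i1.hom (show (𝟙_ (Rep k G)).V from c) = c • i1.hom one := by
    intro c
    rw [← map_smul]
    congr 1
    exact (mul_one c).symm
  refine ⟨i1.hom one, p1.hom.toLinearMap, i2.hom.toLinearMap ∘ₗ θ ∘ₗ p2.hom.toLinearMap,
    ?_, ?_, ?_, ?_⟩
  · intro g
    rw [← Rep.hom_comm_apply]
    rfl
  · intro g x
    exact Rep.hom_comm_apply p1 g x
  · exact congrArg (fun f : 𝟙_ (Rep k G) ⟶ 𝟙_ (Rep k G) => f.hom one) h11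
  · intro x
    have e1 : ∀ g, V.ρ g (i2.hom (θ (p2.hom (V.ρ g⁻¹ x)))) =
        i2.hom (N.ρ g (θ (N.ρ g⁻¹ (p2.hom x)))) := by
      intro g
      rw [Rep.hom_comm_apply, Rep.hom_comm_apply]
    change ∑ g : G, V.ρ g (i2.hom (θ (p2.hom (V.ρ g⁻¹ x)))) = _
    simp_rw [e1]
    rw [← map_sum, hθ, ht']
    congr 1
    exact hsm _

lemma proj_of_trace {k G : Type} [Field k] [Group G] [Fintype G] (N : Rep k G)
    (θ : N.V →ₗ[k] N.V) (hθ : ∀ x, ∑ g : G, N.ρ g (θ (N.ρ g⁻¹ x)) = x) : Projective N := by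
  refine ⟨fun {E B} h e he => ?_⟩
  rw [Rep.epi_iff_surjective] at he
  obtain ⟨s, hs⟩ := LinearMap.exists_rightInverse_of_surjective e.hom.toLinearMap
    (LinearMap.range_eq_top.2 he)
  have hs' : ∀ b, e.hom (s b) = b := fun b => LinearMap.congr_fun hs b
  let t : N.V →ₗ[k] E.V := ∑ g : G, E.ρ g ∘ₗ s ∘ₗ h.hom.toLinearMap ∘ₗ θ ∘ₗ N.ρ g⁻¹
  have ht : ∀ x, t x = ∑ g : G, E.ρ g (s (h.hom (θ (N.ρ g⁻¹ x)))) := by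
    intro x
    simp only [t, LinearMap.sum_apply]
    rfl
  let T : N.ρ.IntertwiningMap E.ρ := ⟨t, by
    intro a
    refine LinearMap.ext fun x => ?_
    simp only [LinearMap.comp_apply, ht, map_sum]
    refine Fintype.sum_equiv (Equiv.mulLeft a⁻¹) _ _ fun g => ?_
    simp only [Equiv.coe_mulLeft, mul_inv_rev, inv_inv, map_mul, Module.End.mul_apply,
      Representation.self_inv_apply]⟩
  refine ⟨Rep.ofHom T, ?_⟩
  ext x
  change e.hom (t x) = h.hom x
  rw [ht, map_sum]
  simp_rw [Rep.hom_comm_apply, hs', ← Rep.hom_comm_apply]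
  rw [← map_sum, hθ]

lemma iso_of_good {k G : Type} [Field k] [Group G] [Fintype G] (V : Rep k G)
    (hV : EGood V.ρ) : ∃ N : Rep k G, Projective N ∧ Nonempty (V ≅ 𝟙_ (Rep k G) ⊞ N) := by
  obtain ⟨v, f, θ, hv, hf, hfv, hθ⟩ := hV
  let W := LinearMap.ker f
  let r : Representation k G W :=
    { toFun := fun g => (V.ρ g).restrict (fun x hx => by
        rw [LinearMap.mem_ker] at hx ⊢; rw [hf, hx])
      map_one' := by ext; simp
      map_mul' := by intro a b; ext; simp [LinearMap.restrict_apply] }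
  have hr : ∀ g (x : W), (r g x : V.V) = V.ρ g x := fun _ _ => rfl
  let P : V.V →ₗ[k] W := LinearMap.codRestrict W (LinearMap.id - f.smulRight v) (fun x => by
    simp [W, hfv])
  have hP : ∀ x, (P x : V.V) = x - f x • v := fun _ => rfl
  have hPW : ∀ x : W, P x = x := fun x => Subtype.ext (by rw [hP, LinearMap.mem_ker.1 x.2]; simp)
  have hPe : ∀ g x, P (V.ρ g x) = r g (P x) := fun g x => Subtype.ext (by
    rw [hr, hP, hP, hf, map_sub, map_smul, hv])
  let N : Rep k G := Rep.of r
  have hN : Projective N := by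
    refine proj_of_trace N (P ∘ₗ θ ∘ₗ W.subtype) fun x => ?_
    change ∑ g : G, r g (P (θ (r g⁻¹ x : W))) = x
    simp_rw [← hPe, hr]
    rw [← map_sum, hθ, map_sub, map_smul, LinearMap.mem_ker.1 (show x.1 ∈ W from x.2), hPW]
    simp
  refine ⟨N, hN, ?_⟩
  let i1 : 𝟙_ (Rep k G) ⟶ V := Rep.ofHom (σ := V.ρ) (ρ := Representation.trivial k G k)
    ⟨LinearMap.toSpanSingleton k V.V v, by intro g; ext; simp [hv]⟩
  let p1 : V ⟶ 𝟙_ (Rep k G) := Rep.ofHom (ρ := V.ρ) (σ := Representation.trivial k G k)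
    ⟨f, by intro g; ext x; simp [hf]⟩
  let i2 : N ⟶ V := Rep.ofHom (ρ := r) (σ := V.ρ) ⟨W.subtype, by intro g; rfl⟩
  let p2 : V ⟶ N := Rep.ofHom (ρ := V.ρ) (σ := r)
    ⟨P, by intro g; exact LinearMap.ext (hPe g)⟩
  have h11 : i1 ≫ p1 = 𝟙 _ := by
    refine rep_ext' fun (x : k) => ?_
    change f (x • v) = x
    rw [map_smul, hfv]; exact mul_one x
  have h12 : i1 ≫ p2 = 0 := by
    refine rep_ext' fun (x : k) => ?_
    change P (x • v) = 0
    apply Subtype.ext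
    rw [hP, map_smul, hfv]; simp
  have h21 : i2 ≫ p1 = 0 := by
    refine rep_ext' fun x => ?_
    exact x.2
  have h22 : i2 ≫ p2 = 𝟙 _ := by
    refine rep_ext' fun x => ?_
    exact hPW x
  have ht : p1 ≫ i1 + p2 ≫ i2 = 𝟙 V := by
    refine rep_ext' fun x => ?_
    change f x • v + (P x : V.V) = x
    rw [hP]; simp
  exact ⟨{ hom := biprod.lift p1 p2
           inv := biprod.desc i1 i2
           hom_inv_id := by rw [biprod.lift_desc]; exact ht
           inv_hom_id := by
             apply biprod.hom_ext' <;> apply biprod.hom_ext <;> simp [h11, h12, h21, h22] }⟩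

/-- If `Y` is strongly `p`-embedded in `X` and `L` is an endo-trivial `kY`-module,
then `Ind_Y^X L` is an endo-trivial `kX`-module. -/
theorem endoTrivial_of_induced_from_strongly_p_embedded
    (p : ℕ) (hp : p.Prime) (k : Type) [Field k] [IsAlgClosed k] [CharP k p]
    (X : Type) [Group X] [Fintype X] (hpX : p ∣ Fintype.card X)
    (Y : Subgroup X) (hY : StronglyPEmbedded p Y) (L : Rep k ↥Y)
    (hL : IsEndoTrivial L) :
    IsEndoTrivial (indRep L) := by

  classical
  obtain ⟨N, hN, ⟨iso⟩⟩ := hL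
  have hgood : EGood (L.ρ.tprod L.ρ.dual) := good_of_iso _ N hN iso
  obtain ⟨i, e, hie⟩ := ind_EInd L
  have hY1 : (Fintype.card Y : k) = 0 := by
    rw [CharP.cast_eq_zero_iff k p, ← Nat.card_eq_fintype_card]
    exact hY.1
  have hn := card_one (k := k) Y hY1 (fun a ha => by
    rw [Ne, CharP.cast_eq_zero_iff k p]
    exact stab_one hY.2 a ha)
  have := main_good Y hie hie.dual hn (fun a b hab => by
    rw [Ne, CharP.cast_eq_zero_iff k p]
    exact stab_pair hY.2 a b hab) hgood
  exact iso_of_good (indRep L ⊗ Rep.of (indRep L).ρ.dual) this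
end

section
/- If Y is a strongly p-embedded subgroup of a finite group X, then the only non-projective indecomposable direct summand of the permutation module Ind_Y^X(k) is the trivial module k. -/
open CategoryTheory Limits MonoidalCategory

/-- `S` is a direct summand of `M`. -/
def IsDirectSummand {k : Type} [Field k] {G : Type} [Group G] (S M : Rep k G) : Prop :=
  ∃ N : Rep k G, Nonempty (M ≅ S ⊞ N)

/-- `S` is an indecomposable representation: it is nonzero and in any direct sum
decomposition one factor vanishes. -/
def IsIndecomposable {k : Type} [Field k] {G : Type} [Group G] (S : Rep k G) : Prop :=
  ¬ IsZero S ∧ ∀ A B : Rep k G, Nonempty (S ≅ A ⊞ B) → IsZero A ∨ IsZero B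

theorem exists_transversal_fun {k X Z : Type} [Field k] [Group X] [Fintype X] [MulAction X Z]
    (P : Z → Prop) (hP : ∀ (x : X) z, P (x • z) ↔ P z)
    (hc : ∀ z, P z → (Nat.card (MulAction.stabilizer X z) : k) ≠ 0) :
    ∃ f : Z → k, ∀ z, (P z → ∑ x : X, f (x⁻¹ • z) = 1) ∧ (¬ P z → ∑ x : X, f (x⁻¹ • z) = 0) := by
  classical
  let out : Z → Z := fun z => (Quotient.mk (MulAction.orbitRel X Z) z).out
  have hout : ∀ z, ∃ g : X, g • z = out z := fun z => by
    have := Quotient.exact (s := MulAction.orbitRel X Z)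
      (Quotient.out_eq (Quotient.mk (MulAction.orbitRel X Z) z))
    exact this
  have hinv : ∀ (x : X) z, out (x • z) = out z := fun x z => by
    have : Quotient.mk (MulAction.orbitRel X Z) (x • z) = Quotient.mk _ z :=
      Quotient.sound ⟨x, rfl⟩
    simp only [out, this]
  refine ⟨fun z => if P z ∧ z = out z then (Nat.card (MulAction.stabilizer X z) : k)⁻¹ else 0,
    fun z => ⟨fun hz => ?_, fun hz => ?_⟩⟩
  · obtain ⟨g, hg⟩ := hout z
    have hr : P (out z) := by rw [← hg, hP]; exact hz
    have h1 : ∀ x : X, (if P (x⁻¹ • z) ∧ x⁻¹ • z = out (x⁻¹ • z) then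
        (Nat.card (MulAction.stabilizer X (x⁻¹ • z)) : k)⁻¹ else 0) =
        if x⁻¹ • z = out z then (Nat.card (MulAction.stabilizer X (out z)) : k)⁻¹ else 0 := by
      intro x
      rw [hinv, hP]
      by_cases h : x⁻¹ • z = out z
      · simp [h, hz]
      · simp [h]
    simp only [h1]
    rw [← Finset.sum_filter, Finset.sum_const, nsmul_eq_mul]
    have h2 : (Finset.univ.filter fun x : X => x⁻¹ • z = out z).card =
        Nat.card (MulAction.stabilizer X (out z)) := by
      rw [← Fintype.card_subtype, ← Nat.card_eq_fintype_card]
      refine Nat.card_congr ⟨fun x => ⟨x.1⁻¹ * g⁻¹, ?_⟩, fun y => ⟨(y.1 * g)⁻¹, ?_⟩, ?_, ?_⟩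
      · rw [MulAction.mem_stabilizer_iff, mul_smul, inv_smul_eq_iff.2 hg.symm, x.2]
      · have := y.2
        rw [MulAction.mem_stabilizer_iff] at this
        rw [inv_inv, mul_smul, hg, this]
      · intro x; simp
      · intro x; simp
    rw [h2, mul_inv_cancel₀ (hc _ hr)]
  · apply Finset.sum_eq_zero
    intro x _
    simp [hP, hz]

theorem stab_card {p : ℕ} {X : Type} [Group X] [Fintype X] (Y : Subgroup X)
    (hY : ∀ g : X, g ∉ Y → ¬ p ∣ Nat.card ↥(Y ⊓ Y.map (MulAut.conj g).toMonoidHom))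
    (z : (X ⧸ Y) × (X ⧸ Y)) (hz : z.1 ≠ z.2) :
    ¬ p ∣ Nat.card (MulAction.stabilizer X z) := by
  obtain ⟨a, b⟩ := z
  induction a using QuotientGroup.induction_on with | _ g
  induction b using QuotientGroup.induction_on with | _ h
  have hu : g⁻¹ * h ∉ Y := fun hh => hz (QuotientGroup.eq.2 hh)
  have e : Nat.card (MulAction.stabilizer X ((g : X ⧸ Y), (h : X ⧸ Y))) =
      Nat.card ↥(Y ⊓ Y.map (MulAut.conj (g⁻¹ * h)).toMonoidHom) := by
    have key : ∀ x : X, x ∈ MulAction.stabilizer X ((g : X ⧸ Y), (h : X ⧸ Y)) ↔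
        g⁻¹ * x * g ∈ Y ⊓ Y.map (MulAut.conj (g⁻¹ * h)).toMonoidHom := by
      intro x
      rw [MulAction.mem_stabilizer_iff, Prod.smul_mk, Prod.mk.injEq, Subgroup.mem_inf,
        eq_comm, MulAction.Quotient.smul_coe, QuotientGroup.eq, eq_comm (a := x • (h : X ⧸ Y)),
        MulAction.Quotient.smul_coe, QuotientGroup.eq, Subgroup.mem_map_equiv]
      have e1 : (MulAut.conj (g⁻¹ * h)).symm (g⁻¹ * x * g) = h⁻¹ * x * h := by
        rw [MulAut.conj_symm_apply]; group
      rw [e1]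
      have e2 : (g⁻¹ * (x • g) ∈ Y ↔ g⁻¹ * x * g ∈ Y) := by rw [smul_eq_mul, mul_assoc]
      have e3 : (h⁻¹ * (x • h) ∈ Y ↔ h⁻¹ * x * h ∈ Y) := by rw [smul_eq_mul, mul_assoc]
      rw [e2, e3]
    refine Nat.card_congr ⟨fun x => ⟨g⁻¹ * x * g, (key _).1 x.2⟩,
      fun y => ⟨g * y * g⁻¹, (key _).2 ?_⟩, ?_, ?_⟩
    · have := y.2
      simpa [mul_assoc] using this
    · intro x; apply Subtype.ext; simp [mul_assoc]
    · intro x; apply Subtype.ext; simp [mul_assoc]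
  rw [e]
  exact hY _ hu

/-- The trace of a linear map between representations. -/
noncomputable def trHom {k X : Type} [Field k] [Group X] [Fintype X] {A B : Rep k X}
    (φ : A.V →ₗ[k] B.V) : A ⟶ B :=
  Rep.ofHom ⟨∑ x : X, B.ρ x ∘ₗ φ ∘ₗ A.ρ x⁻¹, by
    intro g
    ext v
    simp only [LinearMap.coe_comp, Function.comp_apply, LinearMap.sum_apply, map_sum]
    refine Fintype.sum_equiv (Equiv.mulLeft g⁻¹) _ _ fun x => ?_
    simp [← Module.End.mul_apply, ← map_mul]⟩

theorem trHom_apply {k X : Type} [Field k] [Group X] [Fintype X] {A B : Rep k X}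
    (φ : A.V →ₗ[k] B.V) (v : A.V) : (trHom φ).hom v = ∑ x : X, B.ρ x (φ (A.ρ x⁻¹ v)) := by
  change (∑ x : X, B.ρ x ∘ₗ φ ∘ₗ A.ρ x⁻¹) v = _
  simp

theorem comp_trHom {k X : Type} [Field k] [Group X] [Fintype X] {A B C : Rep k X}
    (f : A ⟶ B) (φ : B.V →ₗ[k] C.V) : f ≫ trHom φ = trHom (φ ∘ₗ f.hom.toLinearMap) := by
  ext v
  change (trHom φ).hom (f.hom v) = (trHom _).hom v
  rw [trHom_apply, trHom_apply]
  refine Finset.sum_congr rfl fun x _ => ?_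
  rw [← Rep.hom_comm_apply]
  rfl

theorem trHom_comp {k X : Type} [Field k] [Group X] [Fintype X] {A B C : Rep k X}
    (φ : A.V →ₗ[k] B.V) (f : B ⟶ C) : trHom φ ≫ f = trHom (f.hom.toLinearMap ∘ₗ φ) := by
  ext v
  change f.hom ((trHom φ).hom v) = (trHom _).hom v
  rw [trHom_apply, trHom_apply, map_sum]
  refine Finset.sum_congr rfl fun x _ => ?_
  rw [Rep.hom_comm_apply]
  rfl

theorem projective_of_trHom {k X : Type} [Field k] [Group X] [Fintype X] {S : Rep k X}
    (ψ : S.V →ₗ[k] S.V) (h : trHom ψ = 𝟙 S) : Projective S := by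
  refine ⟨fun {E B} f e he => ?_⟩
  have hs := (Rep.epi_iff_surjective e).1 he
  obtain ⟨s, hs⟩ := e.hom.toLinearMap.exists_rightInverse_of_surjective
    (LinearMap.range_eq_top.2 hs)
  refine ⟨trHom (s ∘ₗ f.hom.toLinearMap ∘ₗ ψ), ?_⟩
  rw [trHom_comp, ← LinearMap.comp_assoc, hs, LinearMap.id_comp, ← trHom_comp, h, Category.id_comp]

theorem key_decomp {p : ℕ} {k X : Type} [Field k] [CharP k p] [Group X] [Fintype X]
    (Y : Subgroup X)
    (hY : ∀ g : X, g ∉ Y → ¬ p ∣ Nat.card ↥(Y ⊓ Y.map (MulAut.conj g).toMonoidHom)) :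
    ∃ (b : Rep.ofMulAction k X (X ⧸ Y) ⟶ 𝟙_ (Rep k X)) (a : 𝟙_ (Rep k X) ⟶ Rep.ofMulAction k X (X ⧸ Y))
      (φ : (Rep.ofMulAction k X (X ⧸ Y)).V →ₗ[k] (Rep.ofMulAction k X (X ⧸ Y)).V),
      b ≫ a = 𝟙 _ + trHom φ := by
  classical
  have : Fintype (X ⧸ Y) := Fintype.ofFinite _
  obtain ⟨f, hf⟩ := exists_transversal_fun (k := k) (X := X) (Z := (X ⧸ Y) × (X ⧸ Y))
    (fun z => z.1 ≠ z.2) (fun x z => by simp)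
    (fun z hz => by rw [Ne, CharP.cast_eq_zero_iff k p]; exact stab_card Y hY z hz)
  let T : MonoidAlgebra k (X ⧸ Y) ≃ₗ[k] ((X ⧸ Y) → k) :=
    (MonoidAlgebra.coeffLinearEquiv k) ≪≫ₗ Finsupp.linearEquivFunOnFinite k k (X ⧸ Y)
  have hT : ∀ v i, T v i = v.coeff i := fun v i => rfl
  have hTρ : ∀ (g : X) v i, T (Representation.ofMulAction k X (X ⧸ Y) g v) i = T v (g⁻¹ • i) :=
    fun g v i => by rw [hT, Representation.coeff_ofMulAction, hT]
  let F : Matrix (X ⧸ Y) (X ⧸ Y) k := fun a b => f (a, b)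
  let φ : MonoidAlgebra k (X ⧸ Y) →ₗ[k] MonoidAlgebra k (X ⧸ Y) :=
    T.symm.toLinearMap ∘ₗ F.mulVecLin ∘ₗ T.toLinearMap
  let b : Rep.ofMulAction k X (X ⧸ Y) ⟶ 𝟙_ (Rep k X) :=
    Rep.ofHom (ρ := Representation.ofMulAction k X (X ⧸ Y)) (σ := Representation.trivial k X k)
    ⟨(∑ i, LinearMap.proj i) ∘ₗ T.toLinearMap, by
      intro g
      refine LinearMap.ext fun v => ?_
      simp only [LinearMap.coe_comp, Function.comp_apply, LinearMap.sum_apply, LinearMap.proj_apply,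
        LinearEquiv.coe_coe, hTρ, Representation.trivial_apply]
      exact Fintype.sum_equiv (MulAction.toPerm g⁻¹) _ _ fun x => rfl⟩
  let a : 𝟙_ (Rep k X) ⟶ Rep.ofMulAction k X (X ⧸ Y) :=
    Rep.ofHom (σ := Representation.ofMulAction k X (X ⧸ Y)) (ρ := Representation.trivial k X k)
    ⟨T.symm.toLinearMap ∘ₗ LinearMap.pi (fun _ => LinearMap.id), by
      intro g
      refine LinearMap.ext fun v => ?_
      apply T.injective
      ext i
      change T (T.symm fun _ => v) i =
        T (Representation.ofMulAction k X (X ⧸ Y) g (T.symm fun _ => v)) i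
      rw [hTρ, LinearEquiv.apply_symm_apply]⟩
  refine ⟨b, a, φ, ?_⟩
  apply Rep.hom_ext
  apply Representation.IntertwiningMap.ext
  apply LinearMap.ext
  intro v
  apply T.injective
  ext i
  have h1 : T ((b ≫ a).hom v) i = ∑ j, T v j := by
    change T (T.symm (fun _ => ((∑ i, LinearMap.proj i) : _ →ₗ[k] k) (T v))) i = _
    rw [LinearEquiv.apply_symm_apply]
    simp
  have h2 : T ((trHom (A := Rep.ofMulAction k X (X ⧸ Y)) (B := Rep.ofMulAction k X (X ⧸ Y)) φ).hom v) i
      = ∑ j, (∑ x : X, f (x⁻¹ • (i, j))) * T v j := by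
    rw [trHom_apply, map_sum, Finset.sum_apply]
    simp only [Finset.sum_mul]
    rw [Finset.sum_comm]
    refine Finset.sum_congr rfl fun x _ => ?_
    rw [hTρ]
    change T (T.symm (F.mulVec (T _))) _ = _
    rw [LinearEquiv.apply_symm_apply]
    simp only [Matrix.mulVec, dotProduct, hTρ, inv_inv]
    exact Fintype.sum_equiv (MulAction.toPerm x) _ _ fun y => by simp [F]
  have h3 : T ((𝟙 (Rep.ofMulAction k X (X ⧸ Y)) + trHom φ).hom v) i = T v i + T ((trHom (A := Rep.ofMulAction k X (X ⧸ Y)) (B := Rep.ofMulAction k X (X ⧸ Y)) φ).hom v) i := by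
    rw [Rep.add_hom]
    change T (v + _) i = _
    rw [map_add, Pi.add_apply]
    rfl
  refine h1.trans (Eq.trans ?_ h3.symm)
  rw [h2, ← Finset.add_sum_erase _ _ (Finset.mem_univ i),
    ← Finset.add_sum_erase _ (fun j => (∑ x : X, f (x⁻¹ • (i, j))) * T v j) (Finset.mem_univ i)]
  rw [(hf (i, i)).2 (by simp), zero_mul, zero_add]
  congr 1
  refine Finset.sum_congr rfl fun j hj => ?_
  rw [(hf (i, j)).1 (Finset.ne_of_mem_erase hj).symm, one_mul]

theorem iso_unit_of_retract {k X : Type} [Field k] [Group X] {S : Rep k X}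
    (h : ∀ A B : Rep k X, Nonempty (S ≅ A ⊞ B) → IsZero A ∨ IsZero B)
    (a : 𝟙_ (Rep k X) ⟶ S) (b : S ⟶ 𝟙_ (Rep k X)) (hab : a ≫ b = 𝟙 _) :
    Nonempty (S ≅ 𝟙_ (Rep k X)) := by
  have : IsSplitMono a := IsSplitMono.mk' ⟨b, hab⟩
  have hb := isBilimitBinaryBiconeOfIsSplitMonoOfCokernel (f := a) (cokernelIsCokernel a)
  let e := biprod.uniqueUpToIso _ _ hb
  rcases h _ _ ⟨e⟩ with h0 | h0
  · rw [Rep.isZero_iff] at h0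
    exact absurd (show Subsingleton k from h0) (not_subsingleton k)
  · exact ⟨e ≪≫ (isoBiprodZero h0).symm⟩

theorem summand_aux {p : ℕ} {k : Type} [Field k] [CharP k p]
    {X : Type} [Group X] [Fintype X]
    (Y : Subgroup X)
    (hY : ∀ g : X, g ∉ Y → ¬ p ∣ Nat.card ↥(Y ⊓ Y.map (MulAut.conj g).toMonoidHom))
    (S : Rep k X) (i : S ⟶ Rep.ofMulAction k X (X ⧸ Y)) (q : Rep.ofMulAction k X (X ⧸ Y) ⟶ S)
    (hiq : i ≫ q = 𝟙 S)
    (h : ∀ A B : Rep k X, Nonempty (S ≅ A ⊞ B) → IsZero A ∨ IsZero B)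
    (hSnp : ¬ Projective S) :
    Nonempty (S ≅ 𝟙_ (Rep k X)) := by
  obtain ⟨b, a, φ, hφ⟩ := key_decomp (k := k) Y hY
  set bS := i ≫ b with hbS
  set aS := a ≫ q with haS
  set ψ : S.V →ₗ[k] S.V := q.hom.toLinearMap ∘ₗ φ ∘ₗ i.hom.toLinearMap with hψ
  have h1 : bS ≫ aS = 𝟙 S + trHom ψ := by
    have : i ≫ (b ≫ a) ≫ q = 𝟙 S + trHom ψ := by
      rw [hφ, Preadditive.add_comp, Preadditive.comp_add, Category.id_comp, hiq, trHom_comp,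
        comp_trHom, LinearMap.comp_assoc]
    simpa [hbS, haS] using this
  let c : k := (aS ≫ bS).hom (1 : k)
  have hc : aS ≫ bS = c • 𝟙 (𝟙_ (Rep k X)) := by
    apply Rep.hom_ext
    apply Representation.IntertwiningMap.ext
    apply LinearMap.ext
    intro (v : k)
    have : (aS ≫ bS).hom (v • (1 : k)) = v • (aS ≫ bS).hom (1 : k) :=
      map_smul (aS ≫ bS).hom.toLinearMap v (1 : k)
    rw [smul_eq_mul, mul_one] at this
    refine this.trans ?_
    change v * c = c * v
    rw [mul_comm]
  by_cases h0 : c = 0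
  · exfalso
    apply hSnp
    rw [h0, zero_smul] at hc
    have h2 : (bS ≫ aS) ≫ (bS ≫ aS) = 0 := by
      rw [Category.assoc, reassoc_of% hc]; simp
    apply projective_of_trHom ((-(𝟙 S + bS ≫ aS)).hom.toLinearMap ∘ₗ ψ)
    rw [← trHom_comp]
    have h3 : trHom ψ = bS ≫ aS - 𝟙 S := by rw [h1]; abel
    rw [h3]
    simp only [Preadditive.sub_comp, Preadditive.comp_neg, Preadditive.comp_add, Category.id_comp,
      Category.comp_id, h2]
    abel
  · refine iso_unit_of_retract h (c⁻¹ • aS) bS ?_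
    rw [Linear.smul_comp, hc, smul_smul, inv_mul_cancel₀ h0, one_smul]

/-- If `Y` is strongly `p`-embedded in `X`, then the only non-projective
indecomposable direct summand of the permutation module `Ind_Y^X(k)` on the cosets
of `Y` is the trivial module `k`. -/
theorem trivial_unique_nonprojective_summand_of_stronglyPEmbedded
    (p : ℕ) (hp : p.Prime) (k : Type) [Field k] [IsAlgClosed k] [CharP k p]
    (X : Type) [Group X] [Fintype X] (hpX : p ∣ Fintype.card X)
    (Y : Subgroup X) (hY : StronglyPEmbedded p Y)
    (S : Rep k X) (hS : IsDirectSummand S (Rep.ofMulAction k X (X ⧸ Y)))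
    (hSind : IsIndecomposable S) (hSnp : ¬ Projective S) :
    Nonempty (S ≅ 𝟙_ (Rep k X)) := by
  obtain ⟨N, ⟨e⟩⟩ := hS
  exact summand_aux Y hY.2 S (biprod.inl ≫ e.inv) (e.hom ≫ biprod.fst) (by simp) hSind.2 hSnp
end

section
/- If the only non-projective indecomposable direct summand of Ind_Y^X(k) is the trivial module k, where Y is a proper subgroup of X containing a Sylow p-subgroup of X, then Y ∩ Y^x is a p'-group for every x ∈ X \ Y; that is, Y is strongly p-embedded in X. -/
open CategoryTheory Limits MonoidalCategory

lemma aux_split {C : Type*} [Category C] [Abelian C] {M U : C} (e : M ⟶ U) (s : U ⟶ M)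
    (h : s ≫ e = 𝟙 U) : ∃ (Q : C) (i : Q ⟶ M) (r : M ⟶ Q), r ≫ i = 𝟙 M - e ≫ s ∧
      i ≫ e = 0 ∧ i ≫ r = 𝟙 Q ∧ Nonempty (M ≅ Q ⊞ U) := by
  let r : M ⟶ kernel e := kernel.lift e (𝟙 M - e ≫ s) (by simp [h])
  have hr : r ≫ kernel.ι e = 𝟙 M - e ≫ s := kernel.lift_ι _ _ _
  have hi : kernel.ι e ≫ r = 𝟙 _ := by
    rw [← cancel_mono (kernel.ι e)]
    simp [hr]
  refine ⟨kernel e, kernel.ι e, r, hr, kernel.condition e, hi, ⟨?_⟩⟩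
  exact (ShortComplex.Splitting.mk (S := ShortComplex.mk (kernel.ι e) e (kernel.condition e))
    r s hi h (by simp [hr])).isoBinaryBiproduct

lemma aux_sum {k : Type} [Field k] {G : Type} [Group G] [Fintype G] (H : Subgroup G)
    (hH : (Nat.card H : k) = 0) (f : G → k) (hf : ∀ g, ∀ h ∈ H, f (g * h) = f g) :
    ∑ g, f g = 0 := by
  classical
  have key : ∀ q : G ⧸ H, ∑ g with (QuotientGroup.mk g : G ⧸ H) = q, f g = 0 := by
    intro q
    induction q using QuotientGroup.induction_on with
    | H a =>
      have : ∑ g with (QuotientGroup.mk g : G ⧸ H) = QuotientGroup.mk a, f g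
          = ∑ h : H, f (a * h) := by
        symm
        refine Finset.sum_bij (fun h _ => a * (h : G)) ?_ ?_ ?_ ?_
        · intro h _
          simp
        · intro h _ h' _ hh
          exact Subtype.ext (mul_left_cancel hh)
        · intro b hb
          simp only [Finset.mem_filter, Finset.mem_univ, true_and] at hb
          exact ⟨⟨a⁻¹ * b, QuotientGroup.eq.1 hb.symm⟩, Finset.mem_univ _, by simp⟩
        · intro h _
          rfl
      rw [this, Finset.sum_congr rfl (fun (h : H) _ => hf a (h : G) h.2)]
      simp [← Nat.card_eq_fintype_card, hH]
  rw [← Finset.sum_fiberwise (s := Finset.univ) (g := fun g => (QuotientGroup.mk g : G ⧸ H))]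
  exact Finset.sum_eq_zero fun q _ => key q

/-- functions `G → V` with right translation -/
def auxRho {k : Type} [Field k] {G : Type} [Group G] (V : Type) [AddCommGroup V] [Module k V] :
    Representation k G (G → V) where
  toFun g := LinearMap.funLeft k V (fun h => h * g)
  map_one' := by
    ext f h
    simp [LinearMap.funLeft]
  map_mul' a b := by
    ext f h
    simp [LinearMap.funLeft, mul_assoc]

lemma aux_proj {k : Type} [Field k] {G : Type} [Group G] [Fintype G] (Q : Rep.{0} k G)
    [Projective Q] : ∃ θ : Q → Q, ∀ v : Q, v = ∑ h : G, Q.ρ h⁻¹ (θ (Q.ρ h v)) := by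
  classical
  let F : Rep.{0} k G := Rep.of (auxRho (k := k) (G := G) Q.V)
  let π : F ⟶ Q := Rep.ofHom (σ := Q.ρ) ⟨∑ h : G, (Q.ρ h⁻¹) ∘ₗ LinearMap.proj h, by
    intro g
    refine LinearMap.ext fun f => ?_
    change (∑ h : G, (Q.ρ h⁻¹) ∘ₗ LinearMap.proj h : (G → Q.V) →ₗ[k] Q.V) (fun h => f (h * g)) =
      Q.ρ g ((∑ h : G, (Q.ρ h⁻¹) ∘ₗ LinearMap.proj h : (G → Q.V) →ₗ[k] Q.V) f)
    simp only [LinearMap.sum_apply, LinearMap.comp_apply, LinearMap.proj_apply, map_sum]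
    refine Fintype.sum_equiv (Equiv.mulRight g) _ _ ?_
    intro h
    simp only [Equiv.coe_mulRight, mul_inv_rev]
    rw [← Module.End.mul_apply, ← map_mul]
    simp⟩
  have hπ : ∀ f : G → Q.V, π.hom f = ∑ h : G, Q.ρ h⁻¹ (f h) := by
    intro f
    change (∑ h : G, (Q.ρ h⁻¹) ∘ₗ LinearMap.proj h : (G → Q.V) →ₗ[k] Q.V) f = _
    simp
  have : Epi π := by
    rw [Rep.epi_iff_surjective]
    intro v
    refine ⟨(Pi.single 1 v : G → Q.V), ?_⟩
    rw [hπ, Finset.sum_eq_single 1]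
    · simp
    · intro b _ hb
      simp [hb]
    · simp
  let σ : Q ⟶ F := Projective.factorThru (𝟙 Q) π
  have hσ : σ ≫ π = 𝟙 Q := Projective.factorThru_comp _ _
  refine ⟨fun v => (σ.hom v : G → Q.V) 1, fun v => ?_⟩
  have h1 : π.hom (σ.hom v) = v := by
    rw [← Rep.comp_apply, hσ, Rep.id_apply]
  rw [hπ] at h1
  conv_lhs => rw [← h1]
  refine Finset.sum_congr rfl fun h _ => ?_
  have h2 : (σ.hom (Q.ρ h v) : G → Q.V) 1 = (σ.hom v : G → Q.V) (1 * h) :=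
    congrFun (Rep.hom_comm_apply σ h v) 1
  rw [one_mul] at h2
  exact congrArg _ h2.symm

lemma aux_proj2 {k : Type} [Field k] {G : Type} [Group G] [Fintype G] (Q : Rep.{0} k G)
    [Projective Q] (H : Subgroup G) (hH : (Nat.card H : k) = 0) (v : Q)
    (hv : ∀ h ∈ H, Q.ρ h v = v) (l : Q.V →ₗ[k] k) (hl : ∀ h ∈ H, ∀ w, l (Q.ρ h w) = l w) :
    l v = 0 := by
  obtain ⟨θ, hθ⟩ := aux_proj Q
  rw [hθ v, map_sum]
  refine aux_sum H hH _ ?_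
  intro g h hh
  rw [map_mul, Module.End.mul_apply, hv h hh, mul_inv_rev, map_mul, Module.End.mul_apply,
    hl _ (H.inv_mem hh)]

lemma aux_dim {k : Type} [Field k] {G : Type} [Group G] (S A B : Rep.{0} k G)
    [Module.Finite k S] (e : S ≅ A ⊞ B) :
    Module.Finite k A ∧ Module.Finite k B ∧
      Module.finrank k A + Module.finrank k B ≤ Module.finrank k S := by
  let f : A ⟶ S := biprod.inl ≫ e.inv
  let g : B ⟶ S := biprod.inr ≫ e.inv
  let f' : S ⟶ A := e.hom ≫ biprod.fst
  let g' : S ⟶ B := e.hom ≫ biprod.snd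
  have h1 : ∀ a, f'.hom (f.hom a) = a := fun a => by
    rw [← Rep.comp_apply, show f ≫ f' = 𝟙 _ by simp [f, f'], Rep.id_apply]
  have h2 : ∀ a, g'.hom (f.hom a) = 0 := fun a => by
    rw [← Rep.comp_apply, show f ≫ g' = 0 by simp [f, g']]; rfl
  have h3 : ∀ a, f'.hom (g.hom a) = 0 := fun a => by
    rw [← Rep.comp_apply, show g ≫ f' = 0 by simp [g, f']]; rfl
  have h4 : ∀ a, g'.hom (g.hom a) = a := fun a => by
    rw [← Rep.comp_apply, show g ≫ g' = 𝟙 _ by simp [g, g'], Rep.id_apply]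
  let L : (A.V × B.V) →ₗ[k] S.V := f.hom.toLinearMap.coprod g.hom.toLinearMap
  have hL : Function.Injective L := by
    rw [injective_iff_map_eq_zero]
    rintro ⟨a, b⟩ h
    have h0 : f.hom a + g.hom b = 0 := h
    have ha := congrArg f'.hom h0
    have hb := congrArg g'.hom h0
    rw [map_add, h1, h3, map_zero, add_zero] at ha
    rw [map_add, h2, h4, map_zero, zero_add] at hb
    simp [ha, hb]
  have fA : Module.Finite k A := Module.Finite.of_injective f.hom.toLinearMap
    (Function.LeftInverse.injective h1)
  have fB : Module.Finite k B := Module.Finite.of_injective g.hom.toLinearMap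
    (Function.LeftInverse.injective h4)
  refine ⟨fA, fB, ?_⟩
  rw [← Module.finrank_prod]
  exact LinearMap.finrank_le_finrank_of_injective hL

lemma aux_induct {k : Type} [Field k] {G : Type} [Group G] (M : Rep.{0} k G)
    (honly : ∀ S : Rep.{0} k G, IsDirectSummand S M →
      IsIndecomposable S → ¬ Projective S → Nonempty (S ≅ 𝟙_ (Rep.{0} k G))) (n : ℕ) :
    ∀ S : Rep.{0} k G, IsDirectSummand S M → Module.Finite k S → Module.finrank k S ≤ n →
      (∀ f : 𝟙_ (Rep.{0} k G) ⟶ S, f = 0) → Projective S := by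
  induction n with
  | zero =>
    intro S _ _ h _
    have : Subsingleton S.V := Module.finrank_zero_iff.1 (Nat.le_zero.1 h)
    exact ((Rep.isZero_iff (M := S) _ _).2 this).projective
  | succ n ih =>
    intro S hS hfin hn hinv
    by_cases hz : IsZero S
    · exact hz.projective
    by_contra hproj
    by_cases hind : IsIndecomposable S
    · obtain ⟨e⟩ := honly S hS hind hproj
      apply hz
      rw [IsZero.iff_id_eq_zero, ← e.hom_inv_id, hinv e.inv, comp_zero]
    · simp only [IsIndecomposable, not_and, not_forall, not_or] at hind
      obtain ⟨A, B, ⟨e⟩, hA, hB⟩ := hind hz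
      obtain ⟨fA, fB, hd⟩ := aux_dim S A B e
      have pos : ∀ A : Rep.{0} k G, Module.Finite k A → ¬ IsZero A → 0 < Module.finrank k A := by
        intro A _ h
        rw [Rep.isZero_iff, not_subsingleton_iff_nontrivial] at h
        exact Module.finrank_pos
      have pA := pos A fA hA
      have pB := pos B fB hB
      obtain ⟨N, ⟨e'⟩⟩ := hS
      have sA : IsDirectSummand A M :=
        ⟨B ⊞ N, ⟨e' ≪≫ biprod.mapIso e (Iso.refl N) ≪≫ biprod.associator A B N⟩⟩
      have sB : IsDirectSummand B M :=
        ⟨A ⊞ N, ⟨e' ≪≫ biprod.mapIso (e ≪≫ biprod.braiding A B) (Iso.refl N)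
          ≪≫ biprod.associator B A N⟩⟩
      have prA : Projective A := ih A sA fA (by omega) fun f => by
        have := hinv (f ≫ biprod.inl ≫ e.inv)
        simpa using congrArg (fun t => t ≫ e.hom ≫ biprod.fst) this
      have prB : Projective B := ih B sB fB (by omega) fun f => by
        have := hinv (f ≫ biprod.inr ≫ e.inv)
        simpa using congrArg (fun t => t ≫ e.hom ≫ biprod.snd) this
      exact hproj (Projective.of_iso e.symm inferInstance)

lemma aux_Q {k : Type} [Field k] {X : Type} [Group X] [Fintype X]
    (Y : Subgroup X) (hidx : (Y.index : k) ≠ 0)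
    (honly : ∀ S : Rep.{0} k X, IsDirectSummand S (Rep.ofMulAction k X (X ⧸ Y)) →
      IsIndecomposable S → ¬ Projective S → Nonempty (S ≅ 𝟙_ (Rep.{0} k X))) :
    ∃ (Q : Rep.{0} k X) (i : Q ⟶ Rep.ofMulAction k X (X ⧸ Y))
      (r : Rep.ofMulAction k X (X ⧸ Y) ⟶ Q) (e : Rep.ofMulAction k X (X ⧸ Y) ⟶ 𝟙_ (Rep.{0} k X)),
      Projective Q ∧ ∀ m, e.hom m = (0 : k) → i.hom (r.hom m) = m := by
  classical
  have : Fintype (X ⧸ Y) := Fintype.ofFinite _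
  let M : Rep.{0} k X := Rep.ofMulAction k X (X ⧸ Y)
  let cf : X ⧸ Y → (MonoidAlgebra k (X ⧸ Y) →ₗ[k] k) := fun x =>
    Finsupp.lapply x ∘ₗ (MonoidAlgebra.coeffLinearEquiv k).toLinearMap
  let E : MonoidAlgebra k (X ⧸ Y) →ₗ[k] k := ∑ x, cf x
  have hE : ∀ m, E m = ∑ x, m.coeff x := by
    intro m
    simp [E, cf]
  let e : M ⟶ 𝟙_ (Rep.{0} k X) := Rep.ofHom (σ := Representation.trivial k X k)
    ⟨E, by
      intro g
      refine LinearMap.ext fun m => ?_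
      change E (Representation.ofMulAction k X (X ⧸ Y) g m) = E m
      rw [hE, hE]
      refine Fintype.sum_equiv (MulAction.toPerm g⁻¹) _ _ (fun x => ?_)
      rw [Representation.coeff_ofMulAction]
      rfl⟩
  let s0 : MonoidAlgebra k (X ⧸ Y) := ∑ x, MonoidAlgebra.single x 1
  have hs0 : ∀ g : X, Representation.ofMulAction k X (X ⧸ Y) g s0 = s0 := by
    intro g
    simp only [s0, map_sum, Representation.ofMulAction_single]
    exact Fintype.sum_equiv (MulAction.toPerm g) _ _ (fun _ => rfl)
  have hs0' : ∀ x, s0.coeff x = 1 := by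
    intro x
    simp [s0, Finsupp.finsetSum_apply, Finsupp.single_apply]
  have hes0 : E s0 = (Y.index : k) := by
    simp [hE, hs0', Subgroup.index, Nat.card_eq_fintype_card]
  let s : 𝟙_ (Rep.{0} k X) ⟶ M := Rep.ofHom (ρ := Representation.trivial k X k)
    ⟨LinearMap.toSpanSingleton k _ ((Y.index : k)⁻¹ • s0), by
      intro g
      ext1
      simp [hs0]⟩
  have hse : s ≫ e = 𝟙 _ := by
    apply Rep.hom_ext
    apply Representation.IntertwiningMap.ext
    refine LinearMap.ext fun c => ?_
    change E ((c : k) • ((Y.index : k)⁻¹ • s0)) = c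
    rw [map_smul, map_smul, hes0, smul_eq_mul, smul_eq_mul, inv_mul_cancel₀ hidx, mul_one]
  obtain ⟨Q, i, r, hri, hie, hir, ⟨iso⟩⟩ := aux_split e s hse
  refine ⟨Q, i, r, e, ?_, ?_⟩
  · have fM : Module.Finite k M :=
      Module.Finite.equiv (MonoidAlgebra.coeffLinearEquiv k : MonoidAlgebra k (X ⧸ Y) ≃ₗ[k] _).symm
    refine aux_induct M honly (Module.finrank k Q) Q ⟨_, ⟨iso⟩⟩ (aux_dim M _ _ iso).1 le_rfl ?_
    intro f
    let m0 : MonoidAlgebra k (X ⧸ Y) := (f ≫ i).hom (1 : k)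
    have hf : ∀ g, Representation.ofMulAction k X (X ⧸ Y) g m0 = m0 := by
      intro g
      exact (Rep.hom_comm_apply (f ≫ i) g (1 : k)).symm
    have hc : ∀ x, m0.coeff x = m0.coeff (QuotientGroup.mk 1) := by
      intro x
      induction x using QuotientGroup.induction_on with
      | H a =>
        have := Representation.coeff_ofMulAction a m0 (QuotientGroup.mk a : X ⧸ Y)
        rw [hf a] at this
        rw [this]
        change m0.coeff (QuotientGroup.mk (a⁻¹ * a)) = _
        rw [inv_mul_cancel]
    have hEm : E m0 = 0 := by
      have h : (f ≫ i) ≫ e = 0 := by rw [Category.assoc, hie, comp_zero]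
      have h' : ((f ≫ i) ≫ e).hom (1 : k) = (0 : k) := by rw [h]; rfl
      exact h'
    have hm0 : m0 = 0 := by
      rw [hE, Finset.sum_congr rfl (fun x _ => hc x), Finset.sum_const, nsmul_eq_mul,
        Finset.card_univ, ← Nat.card_eq_fintype_card] at hEm
      have h0 := (mul_eq_zero.1 hEm).resolve_left hidx
      apply MonoidAlgebra.ext
      refine Finsupp.ext fun x => ?_
      rw [hc x, h0]
      rfl
    have hfi : f ≫ i = 0 := by
      apply Rep.hom_ext
      apply Representation.IntertwiningMap.ext
      refine LinearMap.ext fun c => ?_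
      have : (f ≫ i).hom ((c : k) • (1 : k)) = (c : k) • (f ≫ i).hom (1 : k) :=
        map_smul (f ≫ i).hom.toLinearMap (c : k) (1 : k)
      rw [smul_eq_mul, mul_one] at this
      refine this.trans ?_
      change (c : k) • m0 = 0
      rw [hm0, smul_zero]
    have := congrArg (fun t => t ≫ r) hfi
    simpa [hir] using this
  · intro m hm
    rw [← Rep.comp_apply, hri]
    change (m : MonoidAlgebra k (X ⧸ Y)) - s.hom (e.hom m) = m
    rw [hm, map_zero]
    exact sub_zero _

/-- If the only non-projective indecomposable direct summand of the permutation
module `Ind_Y^X(k)` is the trivial module, where `Y` is a proper subgroup containing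
a Sylow `p`-subgroup of `X`, then `Y` is strongly `p`-embedded in `X`. -/
theorem stronglyPEmbedded_of_trivial_unique_nonprojective_summand
    (p : ℕ) (hp : p.Prime) (k : Type) [Field k] [IsAlgClosed k] [CharP k p]
    (X : Type) [Group X] [Fintype X] (hpX : p ∣ Fintype.card X)
    (Y : Subgroup X) (hYprop : Y < ⊤) (P : Sylow p X) (hPY : (P : Subgroup X) ≤ Y)
    (honly : ∀ S : Rep k X, IsDirectSummand S (Rep.ofMulAction k X (X ⧸ Y)) →
      IsIndecomposable S → ¬ Projective S → Nonempty (S ≅ 𝟙_ (Rep k X))) :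
    StronglyPEmbedded p Y := by
  have : Fact p.Prime := ⟨hp⟩
  have hidx : (Y.index : k) ≠ 0 := by
    rw [Ne, CharP.cast_eq_zero_iff k p]
    intro h
    exact P.not_dvd_index (h.trans (Subgroup.index_dvd_of_le hPY))
  refine ⟨?_, ?_⟩
  · have h := Y.card_mul_index
    rw [← Nat.card_eq_fintype_card, ← h] at hpX
    refine (hp.dvd_mul.1 hpX).resolve_right ?_
    rwa [← CharP.cast_eq_zero_iff k p]
  intro g hg hdvd
  obtain ⟨Q, i, r, e, hQ, hir⟩ := aux_Q Y hidx honly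
  set H := Y ⊓ Y.map (MulAut.conj g).toMonoidHom with hHdef
  have hH : (Nat.card H : k) = 0 := (CharP.cast_eq_zero_iff k p _).2 hdvd
  let M : Rep.{0} k X := Rep.ofMulAction k X (X ⧸ Y)
  have hx1 : ∀ h ∈ H, h • (QuotientGroup.mk 1 : X ⧸ Y) = QuotientGroup.mk 1 := by
    intro h hh
    change (QuotientGroup.mk (h * 1) : X ⧸ Y) = _
    rw [QuotientGroup.eq]
    simpa using hh.1
  have hxg : ∀ h ∈ H, h • (QuotientGroup.mk g : X ⧸ Y) = QuotientGroup.mk g := by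
    intro h hh
    change (QuotientGroup.mk (h * g) : X ⧸ Y) = _
    obtain ⟨y, hy, rfl⟩ := hh.2
    rw [QuotientGroup.eq]
    simpa [mul_assoc] using hy
  have hne : (QuotientGroup.mk 1 : X ⧸ Y) ≠ QuotientGroup.mk g := by
    rw [Ne, QuotientGroup.eq]
    simpa using hg
  have key : ∀ m : MonoidAlgebra k (X ⧸ Y), (∀ h ∈ H, M.ρ h m = m) → e.hom m = (0 : k) →
      ∀ x : X ⧸ Y, (∀ h ∈ H, h • x = x) → m.coeff x = 0 := by
    intro m hm hem x hx
    have := aux_proj2 Q H hH (r.hom m)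
      (fun h hh => by rw [← Rep.hom_comm_apply]; exact congrArg r.hom (hm h hh))
      (Finsupp.lapply x ∘ₗ (MonoidAlgebra.coeffLinearEquiv k : MonoidAlgebra k (X ⧸ Y) ≃ₗ[k] _).toLinearMap ∘ₗ i.hom.toLinearMap) (by
        intro h hh w
        change (i.hom (Q.ρ h w) : MonoidAlgebra k (X ⧸ Y)).coeff x = (i.hom w : MonoidAlgebra k (X ⧸ Y)).coeff x
        rw [Rep.hom_comm_apply]
        change (Representation.ofMulAction k X (X ⧸ Y) h (i.hom w)).coeff x = _
        rw [Representation.coeff_ofMulAction, hx _ (H.inv_mem hh)])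
    change (i.hom (r.hom m) : MonoidAlgebra k (X ⧸ Y)).coeff x = 0 at this
    rwa [hir m hem] at this
  have hfix : ∀ x : X ⧸ Y, (∀ h ∈ H, h • x = x) → ∀ c : k, ∀ h ∈ H,
      M.ρ h (MonoidAlgebra.single x c) = MonoidAlgebra.single x c := by
    intro x hx c h hh
    change Representation.ofMulAction k X (X ⧸ Y) h (MonoidAlgebra.single x c) = _
    rw [Representation.ofMulAction_single, hx h hh]
  let x1 : X ⧸ Y := QuotientGroup.mk 1
  let xg : X ⧸ Y := QuotientGroup.mk g
  let E : (MonoidAlgebra k (X ⧸ Y)) →ₗ[k] k := e.hom.toLinearMap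
  let a : k := E (MonoidAlgebra.single x1 1)
  let b : k := E (MonoidAlgebra.single xg 1)
  have ea : ∀ c, E (MonoidAlgebra.single x1 c) = c * a := fun c => by
    rw [← mul_one c, ← smul_eq_mul, ← MonoidAlgebra.smul_single, map_smul]; simp [a]
  have eb : ∀ c, E (MonoidAlgebra.single xg c) = c * b := fun c => by
    rw [← mul_one c, ← smul_eq_mul, ← MonoidAlgebra.smul_single, map_smul]; simp [b]
  have ha : a = 0 := by
    have := key (MonoidAlgebra.single x1 b - MonoidAlgebra.single xg a)
      (fun h hh => by
        rw [map_sub]; exact congrArg₂ _ (hfix x1 hx1 b h hh) (hfix xg hxg a h hh))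
      (by
        change E (MonoidAlgebra.single x1 b - MonoidAlgebra.single xg a) = 0
        rw [map_sub, ea, eb]; ring) xg hxg
    simpa [x1, xg, Finsupp.single_apply, hne] using this
  have := key (MonoidAlgebra.single x1 1) (hfix x1 hx1 1) ha x1 hx1
  simp at this
end

section
/- Let G = ⟨x⟩N be finite p-nilpotent with Sylow p-subgroup ⟨x⟩ of order p and normal p-complement N, and let V be a simple endo-trivial kG-module. Then the Green correspondent W of V with respect to C_G(x) restricts to C_N(x) as a direct sum of pairwise isomorphic 1-dimensional modules. -/
open CategoryTheory Limits MonoidalCategory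

/-- Restriction of a representation to a subgroup. -/
noncomputable def resRep {k : Type} [Field k] {X : Type} [Group X] (Z : Subgroup X)
    (M : Rep k X) : Rep k Z :=
  Rep.of (M.ρ.comp Z.subtype)

theorem gc_sum_left {G : Type} [Group G] [Fintype G] (y : G) {M : Type} [AddCommMonoid M]
    (F : G → M) :
    ∑ g, F g = ∑ q : G ⧸ Subgroup.zpowers y,
      ∑ i ∈ Finset.range (orderOf y), F (q.out * y ^ i) := by
  classical
  let e : ((G ⧸ Subgroup.zpowers y) × Fin (orderOf y)) ≃ G := by
    refine Equiv.ofBijective (fun qi => qi.1.out * y ^ (qi.2 : ℕ)) ⟨?_, ?_⟩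
    · rintro ⟨q, i⟩ ⟨q', i'⟩ h
      simp only at h
      have hq : q = q' := by
        have := congrArg (QuotientGroup.mk (s := Subgroup.zpowers y)) h
        rw [QuotientGroup.mk_mul_of_mem _ (Subgroup.npow_mem_zpowers y _),
          QuotientGroup.mk_mul_of_mem _ (Subgroup.npow_mem_zpowers y _)] at this
        simpa using this
      subst hq
      have h2 := mul_left_cancel h
      have := pow_injOn_Iio_orderOf (Set.mem_Iio.2 i.2) (Set.mem_Iio.2 i'.2) h2
      simp [Fin.ext_iff, this]
    · intro g
      obtain ⟨h, hh⟩ := QuotientGroup.mk_out_eq_mul (Subgroup.zpowers y) g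
      obtain ⟨i, hi, hi'⟩ := (mem_zpowers_iff_mem_range_orderOf (x := y) (y := (h : G)⁻¹)).1
        (inv_mem h.2) |> fun H => by simpa using H
      refine ⟨⟨(g : G ⧸ Subgroup.zpowers y), ⟨i, hi⟩⟩, ?_⟩
      simp [hh, hi']
  rw [← Equiv.sum_comp e, Fintype.sum_prod_type]
  refine Finset.sum_congr rfl fun q _ => ?_
  rw [Finset.sum_range]
  rfl

/-- Averaging operator. -/
theorem gc_higman {k G : Type} [Field k] [Group G] [Fintype G] (P : Rep k G)
    (hP : Projective P) :
    ∃ θ : P.V →ₗ[k] P.V, ∀ v, ∑ g, P.ρ g (θ (P.ρ g⁻¹ v)) = v := by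
  let σ : Representation k G (G → P.V) :=
    { toFun := fun g => LinearMap.funLeft k P.V (fun h => g⁻¹ * h)
      map_one' := by ext; simp [LinearMap.funLeft]
      map_mul' := by intro a b; ext; simp [LinearMap.funLeft, mul_assoc] }
  have hσ : ∀ g f h, σ g f h = f (g⁻¹ * h) := fun _ _ _ => rfl
  let π : Rep.of σ ⟶ P := Rep.ofHom (σ := P.ρ)
    ⟨∑ h, (P.ρ h) ∘ₗ LinearMap.proj h, by
      intro g
      ext f
      simp only [LinearMap.comp_apply, LinearMap.sum_apply, LinearMap.proj_apply, hσ, map_sum]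
      rw [← Equiv.sum_comp (Equiv.mulLeft g)]
      simp⟩
  have hπ : ∀ f : G → P.V, π.hom f = ∑ h, P.ρ h (f h) := by
    intro f
    change (∑ h, (P.ρ h) ∘ₗ LinearMap.proj (R := k) (φ := fun _ : G => P.V) h) f = _
    simp
  have hepi : Epi π := by
    classical
    rw [Rep.epi_iff_surjective]
    intro v
    refine ⟨Pi.single 1 v, ?_⟩
    rw [hπ, Finset.sum_eq_single 1] <;> simp +contextual [Pi.single_apply]
  let s := Projective.factorThru (𝟙 P) π
  have hs : s ≫ π = 𝟙 P := Projective.factorThru_comp _ _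
  refine ⟨LinearMap.proj (R := k) (φ := fun _ : G => P.V) 1 ∘ₗ s.hom.toLinearMap, ?_⟩
  intro v
  have h1 : π.hom (s.hom v) = v := by
    rw [← Rep.comp_apply, hs]; rfl
  conv_rhs => rw [← h1]
  rw [hπ]
  refine Finset.sum_congr rfl fun g _ => ?_
  congr 1
  change s.hom (P.ρ g⁻¹ v) 1 = _
  rw [Rep.hom_comm_apply]
  change σ g⁻¹ _ 1 = _
  rw [hσ]; simp

theorem gc_proj_of_higman {k G : Type} [Field k] [Group G] [Fintype G] (P : Rep k G)
    (θ : P.V →ₗ[k] P.V) (hθ : ∀ v, ∑ g, P.ρ g (θ (P.ρ g⁻¹ v)) = v) : Projective P := by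
  constructor
  intro E X f e he
  rw [Rep.epi_iff_surjective] at he
  obtain ⟨l, hl⟩ := e.hom.toLinearMap.exists_rightInverse_of_surjective
    (LinearMap.range_eq_top.2 he)
  have hl' : ∀ u, e.hom (l u) = u := fun u => LinearMap.congr_fun hl u
  refine ⟨Rep.ofHom (ρ := P.ρ) (σ := E.ρ)
    ⟨∑ g, E.ρ g ∘ₗ l ∘ₗ f.hom.toLinearMap ∘ₗ θ ∘ₗ P.ρ g⁻¹, ?_⟩, ?_⟩
  · intro a
    ext v
    simp only [LinearMap.comp_apply, LinearMap.sum_apply, map_sum]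
    rw [← Equiv.sum_comp (Equiv.mulLeft a)]
    simp [map_mul]
  · ext v
    change e.hom ((∑ g, E.ρ g ∘ₗ l ∘ₗ f.hom.toLinearMap ∘ₗ θ ∘ₗ P.ρ g⁻¹) v) = f.hom v
    simp only [LinearMap.comp_apply, LinearMap.sum_apply, map_sum]
    conv_rhs => rw [← hθ v, map_sum]
    refine Finset.sum_congr rfl fun g _ => ?_
    rw [Rep.hom_comm_apply, Rep.hom_comm_apply, hl']
    rfl

theorem gc_idem {k G : Type} [Field k] [Group G] (S : Rep k G) (hS : IsIndecomposable S)
    (e : S ⟶ S) (he : e ≫ e = e) : e = 0 ∨ e = 𝟙 S := by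
  have he' : (𝟙 S - e) ≫ (𝟙 S - e) = 𝟙 S - e := by
    simp [Preadditive.sub_comp, Preadditive.comp_sub, he]
  obtain ⟨A, i, r, h1, h2⟩ := IsIdempotentComplete.idempotents_split S e he
  obtain ⟨B, i', r', h1', h2'⟩ := IsIdempotentComplete.idempotents_split S _ he'
  have e1 : i ≫ r' = 0 := by
    have : (i ≫ r) ≫ i ≫ (r' ≫ i') ≫ r' = 0 := by
      rw [h2']
      have := congrArg (fun t => i ≫ t ≫ (𝟙 S - e) ≫ r') h2
      simp [Preadditive.sub_comp, Preadditive.comp_sub, he, reassoc_of% he] at this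
      simp [Preadditive.sub_comp, Preadditive.comp_sub, reassoc_of% h1, ← h2, h1]
    simpa [h1, h1', reassoc_of% h1] using this
  have e2 : i' ≫ r = 0 := by
    have : i' ≫ (r' ≫ i') ≫ (r ≫ i) ≫ r = 0 := by
      rw [h2', h2]
      simp [Preadditive.sub_comp, Preadditive.comp_sub, reassoc_of% he]
    simpa [h1, h1', reassoc_of% h1'] using this
  have iso : S ≅ A ⊞ B :=
    { hom := biprod.lift r r'
      inv := biprod.desc i i'
      hom_inv_id := by simp [biprod.lift_desc, h2, h2']
      inv_hom_id := by
        apply biprod.hom_ext' <;> apply biprod.hom_ext <;> simp [h1, h1', e1, e2] }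
  rcases hS.2 A B ⟨iso⟩ with h | h
  · left; rw [← h2, h.eq_of_tgt r 0]; simp
  · right
    rw [h.eq_of_tgt r' 0] at h2'
    simp at h2'
    exact (sub_eq_zero.1 h2'.symm).symm

/-- Action by scalars on a summand. -/
theorem gc_summand_maps {k G : Type} [Field k] [Group G] {S M : Rep k G}
    (h : IsDirectSummand S M) : ∃ (i : S ⟶ M) (r : M ⟶ S), i ≫ r = 𝟙 S := by
  obtain ⟨N, ⟨e⟩⟩ := h
  exact ⟨biprod.inl ≫ e.inv, e.hom ≫ biprod.fst, by simp⟩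

theorem gc_scalar_dim {k G : Type} [Field k] [Group G] (S : Rep k G) (hS : IsIndecomposable S)
    (χ : G → k) (hχ : ∀ g v, S.ρ g v = χ g • v) : Module.finrank k S.V = 1 := by
  have hnt : Nontrivial S.V := by
    rw [← not_subsingleton_iff_nontrivial, ← Rep.isZero_iff]; exact hS.1
  obtain ⟨v, hv⟩ := exists_ne (0 : S.V)
  obtain ⟨f, hf⟩ := Module.Projective.exists_dual_ne_zero k hv
  let e : S ⟶ S := Rep.ofHom (ρ := S.ρ) (σ := S.ρ)
    ⟨LinearMap.toSpanSingleton k S.V ((f v)⁻¹ • v) ∘ₗ f, by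
      intro g; ext w; simp [hχ, mul_smul]⟩
  have he : ∀ w, e.hom w = f w • (f v)⁻¹ • v := fun w => rfl
  have hid : e ≫ e = e := by
    ext w
    change e.hom (e.hom w) = e.hom w
    simp [he, hf]
  have hev : e.hom v = v := by rw [he, smul_smul, mul_inv_cancel₀ hf, one_smul]
  rcases gc_idem S hS e hid with h | h
  · rw [h] at hev
    exact absurd hev.symm hv
  · refine finrank_eq_one v hv fun w => ⟨f w * (f v)⁻¹, ?_⟩
    have : e.hom w = w := by rw [h]; rfl
    rw [mul_smul, ← he, this]

/-- The trace map from the trivial group to `⟨y⟩` on endomorphisms. -/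
noncomputable def gcTr {k G : Type} [Field k] [Group G] {M : Type} [AddCommGroup M] [Module k M]
    (ρ : Representation k G M) (y : G) : Module.End k M →ₗ[k] Module.End k M :=
  ∑ i ∈ Finset.range (orderOf y),
    LinearMap.mulLeft k (ρ (y ^ i)) ∘ₗ LinearMap.mulRight k (ρ ((y ^ i)⁻¹))

theorem gcTr_apply {k G : Type} [Field k] [Group G] {M : Type} [AddCommGroup M] [Module k M]
    (ρ : Representation k G M) (y : G) (g : Module.End k M) :
    gcTr ρ y g = ∑ i ∈ Finset.range (orderOf y), ρ (y ^ i) * (g * ρ ((y ^ i)⁻¹)) := by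
  simp [gcTr]

/-- A projective module: invariants under `y` are traces. -/
theorem gc_inv_trace {k G : Type} [Field k] [Group G] [Fintype G] (P : Rep.{0} k G)
    (hP : Projective P) (y : G) (b : P.V) (hb : P.ρ y b = b) :
    ∃ w, b = ∑ i ∈ Finset.range (orderOf y), P.ρ (y ^ i) w := by
  obtain ⟨θ, hθ⟩ := gc_higman P hP
  have hpow : ∀ i : ℕ, P.ρ (y ^ i) b = b := by
    intro i
    induction i with
    | zero => simp
    | succ n ih => rw [pow_succ, map_mul, Module.End.mul_apply, hb, ih]
  have hpow' : ∀ i : ℕ, P.ρ (y ^ i)⁻¹ b = b := by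
    intro i
    conv_lhs => rw [← hpow i]
    rw [← Module.End.mul_apply, ← map_mul]; simp
  refine ⟨∑ q : G ⧸ Subgroup.zpowers y⁻¹, P.ρ (q.out)⁻¹ (θ (P.ρ q.out b)), ?_⟩
  conv_lhs => rw [← hθ b, ← Equiv.sum_comp (Equiv.inv G), gc_sum_left y⁻¹]
  simp only [map_sum]
  rw [Finset.sum_comm, orderOf_inv]
  refine Finset.sum_congr rfl fun i _ => Finset.sum_congr rfl fun q _ => ?_
  simp [map_mul, hpow']

theorem gc_lemA {k G : Type} [Field k] [Group G] [Finite G] (V : Rep k G)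
    [FiniteDimensional k V.V] (hV : IsEndoTrivial V) (y : G) :
    ∃ f0 : Module.End k V.V, ∀ f : Module.End k V.V, V.ρ y * f = f * V.ρ y →
      ∃ (a : k) (g : Module.End k V.V), f = a • f0 + gcTr V.ρ y g := by
  classical
  have := Fintype.ofFinite G
  obtain ⟨P, hP, ⟨φ⟩⟩ := hV
  let Φ : TensorProduct k V.V (Module.Dual k V.V) ≃ₗ[k] Module.End k V.V :=
    (TensorProduct.comm k _ _).trans (dualTensorHomEquiv k V.V V.V)
  have hΦ : ∀ (g : G) (t : TensorProduct k V.V (Module.Dual k V.V)),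
      Φ ((V.ρ.tprod V.ρ.dual) g t) = V.ρ g * (Φ t * V.ρ g⁻¹) := by
    intro g t
    induction t with
    | zero => simp
    | add a b ha hb => simp only [map_add, ha, hb, add_mul, mul_add]
    | tmul v f =>
      ext w
      simp [Φ, Representation.tprod_apply, Representation.dual_apply, Module.Dual.transpose_apply]
  let T : Rep k G := V ⊗ Rep.of V.ρ.dual
  let ia : 𝟙_ (Rep k G) ⟶ T := biprod.inl ≫ φ.inv
  let ib : P ⟶ T := biprod.inr ≫ φ.inv
  let ra : T ⟶ 𝟙_ (Rep k G) := φ.hom ≫ biprod.fst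
  let rb : T ⟶ P := φ.hom ≫ biprod.snd
  have hsum : ra ≫ ia + rb ≫ ib = 𝟙 T := by
    have : φ.hom ≫ (biprod.fst ≫ biprod.inl + biprod.snd ≫ biprod.inr) ≫ φ.inv = 𝟙 _ := by
      rw [biprod.total]; simp
    rw [Preadditive.add_comp, Preadditive.comp_add] at this
    simpa only [ia, ib, ra, rb, Category.assoc] using this
  have hsum' : ∀ t : T.V, ia.hom (ra.hom t) + ib.hom (rb.hom t) = t := by
    intro t
    have := congrArg (fun u : T ⟶ T => u.hom t) hsum
    exact this
  refine ⟨Φ (ia.hom (1 : k)), fun f hf => ?_⟩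
  obtain ⟨t, rfl⟩ := Φ.surjective f
  have ht : T.ρ y t = t := by
    apply Φ.injective
    refine (hΦ y t).trans ?_
    rw [← mul_assoc, hf, mul_assoc, ← map_mul]; simp
  obtain ⟨w, hw⟩ := gc_inv_trace P hP y (rb.hom t) (by rw [← Rep.hom_comm_apply, ht])
  refine ⟨ra.hom t, Φ (ib.hom w), ?_⟩
  rw [gcTr_apply]
  have h1 : ia.hom (ra.hom t) = (show k from ra.hom t) • ia.hom (1 : k) := by
    rw [← map_smul]
    congr 1
    exact (mul_one _).symm
  have h2 : ib.hom (rb.hom t) = ∑ i ∈ Finset.range (orderOf y), T.ρ (y ^ i) (ib.hom w) := by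
    rw [hw, map_sum]
    exact Finset.sum_congr rfl fun i _ => Rep.hom_comm_apply _ _ _
  conv_lhs => rw [← hsum' t, h1, h2]
  refine (map_add Φ _ _).trans ?_
  congr 1
  · exact map_smul Φ _ _
  · refine (map_sum Φ _ _).trans ?_
    exact Finset.sum_congr rfl fun i _ => hΦ _ _

theorem gc_lemB {k G : Type} [Field k] [Group G] (V : Rep k G) (H : Subgroup G) (y : H)
    (hV : ∃ f0 : Module.End k V.V, ∀ f : Module.End k V.V, V.ρ y * f = f * V.ρ y →
      ∃ (a : k) (g : Module.End k V.V), f = a • f0 + gcTr V.ρ (y : G) g)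
    (W : Rep k H) (hW : IsDirectSummand W (resRep H V)) :
    ∃ f0 : Module.End k W.V, ∀ f : Module.End k W.V, W.ρ y * f = f * W.ρ y →
      ∃ (a : k) (g : Module.End k W.V), f = a • f0 + gcTr W.ρ y g := by
  obtain ⟨i, r, hir⟩ := gc_summand_maps hW
  let i' : W.V →ₗ[k] V.V := i.hom.toLinearMap
  let r' : V.V →ₗ[k] W.V := r.hom.toLinearMap
  have hi : ∀ (h : H) w, i' (W.ρ h w) = V.ρ (h : G) (i' w) := fun h w => Rep.hom_comm_apply i h w
  have hr : ∀ (h : H) w, r' (V.ρ (h : G) w) = W.ρ h (r' w) := fun h w => Rep.hom_comm_apply r h w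
  have hri : ∀ w, r' (i' w) = w := fun w => congrArg (fun u : W ⟶ W => u.hom w) hir
  obtain ⟨f0, h0⟩ := hV
  refine ⟨r' ∘ₗ f0 ∘ₗ i', fun f hf => ?_⟩
  obtain ⟨a, g, hag⟩ := h0 (i' ∘ₗ f ∘ₗ r') (by
    ext v
    simp only [Module.End.mul_apply, LinearMap.comp_apply]
    rw [← hi, hr]
    congr 1
    exact LinearMap.congr_fun hf _)
  refine ⟨a, r' ∘ₗ g ∘ₗ i', ?_⟩
  ext w
  have h3 : f w = r' ((i' ∘ₗ f ∘ₗ r') (i' w)) := by simp [hri]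
  rw [h3, hag]
  simp only [LinearMap.add_apply, map_add, LinearMap.smul_apply, map_smul, gcTr_apply,
    LinearMap.sum_apply, map_sum, LinearMap.comp_apply, Module.End.mul_apply, hi]
  congr 1
  rw [Subgroup.orderOf_coe]
  refine Finset.sum_congr rfl fun j _ => ?_
  rw [← hr]
  simp

theorem gc_lemC {k H : Type} [Field k] [Group H] [Finite H] (W : Rep k H) (y : H)
    (hy : ∀ h, h * y = y * h)
    (hyp : ∃ f0 : Module.End k W.V, ∀ f : Module.End k W.V, W.ρ y * f = f * W.ρ y →
      ∃ (a : k) (g : Module.End k W.V), f = a • f0 + gcTr W.ρ y g)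
    (hind : IsIndecomposable W) (hnp : ¬ Projective W)
    (hidx : (((Subgroup.zpowers y).index : ℕ) : k) ≠ 0)
    (C : Subgroup H) [C.Normal] (hC : ((Nat.card C : ℕ) : k) ≠ 0) :
    ∃ χ : H → k, ∀ c ∈ C, ∀ w, W.ρ c w = χ c • w := by
  classical
  have := Fintype.ofFinite H
  let I : Submodule k (Module.End k W.V) := LinearMap.range (gcTr W.ρ y)
  have hone : (1 : Module.End k W.V) ∉ I := by
    rintro ⟨θ, hθ⟩
    apply hnp
    refine gc_proj_of_higman W (((Subgroup.zpowers y).index : k)⁻¹ • θ) fun v => ?_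
    rw [gc_sum_left y]
    have key : ∀ q : H, ∑ i ∈ Finset.range (orderOf y),
        W.ρ (q * y ^ i) ((((Subgroup.zpowers y).index : k)⁻¹ • θ) (W.ρ (q * y ^ i)⁻¹ v))
        = ((Subgroup.zpowers y).index : k)⁻¹ • v := by
      intro q
      have h4 := LinearMap.congr_fun hθ (W.ρ q⁻¹ v)
      rw [gcTr_apply] at h4
      have h5 := congrArg (fun u => ((Subgroup.zpowers y).index : k)⁻¹ • W.ρ q u) h4
      simp only [LinearMap.sum_apply, map_sum, Finset.smul_sum, Module.End.mul_apply,
        Module.End.one_apply] at h5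
      have h6 : W.ρ q (W.ρ q⁻¹ v) = v := by simp
      rw [h6] at h5
      rw [← h5]
      refine Finset.sum_congr rfl fun i _ => ?_
      simp [mul_inv_rev, map_mul]
    simp only [key, Finset.sum_const, Finset.card_univ]
    rw [← Nat.card_eq_fintype_card, ← Subgroup.index, ← Nat.cast_smul_eq_nsmul k, smul_smul,
      mul_inv_cancel₀ hidx, one_smul]
  have hcomm : ∀ h, W.ρ y * W.ρ h = W.ρ h * W.ρ y := by
    intro h; rw [← map_mul, ← map_mul, hy]
  have hcomm2 : ∀ (h : H) (i : ℕ), W.ρ h * W.ρ (y ^ i) = W.ρ (y ^ i) * W.ρ h := by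
    intro h i
    have hc : Commute h (y ^ i) := Commute.pow_right (hy h) i
    rw [← map_mul, ← map_mul, hc.eq]
  have hmul : ∀ (h : H), ∀ f ∈ I, W.ρ h * f ∈ I := by
    rintro h _ ⟨g, rfl⟩
    refine ⟨W.ρ h * g, ?_⟩
    rw [gcTr_apply, gcTr_apply, Finset.mul_sum]
    refine Finset.sum_congr rfl fun i _ => ?_
    rw [← mul_assoc (W.ρ h) (W.ρ _), hcomm2, mul_assoc, mul_assoc]
  obtain ⟨f0, h0⟩ := hyp
  obtain ⟨a0, g0, hag⟩ := h0 1 (by simp)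
  have ha0 : a0 ≠ 0 := by
    rintro rfl
    exact hone ⟨g0, by rw [hag]; simp⟩
  have hf0 : ∃ g1, f0 = a0⁻¹ • (1 : Module.End k W.V) + gcTr W.ρ y g1 := by
    refine ⟨-(a0⁻¹ • g0), ?_⟩
    conv_rhs => rw [hag]
    simp [smul_smul, ha0]
  obtain ⟨g1, hg1⟩ := hf0
  have hχ : ∀ h, ∃ a : k, W.ρ h - a • (1 : Module.End k W.V) ∈ I := by
    intro h
    obtain ⟨a, g, e⟩ := h0 (W.ρ h) (hcomm h)
    refine ⟨a * a0⁻¹, a • g1 + g, ?_⟩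
    rw [e, hg1, map_add, map_smul, smul_add, smul_smul]
    abel
  choose χ hχ using hχ
  have huniq : ∀ a b : k, a • (1 : Module.End k W.V) - b • (1 : Module.End k W.V) ∈ I → a = b := by
    intro a b h
    by_contra hab
    rw [← sub_smul] at h
    exact hone ((I.smul_mem_iff (sub_ne_zero.2 hab)).1 h)
  have huniq2 : ∀ h (b : k), W.ρ h - b • (1 : Module.End k W.V) ∈ I → χ h = b := by
    intro h b hb
    apply huniq
    have := I.sub_mem hb (hχ h)
    simpa using this
  have hχ1 : χ 1 = 1 := huniq2 _ _ (by simp)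
  have hχm : ∀ a b, χ (a * b) = χ a * χ b := by
    intro a b
    apply huniq2
    have := I.add_mem (hmul a _ (hχ b)) (I.smul_mem (χ b) (hχ a))
    convert this using 1
    rw [map_mul, mul_sub, smul_sub, smul_smul, mul_smul_comm, mul_one, mul_comm (χ a)]
    abel
  have hχi : ∀ a, χ a⁻¹ * χ a = 1 := by
    intro a; rw [← hχm]; simp [hχ1]
  let n : k := ((Nat.card C : ℕ) : k)
  have hn : n ≠ 0 := hC
  have hcard : ∀ u : Module.End k W.V, ∑ _c : C, u = n • u := by
    intro u
    rw [Finset.sum_const, Finset.card_univ, ← Nat.card_eq_fintype_card, Nat.cast_smul_eq_nsmul]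
  let e : Module.End k W.V := n⁻¹ • ∑ c : C, χ (c : H)⁻¹ • W.ρ (c : H)
  have he1 : e - 1 ∈ I := by
    have h7 : e - 1 = n⁻¹ • ∑ c : C, χ (c : H)⁻¹ • (W.ρ (c : H) - χ (c : H) • 1) := by
      simp only [smul_sub, Finset.sum_sub_distrib, smul_smul, hχi, hcard]
      simp [e, hn]
    rw [h7]
    exact I.smul_mem _ (I.sum_mem fun c _ => I.smul_mem _ (hχ _))
  have hec : ∀ c0 : C, e * W.ρ (c0 : H) = χ (c0 : H) • e := by
    intro c0
    simp only [e]
    rw [smul_mul_assoc, Finset.sum_mul, smul_comm]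
    congr 1
    rw [Finset.smul_sum, ← Equiv.sum_comp (Equiv.mulRight c0⁻¹)]
    refine Finset.sum_congr rfl fun c _ => ?_
    rw [smul_mul_assoc, ← map_mul, smul_smul, ← hχm]
    simp
  have hee : e * e = e := by
    conv_lhs => rhs; simp only [e]
    rw [mul_smul_comm, Finset.mul_sum]
    simp only [mul_smul_comm, hec, smul_smul, hχi, one_smul, hcard]
    rw [inv_mul_cancel₀ hn, one_smul]
  have heH : ∀ h : H, e * W.ρ h = W.ρ h * e := by
    intro h
    simp only [e]
    rw [smul_mul_assoc, mul_smul_comm, Finset.sum_mul, Finset.mul_sum]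
    congr 1
    rw [← Equiv.sum_comp (MulAut.conjNormal h : C ≃* C).toEquiv]
    refine Finset.sum_congr rfl fun c _ => ?_
    rw [smul_mul_assoc, mul_smul_comm, ← map_mul, ← map_mul]
    have h8 : ((MulAut.conjNormal h : C ≃* C).toEquiv c : H) = h * c * h⁻¹ :=
      MulAut.conjNormal_apply h c
    rw [h8]
    have h9 : χ (h * c * h⁻¹)⁻¹ = χ (c : H)⁻¹ := by
      simp only [mul_inv_rev, inv_inv, hχm]
      rw [mul_left_comm, mul_comm (χ h), hχi, mul_one]
    rw [h9]
    congr 2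
    group
  let E : W ⟶ W := Rep.ofHom (ρ := W.ρ) (σ := W.ρ) ⟨e, fun h => heH h⟩
  have hE : E ≫ E = E := by
    ext w
    exact LinearMap.congr_fun hee w
  refine ⟨χ, fun c hc w => ?_⟩
  rcases gc_idem W hind E hE with h | h
  · exfalso
    have h10 : e = 0 := by
      ext w; exact congrArg (fun u : W ⟶ W => u.hom w) h
    rw [h10, zero_sub] at he1
    exact hone (I.neg_mem_iff.1 he1)
  · have h10 : e = 1 := by
      ext w; exact congrArg (fun u : W ⟶ W => u.hom w) h
    have := LinearMap.congr_fun (hec ⟨c, hc⟩) w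
    rw [h10] at this
    simpa using this

/-- Let `G = ⟨x⟩N` be `p`-nilpotent with Sylow `p`-subgroup `⟨x⟩` of order `p` and
normal `p`-complement `N`, and let `V` be a simple endo-trivial `kG`-module. Then
the Green correspondent `W` of `V` for `C_G(x)` (the unique non-projective
indecomposable direct summand of the restriction of `V` to `C_G(x)`) restricts to
`C_N(x)` as a direct sum of pairwise isomorphic `1`-dimensional modules. -/
theorem green_correspondent_restriction_one_dimensional
    (p : ℕ) (hp : p.Prime) (k : Type) [Field k] [IsAlgClosed k] [CharP k p]
    (G : Type) [Group G] [Finite G]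
    (N : Subgroup G) (hNnorm : N.Normal) (hNp' : ¬ p ∣ Nat.card N)
    (x : G) (hx : orderOf x = p) (hG : Subgroup.zpowers x ⊔ N = ⊤)
    (V : Rep k G) [FiniteDimensional k V.V] (hVsimple : Simple V)
    (hV : IsEndoTrivial V)
    (W : Rep k ↥(Subgroup.centralizer {x}))
    (hW : IsDirectSummand W (resRep (Subgroup.centralizer {x}) V))
    (hWind : IsIndecomposable W) (hWnp : ¬ Projective W) :
    ∀ S : Rep k ↥((N ⊓ Subgroup.centralizer {x}).subgroupOf (Subgroup.centralizer {x})),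
      IsDirectSummand S (resRep ((N ⊓ Subgroup.centralizer {x}).subgroupOf
        (Subgroup.centralizer {x})) W) → IsIndecomposable S →
      Module.finrank k S.V = 1 ∧
        ∀ S' : Rep k ↥((N ⊓ Subgroup.centralizer {x}).subgroupOf
            (Subgroup.centralizer {x})),
          IsDirectSummand S' (resRep ((N ⊓ Subgroup.centralizer {x}).subgroupOf
            (Subgroup.centralizer {x})) W) → IsIndecomposable S' →
          Nonempty (S ≅ S') := by
  have : Fact p.Prime := ⟨hp⟩
  revert W
  generalize hH : Subgroup.centralizer {x} = H
  intro W hW hWind hWnp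
  have hxH : x ∈ H := by rw [← hH, Subgroup.mem_centralizer_singleton_iff]
  let y : H := ⟨x, hxH⟩
  have hy : ∀ h : H, h * y = y * h := by
    intro h
    ext
    have h1 : (h : G) ∈ Subgroup.centralizer {x} := hH.symm ▸ h.2
    exact (Subgroup.mem_centralizer_singleton_iff.1 h1)
  have hB := gc_lemB V H y (gc_lemA V hV x) W hW
  have hxN : ¬ p ∣ (Subgroup.zpowers x).index := by
    intro h
    apply hNp'
    refine h.trans ?_
    have h1 : N.index ∣ p := by
      have h2 := Subgroup.relIndex_sup_right (Subgroup.zpowers x) N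
      rw [hG, Subgroup.relIndex_top_right] at h2
      rw [h2, ← hx, ← Nat.card_zpowers]
      exact Subgroup.relIndex_dvd_card _ _
    have h3 := N.card_mul_index
    have h4 := (Subgroup.zpowers x).card_mul_index
    rw [Nat.card_zpowers, hx, ← h3] at h4
    apply Nat.dvd_of_mul_dvd_mul_left hp.pos
    rw [h4, mul_comm]
    exact Nat.mul_dvd_mul_right h1 _
  have hidx : (((Subgroup.zpowers y).index : ℕ) : k) ≠ 0 := by
    rw [Ne, CharP.cast_eq_zero_iff k p]
    intro h
    apply hxN
    have h1 : Subgroup.zpowers y = (Subgroup.zpowers x).subgroupOf H := by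
      ext h
      simp only [Subgroup.mem_subgroupOf, Subgroup.mem_zpowers_iff, Subtype.ext_iff, y,
        Subgroup.coe_zpow]
    rw [h1] at h
    refine h.trans ?_
    exact Subgroup.relIndex_dvd_index_of_le (Subgroup.zpowers_le.2 hxH)
  have hC : ((Nat.card ↥((N ⊓ H).subgroupOf H) : ℕ) : k) ≠ 0 := by
    rw [Ne, CharP.cast_eq_zero_iff k p]
    intro h
    apply hNp'
    rw [Nat.card_congr (Subgroup.subgroupOfEquivOfLe (inf_le_right : N ⊓ H ≤ H)).toEquiv] at h
    exact h.trans (Subgroup.card_dvd_of_le inf_le_left)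
  have hnorm : ((N ⊓ H).subgroupOf H).Normal := by
    rw [Subgroup.inf_subgroupOf_right]
    infer_instance
  obtain ⟨χ, hχ⟩ := gc_lemC W y hy hB hWind hWnp hidx ((N ⊓ H).subgroupOf H) hC
  have hsc : ∀ S : Rep k ↥((N ⊓ H).subgroupOf H),
      IsDirectSummand S (resRep ((N ⊓ H).subgroupOf H) W) →
      ∀ c v, S.ρ c v = χ (c : H) • v := by
    intro S hS c v
    obtain ⟨i, r, hir⟩ := gc_summand_maps hS
    have h1 : ∀ w, r.hom (i.hom w) = w := fun w => congrArg (fun u : S ⟶ S => u.hom w) hir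
    have h2 : (resRep ((N ⊓ H).subgroupOf H) W).ρ c (i.hom v) = χ (c : H) • i.hom v :=
      hχ c c.2 (i.hom v)
    rw [← h1 (S.ρ c v), Rep.hom_comm_apply, h2, map_smul, h1]
  intro S hS hSi
  have hd := gc_scalar_dim S hSi _ (hsc S hS)
  refine ⟨hd, fun S' hS' hSi' => ?_⟩
  have hd' := gc_scalar_dim S' hSi' _ (hsc S' hS')
  have := Module.finite_of_finrank_eq_succ hd
  have := Module.finite_of_finrank_eq_succ hd'
  let l : S.V ≃ₗ[k] S'.V := LinearEquiv.ofFinrankEq _ _ (hd.trans hd'.symm)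
  refine ⟨{ hom := Rep.ofHom (ρ := S.ρ) (σ := S'.ρ) ⟨l.toLinearMap, ?_⟩
            inv := Rep.ofHom (ρ := S'.ρ) (σ := S.ρ) ⟨l.symm.toLinearMap, ?_⟩
            hom_inv_id := ?_
            inv_hom_id := ?_ }⟩
  · intro c; ext v; simp [hsc S hS, hsc S' hS']
  · intro c; ext v; simp [hsc S hS, hsc S' hS']
  · ext v; exact l.symm_apply_apply v
  · ext v; exact l.apply_symm_apply v
end

section
/- Let G be a perfect finite group with G = E(G) and Z = Z(G) a cyclic p'-group, G normal in H with Z ≤ Z(H), all components of G conjugate in H, and x ∈ H of order p permuting the components of G semi-regularly by conjugation. Then C_G(x) is isomorphic to a central product of components of G, one from each ⟨x⟩-orbit; in particular C_G(x) is perfect. -/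
/-- `K` is subnormal in the subgroup `G` of the ambient group. -/
def SubnormalIn {H : Type} [Group H] (K G : Subgroup H) : Prop :=
  ∃ (n : ℕ) (s : ℕ → Subgroup H), s 0 = K ∧ s n = G ∧
    ∀ i < n, s i ≤ s (i + 1) ∧ ((s i).subgroupOf (s (i + 1))).Normal

/-- `K` is quasi-simple: perfect and simple modulo its center. -/
def IsQuasiSimple {H : Type} [Group H] (K : Subgroup H) : Prop :=
  commutator ↥K = ⊤ ∧ IsSimpleGroup (↥K ⧸ Subgroup.center ↥K)

/-- `K` is a component of the subgroup `G`: a subnormal quasi-simple subgroup of `G`. -/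
def IsComponentOf {H : Type} [Group H] (G K : Subgroup H) : Prop :=
  SubnormalIn K G ∧ IsQuasiSimple K


section Core
variable {H : Type} [Group H]

/-- conjugate of `M` by `x^j` -/
def cjg (x : H) (j : ℕ) (M : Subgroup H) : Subgroup H := M.map (MulAut.conj (x ^ j)).toMonoidHom

lemma mem_cjg {x : H} {j : ℕ} {M : Subgroup H} {g : H} :
    g ∈ cjg x j M ↔ ∃ m ∈ M, x ^ j * m * (x ^ j)⁻¹ = g := by
  simp only [cjg, Subgroup.mem_map, MulEquiv.coe_toMonoidHom, MulAut.conj_apply]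

/-- `M^x ⊔ ... ⊔ M^(x^k)` -/
def upTo (x : H) (M : Subgroup H) : ℕ → Subgroup H
  | 0 => ⊥
  | k + 1 => upTo x M k ⊔ cjg x (k + 1) M

/-- product of the conjugates -/
def wProd (x y : H) : ℕ → H
  | 0 => 1
  | k + 1 => wProd x y k * (x ^ (k + 1) * y * (x ^ (k + 1))⁻¹)

lemma wProd_mem {x y : H} {M : Subgroup H} (hy : y ∈ M) (k : ℕ) : wProd x y k ∈ upTo x M k := by
  induction k with
  | zero => exact Subgroup.one_mem _
  | succ k ih =>
    exact Subgroup.mul_mem_sup ih (mem_cjg.2 ⟨y, hy, rfl⟩)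

lemma mem_sup_of_comm {A B : Subgroup H} (h : ∀ a ∈ A, ∀ b ∈ B, a * b = b * a) {g : H}
    (hg : g ∈ A ⊔ B) : ∃ a ∈ A, ∃ b ∈ B, g = a * b := by
  rw [Subgroup.sup_eq_closure] at hg
  induction hg using Subgroup.closure_induction with
  | mem g hg =>
    rcases hg with hg | hg
    · exact ⟨g, hg, 1, B.one_mem, by simp⟩
    · exact ⟨1, A.one_mem, g, hg, by simp⟩
  | one => exact ⟨1, A.one_mem, 1, B.one_mem, by simp⟩
  | mul g g' _ _ h1 h2 =>
    obtain ⟨a, ha, b, hb, rfl⟩ := h1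
    obtain ⟨a', ha', b', hb', rfl⟩ := h2
    refine ⟨a * a', A.mul_mem ha ha', b * b', B.mul_mem hb hb', ?_⟩
    have := h a' ha' b hb
    calc a * b * (a' * b') = a * (b * a') * b' := by group
      _ = _ := by rw [← this]; group
  | inv g _ h1 =>
    obtain ⟨a, ha, b, hb, rfl⟩ := h1
    refine ⟨a⁻¹, A.inv_mem ha, b⁻¹, B.inv_mem hb, ?_⟩
    rw [h a ha b hb]; group

lemma comm_sup {A B : Subgroup H} {v : H} (hA : ∀ a ∈ A, v * a = a * v)
    (hB : ∀ a ∈ B, v * a = a * v) : ∀ a ∈ A ⊔ B, v * a = a * v := by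
  have hA' : A ≤ Subgroup.centralizer {v} := fun a ha =>
    Subgroup.mem_centralizer_singleton_iff.2 (hA a ha).symm
  have hB' : B ≤ Subgroup.centralizer {v} := fun a ha =>
    Subgroup.mem_centralizer_singleton_iff.2 (hB a ha).symm
  intro a ha
  exact (Subgroup.mem_centralizer_singleton_iff.1 (sup_le hA' hB' ha)).symm

lemma core_iso (p : ℕ) (x : H) (hx : x ^ p = 1) (hp : p.Prime) (M G : Subgroup H)
    (hcomm : ∀ i j, i < p → j < p → i ≠ j → ∀ a ∈ cjg x i M, ∀ b ∈ cjg x j M, a * b = b * a)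
    (hG : M ⊔ upTo x M (p - 1) = G)
    (hZp' : ¬ p ∣ Nat.card ↥(G ⊓ Subgroup.centralizer (G : Set H)))
    (hZcent : G ⊓ Subgroup.centralizer (G : Set H) ≤ Subgroup.center H) [Finite H] :
    Nonempty (↥(G ⊓ Subgroup.centralizer {x}) ≃* ↥M) := by
  have hp0 := hp.pos
  have c0 : cjg x 0 M = M := by ext g; simp [mem_cjg]
  have hUc : ∀ k < p, ∀ j < p, (j = 0 ∨ k < j) →
      ∀ b ∈ cjg x j M, ∀ a ∈ upTo x M k, b * a = a * b := by
    intro k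
    induction k with
    | zero =>
      intro _ j _ _ b _ a ha
      rw [upTo, Subgroup.mem_bot] at ha
      simp [ha]
    | succ k ih =>
      intro hk j hj hjk b hb
      refine comm_sup (ih (by omega) j hj (by omega) b hb) ?_
      intro a ha
      exact hcomm j (k+1) hj hk (by omega) b hb a ha
  have hMU : ∀ k < p, ∀ a ∈ M, ∀ b ∈ upTo x M k, a * b = b * a := by
    intro k hk a ha
    exact hUc k hk 0 hp0 (Or.inl rfl) a (by rwa [c0])
  -- centralizing M and all conjugates gives centralizing G
  have hcenG : ∀ v : H, (∀ j < p, ∀ a ∈ cjg x j M, v * a = a * v) → ∀ a ∈ G, v * a = a * v := by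
    intro v hv
    rw [← hG]
    refine comm_sup (by simpa [c0] using hv 0 hp0) ?_
    have : ∀ k < p, ∀ a ∈ upTo x M k, v * a = a * v := by
      intro k
      induction k with
      | zero =>
        intro _ a ha
        rw [upTo, Subgroup.mem_bot] at ha
        simp [ha]
      | succ k ih =>
        intro hk
        exact comm_sup (ih (by omega)) (hv _ hk)
    exact this _ (by omega)
  have hUG : ∀ k < p, upTo x M k ≤ G := by
    have hmono : Monotone (upTo x M) := monotone_nat_of_le_succ (fun n => le_sup_left)
    intro k hk
    rw [← hG]
    exact (hmono (by omega)).trans le_sup_right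
  have hMG : M ≤ G := by rw [← hG]; exact le_sup_left
  have hcG : ∀ j < p, cjg x j M ≤ G := by
    intro j hj
    rcases j with _ | j
    · rwa [c0]
    · exact le_trans (by rw [upTo]; exact le_sup_right) (hUG _ hj)
  set Z := G ⊓ Subgroup.centralizer (G : Set H) with hZdef
  have memZ : ∀ v ∈ G, (∀ j < p, ∀ a ∈ cjg x j M, v * a = a * v) → v ∈ Z := by
    intro v hv h
    refine ⟨hv, Subgroup.mem_centralizer_iff.2 ?_⟩
    intro a ha
    exact (hcenG v h a ha).symm
  have Zc : ∀ z ∈ Z, ∀ g, z * g = g * z := by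
    intro z hz g
    exact ((Subgroup.mem_center_iff.1 (hZcent hz)) g).symm
  -- Z ∩ U k ≤ M
  have hZU : ∀ k < p, ∀ z ∈ Z, z ∈ upTo x M k → z ∈ M := by
    intro k
    induction k with
    | zero =>
      intro _ z _ hz
      rw [upTo, Subgroup.mem_bot] at hz
      rw [hz]; exact M.one_mem
    | succ k ih =>
      intro hk z hz hzU
      obtain ⟨u, hu, v, hv, rfl⟩ := mem_sup_of_comm (A := upTo x M k) (B := cjg x (k+1) M)
        (fun a ha b hb => (hUc k (by omega) (k+1) hk (Or.inr (by omega)) b hb a ha).symm) hzU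
      have hvZ : v ∈ Z := by
        refine memZ v (hcG _ hk hv) ?_
        intro j hj a ha
        by_cases hjk : k + 1 = j
        · subst hjk
          have h1 := Zc _ hz a
          have h2 := hUc k (by omega) (k+1) hk (Or.inr (by omega)) a ha u hu
          have : u * (v * a) = u * (a * v) := by
            rw [← mul_assoc, h1, ← mul_assoc, h2, mul_assoc]
          exact mul_left_cancel this
        · exact hcomm (k+1) j hk hj hjk v hv a ha
      have huZ : u ∈ Z := by
        have := Z.mul_mem hz (Z.inv_mem hvZ)
        simpa using this
      refine M.mul_mem (ih (by omega) u huZ hu) ?_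
      obtain ⟨m, hm, rfl⟩ := mem_cjg.1 hv
      have := Zc _ hvZ (x ^ (k+1))
      have h3 : x ^ (k+1) * m * (x ^ (k+1))⁻¹ = m := by
        have h4 : x ^ (k+1) * m = x ^ (k+1) * (x ^ (k+1) * m * (x ^ (k+1))⁻¹) := by
          rw [← this]; group
        exact (mul_left_cancel h4).symm
      rw [h3]; exact hm
  have hZM : Z ≤ M := by
    intro z hz
    have hzG : z ∈ M ⊔ upTo x M (p - 1) := by rw [hG]; exact hz.1
    obtain ⟨a, ha, w, hw, rfl⟩ := mem_sup_of_comm (hMU (p-1) (by omega)) hzG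
    have haZ : a ∈ Z := by
      refine memZ a (hMG ha) ?_
      intro j hj b hb
      rcases j with _ | j
      · rw [c0] at hb
        have h1 := Zc _ hz b
        have h2 := hMU (p-1) (by omega) b hb w hw
        have : (a * b) * w = (b * a) * w := by
          rw [mul_assoc, h2, ← mul_assoc, h1, mul_assoc]
        exact mul_right_cancel this
      · exact hcomm 0 (j+1) hp0 hj (by omega) a (by rwa [c0]) b hb
    have hwZ : w ∈ Z := by
      have := Z.mul_mem (Z.inv_mem haZ) hz
      simpa using this
    exact M.mul_mem ha (hZU _ (by omega) w hwZ hw)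
  -- hom property
  have hWmul : ∀ k < p, ∀ y ∈ M, ∀ z ∈ M, wProd x (y * z) k = wProd x y k * wProd x z k := by
    intro k
    induction k with
    | zero => intro _ y _ z _; simp [wProd]
    | succ k ih =>
      intro hk y hy z hz
      rw [wProd, wProd, wProd, ih (by omega) y hy z hz]
      have := hUc k (by omega) (k+1) hk (Or.inr (by omega)) _ (mem_cjg.2 ⟨y, hy, rfl⟩) _
        (wProd_mem hz k)
      calc _ = wProd x y k * (wProd x z k * (x ^ (k + 1) * y * (x ^ (k + 1))⁻¹)) *
                (x ^ (k + 1) * z * (x ^ (k + 1))⁻¹) := by group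
        _ = _ := by rw [← this]; group
  have hWpow : ∀ k, ∀ y, y * wProd x y k = (y * x) ^ (k + 1) * (x ^ (k + 1))⁻¹ := by
    intro k y
    induction k with
    | zero => simp [wProd]
    | succ k ih =>
      rw [wProd, ← mul_assoc, ih, pow_succ (y * x) (k+1), pow_succ x (k+1)]
      group
  have hφpow : ∀ y, y * wProd x y (p - 1) = (y * x) ^ p := by
    intro y
    rw [hWpow, Nat.sub_add_cancel hp0, hx]; simp
  have hφG : ∀ y ∈ M, y * wProd x y (p-1) ∈ G := fun y hy =>
    G.mul_mem (hMG hy) (hUG _ (by omega) (wProd_mem hy _))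
  have hφx : ∀ y ∈ M, y * wProd x y (p-1) ∈ Subgroup.centralizer {x} := by
    intro y hy
    rw [Subgroup.mem_centralizer_singleton_iff]
    have h1 := hMU (p-1) (by omega) y hy _ (wProd_mem hy (p-1))
    have h2 : y * (y * wProd x y (p-1)) = (y * wProd x y (p-1)) * y := by
      rw [h1, ← mul_assoc, h1]
    rw [hφpow] at h2 ⊢
    have h3 : (y * x) * (y * x) ^ p = (y * x) ^ p * (y * x) := by
      rw [← pow_succ, ← pow_succ']
    have h4 : y * ((y * x) ^ p * x) = y * (x * (y * x) ^ p) := by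
      rw [← mul_assoc, h2, mul_assoc, ← h3, mul_assoc]
    exact mul_left_cancel h4
  let φ : M →* ↥(G ⊓ Subgroup.centralizer {x}) :=
    { toFun := fun y => ⟨y * wProd x y (p-1), hφG y y.2, hφx y y.2⟩
      map_one' := by
        apply Subtype.ext
        simp only [OneMemClass.coe_one]
        rw [hφpow, one_mul, hx]
      map_mul' := by
        intro y z
        apply Subtype.ext
        simp only [Subgroup.coe_mul]
        rw [hWmul _ (by omega) y y.2 z z.2]
        have := hMU (p-1) (by omega) z z.2 _ (wProd_mem y.2 (p-1))
        calc (y * z * (wProd x y (p-1) * wProd x z (p-1)) : H)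
            = y * (z * wProd x y (p-1)) * wProd x z (p-1) := by group
          _ = _ := by rw [this]; group }
  have hφZ : ∀ z ∈ Z, z * wProd x z (p - 1) = z ^ p := by
    intro z hz
    rw [hφpow, Commute.mul_pow (Zc z hz x), hx, mul_one]
  have hcop : (Nat.card Z).Coprime p := ((Nat.Prime.coprime_iff_not_dvd hp).2 hZp').symm
  refine ⟨(MulEquiv.ofBijective φ ⟨?_, ?_⟩).symm⟩
  · rw [injective_iff_map_eq_one]
    rintro ⟨y, hy⟩ h
    have h1 : y * wProd x y (p-1) = 1 := congrArg Subtype.val h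
    have hyZ : y ∈ Z := by
      refine memZ y (hMG hy) ?_
      intro j hj b hb
      rcases j with _ | j
      · rw [c0] at hb
        have h2 := hMU (p-1) (by omega) b hb _ (wProd_mem hy (p-1))
        have h3 : y = (wProd x y (p-1))⁻¹ := eq_inv_of_mul_eq_one_left h1
        have h4 : Commute b (wProd x y (p-1)) := h2
        have h5 := h4.inv_right
        rw [← h3] at h5
        exact h5.symm
      · exact hcomm 0 (j+1) hp0 hj (by omega) y (by rwa [c0]) b hb
    rw [hφZ y hyZ] at h1
    have h6 : (powCoprime hcop) ⟨y, hyZ⟩ = (powCoprime hcop) 1 := by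
      apply Subtype.ext
      simp [powCoprime, h1]
    have h7 := congrArg Subtype.val ((powCoprime hcop).injective h6)
    exact Subtype.ext h7
  · rintro ⟨g, hgG, hgx⟩
    replace hgx := Subgroup.mem_centralizer_singleton_iff.1 hgx
    have hgG' : g ∈ M ⊔ upTo x M (p - 1) := by rw [hG]; exact hgG
    obtain ⟨a, ha, w, hw, hg⟩ := mem_sup_of_comm (hMU (p-1) (by omega)) hgG'
    obtain ⟨h, hh⟩ : ∃ h, h = (a * wProd x a (p-1))⁻¹ * g := ⟨_, rfl⟩
    have hhU : h ∈ upTo x M (p-1) := by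
      rw [hh, hg]
      have : (a * wProd x a (p-1))⁻¹ * (a * w) = (wProd x a (p-1))⁻¹ * w := by group
      rw [this]
      exact Subgroup.mul_mem _ (Subgroup.inv_mem _ (wProd_mem ha _)) hw
    have hhx : h * x = x * h := by
      have h1 := hφx a ha
      have h2 : g ∈ Subgroup.centralizer {x} := Subgroup.mem_centralizer_singleton_iff.2 hgx
      have h3 := Subgroup.mul_mem _ (Subgroup.inv_mem _ h1) h2
      rw [← hh] at h3
      exact Subgroup.mem_centralizer_singleton_iff.1 h3
    have hhZ : h ∈ Z := by
      refine memZ h (hUG _ (by omega) hhU) ?_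
      intro j hj b hb
      obtain ⟨m, hm, rfl⟩ := mem_cjg.1 hb
      have h1 : Commute h (x ^ j) := (show Commute h x from hhx).pow_right j
      have h2 : Commute h m := (hMU _ (by omega) m hm h hhU).symm
      exact (h1.mul_right h2).mul_right h1.inv_right
    obtain ⟨⟨k, hk⟩, hkp⟩ := (powCoprime hcop).surjective ⟨h, hhZ⟩
    have hkp' : k ^ p = h := by
      have := congrArg Subtype.val hkp
      simpa [powCoprime] using this
    refine ⟨⟨a, ha⟩ * ⟨k, hZM hk⟩, ?_⟩
    rw [map_mul]
    apply Subtype.ext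
    change (a * wProd x a (p-1)) * (k * wProd x k (p-1)) = g
    rw [hφZ k hk, hkp', hh]; group
end Core

section Comp
variable {H : Type} [Group H]

/-- normal-in relation on subgroups -/
def NrmIn (A B : Subgroup H) : Prop := A ≤ B ∧ ∀ h k, h ∈ A → k ∈ B → k * h * k⁻¹ ∈ A

lemma SubnormalIn.toRel {K G : Subgroup H} (h : SubnormalIn K G) :
    Relation.ReflTransGen NrmIn K G := by
  obtain ⟨n, s, h0, hn, hs⟩ := h
  have : ∀ k ≤ n, Relation.ReflTransGen NrmIn (s 0) (s k) := by
    intro k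
    induction k with
    | zero => intro _; exact Relation.ReflTransGen.refl
    | succ k ih =>
      intro hk
      refine (ih (by omega)).tail ?_
      obtain ⟨h1, h2⟩ := hs k (by omega)
      exact ⟨h1, (Subgroup.normal_subgroupOf_iff h1).1 h2⟩
  rw [← h0, ← hn]
  exact this n le_rfl

lemma rel_le {K G : Subgroup H} (h : Relation.ReflTransGen NrmIn K G) : K ≤ G := by
  induction h with
  | refl => exact le_rfl
  | tail _ h ih => exact ih.trans h.1

lemma rel_inf {K G : Subgroup H} (C : Subgroup H) (h : Relation.ReflTransGen NrmIn K G) :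
    Relation.ReflTransGen NrmIn (K ⊓ C) (G ⊓ C) := by
  refine Relation.ReflTransGen.lift (f := fun A => A ⊓ C) ?_ _ _ h
  rintro A B ⟨h1, h2⟩
  refine ⟨inf_le_inf_right _ h1, ?_⟩
  intro h k hh hk
  exact ⟨h2 h k hh.1 hk.1, C.mul_mem (C.mul_mem hk.2 hh.2) (C.inv_mem hk.2)⟩

lemma rel_proper {K G : Subgroup H} (h : Relation.ReflTransGen NrmIn K G) (hne : K ≠ G) :
    ∃ K1, Relation.ReflTransGen NrmIn K K1 ∧ NrmIn K1 G ∧ K1 < G := by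
  induction h with
  | refl => exact absurd rfl hne
  | @tail b c h1 h2 ih =>
    by_cases hbc : b = c
    · subst hbc; exact ih hne
    · exact ⟨b, h1, h2, lt_of_le_of_ne h2.1 hbc⟩

lemma qs_normal {K A : Subgroup H} (hK : IsQuasiSimple K) (hA : NrmIn A K) (hne : A ≠ K) :
    ⁅K, A⁆ = ⊥ := by
  obtain ⟨hperf, hsimp⟩ := hK
  have hN : (A.subgroupOf K).Normal := (Subgroup.normal_subgroupOf_iff hA.1).2 hA.2
  have hN' := hN.map (QuotientGroup.mk' (Subgroup.center K)) (QuotientGroup.mk'_surjective _)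
  rcases hN'.eq_bot_or_eq_top with h | h
  · rw [Subgroup.map_eq_bot_iff, QuotientGroup.ker_mk'] at h
    rw [Subgroup.commutator_comm, Subgroup.commutator_eq_bot_iff_le_centralizer]
    intro a ha
    rw [Subgroup.mem_centralizer_iff]
    intro k hk
    have h1 : (⟨a, hA.1 ha⟩ : K) ∈ Subgroup.center K := h (by
      rw [Subgroup.mem_subgroupOf]; exact ha)
    have := (Subgroup.mem_center_iff.1 h1) ⟨k, hk⟩
    exact congrArg Subtype.val this
  · exfalso
    have h1 : A.subgroupOf K ⊔ Subgroup.center K = ⊤ := by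
      have := congrArg (Subgroup.comap (QuotientGroup.mk' (Subgroup.center K))) h
      rw [Subgroup.comap_map_eq, QuotientGroup.ker_mk', Subgroup.comap_top] at this
      exact this
    have h2 : commutator K ≤ A.subgroupOf K := by
      rw [commutator_def, Subgroup.commutator_le]
      have hc : ∀ a ∈ A.subgroupOf K, ∀ b ∈ Subgroup.center K, a * b = b * a :=
        fun a _ b hb => Subgroup.mem_center_iff.1 hb a
      intro g _ g' _
      obtain ⟨a, ha, z, hz, rfl⟩ := mem_sup_of_comm hc (g := g) (by rw [h1]; trivial)
      obtain ⟨a', ha', z', hz', rfl⟩ := mem_sup_of_comm hc (g := g') (by rw [h1]; trivial)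
      have e : a * z * (a' * z') * (a * z)⁻¹ * (a' * z')⁻¹ = a * a' * a⁻¹ * a'⁻¹ := by
        have hz1 := Subgroup.mem_center_iff.1 hz
        have hz1' := Subgroup.mem_center_iff.1 hz'
        calc a * z * (a' * z') * (a * z)⁻¹ * (a' * z')⁻¹
            = a * (z * (a' * z')) * (z⁻¹ * a⁻¹ * (z'⁻¹ * a'⁻¹)) := by group
          _ = a * a' * (z' * a⁻¹) * (z'⁻¹ * a'⁻¹) := by rw [← hz1]; group
          _ = _ := by rw [← hz1']; group
      rw [commutatorElement_def, e]
      exact Subgroup.mul_mem _ (Subgroup.mul_mem _ (Subgroup.mul_mem _ ha ha')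
        (Subgroup.inv_mem _ ha)) (Subgroup.inv_mem _ ha')
    rw [hperf, top_le_iff, Subgroup.subgroupOf_eq_top] at h2
    exact hne (le_antisymm hA.1 h2)

lemma comp_le_or_comm [Finite H] (G : Subgroup H) : ∀ K N : Subgroup H,
    Relation.ReflTransGen NrmIn K G → IsQuasiSimple K → Relation.ReflTransGen NrmIn N G →
    K ≤ N ∨ ⁅K, N⁆ = ⊥ := by
  induction G using WellFoundedLT.induction with
  | ind G ih =>
  intro K N hKG hK hNG
  by_cases hN : N = G
  · left; rw [hN]; exact rel_le hKG
  obtain ⟨N1, hNN1, hN1G, hN1lt⟩ := rel_proper hNG hN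
  by_cases hKe : K = G
  · subst hKe
    right
    have := qs_normal hK hN1G hN1lt.ne
    rw [eq_bot_iff, ← this]
    exact Subgroup.commutator_mono le_rfl (rel_le hNN1)
  obtain ⟨K1, hKK1, hK1G, hK1lt⟩ := rel_proper hKG hKe
  by_cases hKN1 : K ≤ N1
  · have h := rel_inf N1 hKG
    rw [inf_eq_left.2 hKN1, inf_eq_right.2 hN1lt.le] at h
    exact ih N1 hN1lt K N h hK hNN1
  · right
    have hD : NrmIn (N1 ⊓ K1) K1 := by
      refine ⟨inf_le_right, ?_⟩
      intro h k hh hk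
      exact ⟨hN1G.2 h k hh.1 (hK1lt.le hk),
        K1.mul_mem (K1.mul_mem hk hh.2) (K1.inv_mem hk)⟩
    have h1 : ⁅K, N1 ⊓ K1⁆ = ⊥ := by
      rcases ih K1 hK1lt K (N1 ⊓ K1) hKK1 hK (Relation.ReflTransGen.single hD) with h | h
      · exact absurd (h.trans inf_le_left) hKN1
      · exact h
    have h2 : ⁅K, N⁆ ≤ N1 ⊓ K1 := by
      rw [Subgroup.commutator_le]
      intro k hk n hn
      have hk1 := rel_le hKK1 hk
      have hn1 := rel_le hNN1 hn
      rw [commutatorElement_def]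
      refine ⟨?_, ?_⟩
      · exact N1.mul_mem (hN1G.2 n k hn1 (hK1lt.le hk1)) (N1.inv_mem hn1)
      · have := K1.mul_mem hk1 (hK1G.2 k⁻¹ n (K1.inv_mem hk1) (hN1lt.le hn1))
        have e : k * n * k⁻¹ * n⁻¹ = k * (n * k⁻¹ * n⁻¹) := by group
        rw [e]; exact this
    have h3 : ⁅⁅K, N⁆, K⁆ = ⊥ := by
      rw [Subgroup.commutator_comm, eq_bot_iff, ← h1]
      exact Subgroup.commutator_mono le_rfl h2
    have h4 : ⁅⁅N, K⁆, K⁆ = ⊥ := by rw [Subgroup.commutator_comm N K]; exact h3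
    have h5 := Subgroup.commutator_commutator_eq_bot_of_rotate h3 h4
    have h6 : ⁅K, K⁆ = K := Subgroup.isPerfect_iff.1 ⟨hK.1⟩
    rwa [h6] at h5

lemma comp_comm [Finite H] {G K K' : Subgroup H} (h : IsComponentOf G K)
    (h' : IsComponentOf G K') (hne : K ≠ K') : K ≤ Subgroup.centralizer K' := by
  rw [← Subgroup.commutator_eq_bot_iff_le_centralizer]
  rcases comp_le_or_comm G K K' h.1.toRel h.2 h'.1.toRel with h1 | h1
  · rcases comp_le_or_comm G K' K h'.1.toRel h'.2 h.1.toRel with h2 | h2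
    · exact absurd (le_antisymm h1 h2) hne
    · rw [Subgroup.commutator_comm]; exact h2
  · exact h1

lemma qs_congr {K K' : Subgroup H} (e : K ≃* K') (h : IsQuasiSimple K) : IsQuasiSimple K' := by
  obtain ⟨h1, h2⟩ := h
  refine ⟨?_, ?_⟩
  · have : Group.IsPerfect K := ⟨h1⟩
    exact (Group.IsPerfect.ofSurjective (f := e.toMonoidHom) e.surjective).commutator_eq_top
  · have hc : (Subgroup.center K).map e.toMonoidHom = Subgroup.center K' := by
      ext g
      rw [Subgroup.mem_map_equiv, Subgroup.mem_center_iff, Subgroup.mem_center_iff]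
      constructor
      · intro hg k
        have := congrArg e (hg (e.symm k))
        simpa using this
      · intro hg k
        apply e.injective
        simpa using hg (e k)
    exact (QuotientGroup.congr _ _ e hc).symm.isSimpleGroup

lemma comp_conj {G K : Subgroup H} (hG : G.Normal) (h : IsComponentOf G K) (g : H) :
    IsComponentOf G (K.map (MulAut.conj g).toMonoidHom) := by
  obtain ⟨⟨n, s, h0, hn, hs⟩, hq⟩ := h
  refine ⟨⟨n, fun i => (s i).map (MulAut.conj g).toMonoidHom, by simp only [h0], ?_, ?_⟩, ?_⟩
  · dsimp only
    rw [hn]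
    ext y
    rw [Subgroup.mem_map_equiv]
    rw [MulAut.conj_symm_apply]
    constructor
    · intro hy
      have := hG.conj_mem _ hy g
      have e : g * (g⁻¹ * y * g) * g⁻¹ = y := by group
      rwa [e] at this
    · intro hy
      have := hG.conj_mem _ hy g⁻¹
      rwa [inv_inv] at this
  · intro i hi
    obtain ⟨a, b⟩ := hs i hi
    refine ⟨Subgroup.map_mono a, ?_⟩
    rw [Subgroup.normal_subgroupOf_iff_le_normalizer a] at b
    exact Subgroup.normal_subgroupOf_of_le_normalizer
      ((Subgroup.map_mono b).trans (Subgroup.le_normalizer_map _))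
  · exact qs_congr (K.equivMapOfInjective _ (MulAut.conj g).injective) hq

lemma cjg_cjg (x : H) (i j : ℕ) (K : Subgroup H) : cjg x i (cjg x j K) = cjg x (i + j) K := by
  rw [cjg, cjg, cjg, Subgroup.map_map]
  congr 1
  ext y
  simp [pow_add]

lemma cjg_congr {x : H} {i j : ℕ} (h : x ^ i = x ^ j) (K : Subgroup H) :
    cjg x i K = cjg x j K := by
  rw [cjg, cjg, h]

lemma cjg_zero (x : H) (K : Subgroup H) : cjg x 0 K = K := by
  ext g; simp [mem_cjg]

lemma cjg_mul {x : H} {d : ℕ} {K : Subgroup H} (h : cjg x d K = K) (m : ℕ) :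
    cjg x (d * m) K = K := by
  induction m with
  | zero => exact cjg_zero x K
  | succ m ih => rw [Nat.mul_succ, ← cjg_cjg, h, ih]

end Comp

/-- Let `G = E(G)` be a perfect normal subgroup of `H` whose center
`Z = Z(G) = G ⊓ C_H(G)` is a cyclic `p'`-group central in `H`, with all components
of `G` conjugate in `H`, and let `x ∈ H` have order `p` and permute the components
of `G` semi-regularly. Then `C_G(x)` is isomorphic to the central product of a set
of components of `G`, one from each `⟨x⟩`-orbit; in particular `C_G(x)` is perfect. -/
theorem centralizer_iso_central_product_of_components
    (p : ℕ) (hp : p.Prime) (H : Type) [Group H] [Finite H]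
    (G : Subgroup H) (hGnorm : G.Normal)
    (hGperf : commutator ↥G = ⊤)
    (hE : (⨆ K ∈ {K : Subgroup H | IsComponentOf G K}, K) = G)
    (hZcyc : IsCyclic ↥(G ⊓ Subgroup.centralizer (G : Set H)))
    (hZp' : ¬ p ∣ Nat.card ↥(G ⊓ Subgroup.centralizer (G : Set H)))
    (hZcent : G ⊓ Subgroup.centralizer (G : Set H) ≤ Subgroup.center H)
    (hconj : ∀ K K' : Subgroup H, IsComponentOf G K → IsComponentOf G K' →
      ∃ h : H, K' = K.map (MulAut.conj h).toMonoidHom)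
    (x : H) (hx : orderOf x = p)
    (hsemireg : ∀ K : Subgroup H, IsComponentOf G K →
      K.map (MulAut.conj x).toMonoidHom ≠ K) :
    ∃ R : Set (Subgroup H),
      (∀ L ∈ R, IsComponentOf G L) ∧
      (∀ K : Subgroup H, IsComponentOf G K →
        ∃ L ∈ R, ∃ j : ℕ, K = L.map (MulAut.conj (x ^ j)).toMonoidHom) ∧
      (∀ L ∈ R, ∀ L' ∈ R,
        (∃ j : ℕ, L' = L.map (MulAut.conj (x ^ j)).toMonoidHom) → L = L') ∧
      Nonempty (↥(G ⊓ Subgroup.centralizer {x}) ≃* ↥(⨆ L ∈ R, L)) ∧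
      commutator ↥(G ⊓ Subgroup.centralizer {x}) = ⊤ := by
  classical
  have hxp : x ^ p = 1 := by rw [← hx]; exact pow_orderOf_eq_one x
  have hp0 := hp.pos
  let s : Setoid (Subgroup H) :=
    { r := fun K K' => ∃ j : ℕ, K' = cjg x j K
      iseqv :=
        { refl := fun K => ⟨0, (cjg_zero x K).symm⟩
          symm := by
            rintro K K' ⟨j, rfl⟩
            refine ⟨p * j - j, ?_⟩
            have hle : j ≤ p * j := Nat.le_mul_of_pos_left j hp0
            rw [cjg_cjg, Nat.sub_add_cancel hle]
            refine (cjg_zero x K).symm.trans (cjg_congr ?_ K)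
            rw [pow_mul, hxp, one_pow, pow_zero]
          trans := by
            rintro K K' K'' ⟨i, rfl⟩ ⟨j, rfl⟩
            exact ⟨j + i, cjg_cjg x j i K⟩ } }
  have hcc : ∀ (j : ℕ) (K : Subgroup H), IsComponentOf G K → IsComponentOf G (cjg x j K) :=
    fun j K hK => comp_conj hGnorm hK _
  let R : Set (Subgroup H) := {L | IsComponentOf G L ∧ (Quotient.mk s L).out = L}
  have hR1 : ∀ L ∈ R, IsComponentOf G L := fun L hL => hL.1
  have hR2 : ∀ K : Subgroup H, IsComponentOf G K → ∃ L ∈ R, ∃ j : ℕ, K = cjg x j L := by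
    intro K hK
    have h1 : s.r (Quotient.mk s K).out K := Quotient.mk_out (s := s) K
    obtain ⟨j, hj⟩ := s.iseqv.symm h1
    refine ⟨(Quotient.mk s K).out, ⟨?_, ?_⟩, h1⟩
    · rw [hj]; exact hcc j K hK
    · rw [Quotient.out_eq]
  have hR3 : ∀ L ∈ R, ∀ L' ∈ R, (∃ j : ℕ, L' = cjg x j L) → L = L' := by
    intro L hL L' hL' h
    have h1 : Quotient.mk s L = Quotient.mk s L' := Quotient.sound h
    rw [← hL.2, ← hL'.2, h1]
  obtain ⟨M, hM⟩ : ∃ M : Subgroup H, M = ⨆ L ∈ R, L := ⟨_, rfl⟩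
  have hLM : ∀ L ∈ R, L ≤ M := by
    intro L hL; rw [hM]; exact le_iSup₂_of_le L hL le_rfl
  have hcM : ∀ j, cjg x j M = ⨆ L ∈ R, cjg x j L := by
    intro j
    rw [hM, cjg]
    simp only [Subgroup.map_iSup]
    rfl
  have hne : ∀ i j, i < p → j < p → i ≠ j → ∀ L ∈ R, ∀ L' ∈ R, cjg x i L ≠ cjg x j L' := by
    intro i j hi hj hij L hL L' hL' h
    have h1 := congrArg (cjg x (p - i)) h
    rw [cjg_cjg, cjg_cjg, Nat.sub_add_cancel hi.le] at h1
    have h2 : cjg x p L = L := (cjg_congr (by rw [hxp, pow_zero]) L).trans (cjg_zero x L)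
    rw [h2] at h1
    have h3 : L' = L := hR3 L' hL' L hL ⟨_, h1⟩
    subst h3
    have hnd : ¬ p ∣ (p - i + j) := by
      intro hd
      obtain ⟨c, hc⟩ := hd
      have hc1 : c = 1 := by
        have h5 : 0 < c := by
          rcases Nat.eq_zero_or_pos c with h | h
          · subst h; omega
          · exact h
        have h6 : c < 2 := by
          by_contra hcon
          have : p * 2 ≤ p * c := Nat.mul_le_mul_left p (by omega)
          omega
        omega
      subst hc1
      omega
    have hco : (p - i + j).Coprime p := ((Nat.Prime.coprime_iff_not_dvd hp).2 hnd).symm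
    obtain ⟨m, hm⟩ := Nat.exists_mul_mod_eq_one_of_coprime hco hp.one_lt
    have h4 := cjg_mul h1.symm m
    have h5 : x ^ ((p - i + j) * m) = x ^ 1 := by
      rw [pow_eq_pow_iff_modEq, hx, Nat.ModEq, hm.2, Nat.mod_eq_of_lt hp.one_lt]
    rw [cjg_congr h5] at h4
    apply hsemireg L' (hR1 _ hL)
    rw [cjg, pow_one] at h4
    exact h4
  have hcomm : ∀ i j, i < p → j < p → i ≠ j →
      ∀ a ∈ cjg x i M, ∀ b ∈ cjg x j M, a * b = b * a := by
    intro i j hi hj hij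
    have h1 : cjg x i M ≤ Subgroup.centralizer (cjg x j M) := by
      rw [hcM i]
      refine iSup₂_le ?_
      intro L hL
      rw [Subgroup.le_centralizer_iff, hcM j]
      refine iSup₂_le ?_
      intro L' hL'
      exact comp_comm (hcc _ _ (hR1 _ hL')) (hcc _ _ (hR1 _ hL))
        (hne j i hj hi hij.symm L' hL' L hL)
    intro a ha b hb
    exact (Subgroup.mem_centralizer_iff.1 (h1 ha) b hb).symm
  have hcompG : ∀ K, IsComponentOf G K → K ≤ G := fun K hK => rel_le hK.1.toRel
  have hcG : ∀ j, cjg x j M ≤ G := by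
    intro j
    rw [hcM]
    exact iSup₂_le fun L hL => hcompG _ (hcc _ _ (hR1 _ hL))
  have hmono : Monotone (upTo x M) := monotone_nat_of_le_succ (fun n => le_sup_left)
  have hcup : ∀ j < p, cjg x j M ≤ M ⊔ upTo x M (p - 1) := by
    intro j hj
    rcases j with _ | j
    · rw [cjg_zero]; exact le_sup_left
    · refine le_trans ?_ ((hmono (show j + 1 ≤ p - 1 by omega)).trans le_sup_right)
      rw [upTo]; exact le_sup_right
  have hG : M ⊔ upTo x M (p - 1) = G := by
    apply le_antisymm
    · refine sup_le ?_ ?_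
      · have := hcG 0
        rwa [cjg_zero] at this
      · have : ∀ k, upTo x M k ≤ G := by
          intro k
          induction k with
          | zero => exact bot_le
          | succ k ih => exact sup_le ih (hcG _)
        exact this _
    · conv_lhs => rw [← hE]
      refine iSup₂_le ?_
      intro K hK
      obtain ⟨L, hL, j, rfl⟩ := hR2 K hK
      have h1 : cjg x j L = cjg x (j % p) L := cjg_congr (by
        rw [pow_eq_pow_iff_modEq, hx]; exact (Nat.mod_modEq j p).symm) L
      rw [h1]
      exact (Subgroup.map_mono (hLM L hL)).trans (hcup _ (Nat.mod_lt _ hp0))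
  obtain ⟨e⟩ := core_iso p x hxp hp M G hcomm hG hZp' hZcent
  have hMperf : Group.IsPerfect M := by
    rw [Subgroup.isPerfect_iff]
    apply le_antisymm
    · exact Subgroup.commutator_le_self M
    · conv_lhs => rw [hM]
      refine iSup₂_le ?_
      intro L hL
      have h6 : ⁅L, L⁆ = L := Subgroup.isPerfect_iff.1 ⟨(hR1 L hL).2.1⟩
      rw [← h6]
      exact Subgroup.commutator_mono (hLM L hL) (hLM L hL)
  refine ⟨R, hR1, hR2, hR3, ?_, ?_⟩
  · rw [← hM]; exact ⟨e⟩
  · exact (Group.IsPerfect.ofSurjective (f := e.symm.toMonoidHom)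
      e.symm.surjective).commutator_eq_top
end
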